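/- Under the steady assumptions (H1)–(H3), assume (sur-sol-stricte): for every δ>0 there exist ψ_δ ∈ C²(ℝ^N) and a bounded open set Ω_δ ⊂ ℝ^N with [0,1]^N ⊂ Ω_δ such that ψ_δ ≤ 0 on Ω_δ, ψ_δ ≥ 0 on the complement of Ω_δ, and inf_{θ∈Θ}{−trace(Ã_θ(x̃)D²ψ_δ(x̃))} − C|Dψ_δ(x̃)| > 0 for every x̃ ∈ Ω_δ with dist(x̃, Σ̃) > δ, where Ã_θ and Σ̃ denote the ℤ^N-periodic lifts of A_θ and Σ to ℝ^N. Assume moreover either [each H_θ(x,·) convex on ℝ^N and (cvx_neuf): for every x∈Σ, every 0<λ<1 and all p≠q in ℝ^N, inf_{θ∈Θ}{λH_θ(x,p)+(1−λ)H_θ(x,q)−H_θ(x,λp+(1−λ)q)} > 0], or [(H10): there exists μ₀>1 such that (i) H_θ(x,μp)−μH_θ(x,p) ≥ (1−μ)c for all x,p,θ and 1<μ<μ₀, and (ii) there exists a possibly empty compact K ⊂ Σ with H_θ(x,p) ≥ c on K×ℝ^N for all θ, and inf_{θ∈Θ}{H_θ(x,μp)−μH_θ(x,p)} > (1−μ)c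 for all x∈Σ with dist(x,K)≠0, p≠0 and 1<μ≤μ₀]. Then the viscosity solution u of the Cauchy problem (CP) satisfies u(x,t)+ct → u_∞(x) uniformly on 𝕋^N as t→+∞, where u_∞ is a Lipschitz viscosity solution of the ergodic problem. -/

import Mathlib

open Filter
open scoped RealInnerProductSpace Matrix

noncomputable section

namespace LargeTimeBehavior

/-- Euclidean space ℝ^N; ℤ^N-periodic functions on it represent functions on the torus 𝕋^N. -/
abbrev E (N : ℕ) := EuclideanSpace ℝ (Fin N)

variable {N : ℕ} {Θ : Type*}

/-- `f` is ℤ^N-periodic. -/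
def ZPeriodic {α : Type*} (f : E N → α) : Prop :=
  ∀ (x : E N) (k : Fin N → ℤ), f (x + (WithLp.equiv 2 (Fin N → ℝ)).symm fun i => (k i : ℝ)) = f x

/-- Hessian matrix of a real function on ℝ^N. -/
def hessMatrix (φ : E N → ℝ) (x : E N) : Matrix (Fin N) (Fin N) ℝ :=
  Matrix.of fun i j =>
    fderiv ℝ (fun y => fderiv ℝ φ y (EuclideanSpace.single j 1)) x (EuclideanSpace.single i 1)

/-- The totally degenerate set Σ = {x : A_θ(x) = 0 for all θ}. -/
def degenSet (A : Θ → E N → Matrix (Fin N) (Fin N) ℝ) : Set (E N) :=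
  {x | ∀ θ, A θ x = 0}

/-- Value of the operator −trace(A_θ(x)D²φ) + H_θ(x,Dφ) on a C² test function φ at x. -/
def opVal (A : Θ → E N → Matrix (Fin N) (Fin N) ℝ) (H : Θ → E N → E N → ℝ)
    (θ : Θ) (x : E N) (φ : E N → ℝ) : ℝ :=
  -Matrix.trace (A θ x * hessMatrix φ x) + H θ x (gradient φ x)

/-- Viscosity subsolution of ∂u/∂t + sup_θ{−tr(A_θD²u)+H_θ(x,Du)} = 0 on ℝ^N×(0,∞). -/
def IsSubSolCP (A : Θ → E N → Matrix (Fin N) (Fin N) ℝ) (H : Θ → E N → E N → ℝ)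
    (u : E N → ℝ → ℝ) : Prop :=
  ∀ φ : E N → ℝ → ℝ, ContDiff ℝ 2 (fun q : E N × ℝ => φ q.1 q.2) →
    ∀ (x₀ : E N) (t₀ : ℝ), 0 < t₀ →
      IsLocalMax (fun q : E N × ℝ => u q.1 q.2 - φ q.1 q.2) (x₀, t₀) →
      deriv (φ x₀) t₀ + (⨆ θ, opVal A H θ x₀ fun y => φ y t₀) ≤ 0

/-- Viscosity supersolution of the Cauchy problem. -/
def IsSuperSolCP (A : Θ → E N → Matrix (Fin N) (Fin N) ℝ) (H : Θ → E N → E N → ℝ)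
    (u : E N → ℝ → ℝ) : Prop :=
  ∀ φ : E N → ℝ → ℝ, ContDiff ℝ 2 (fun q : E N × ℝ => φ q.1 q.2) →
    ∀ (x₀ : E N) (t₀ : ℝ), 0 < t₀ →
      IsLocalMin (fun q : E N × ℝ => u q.1 q.2 - φ q.1 q.2) (x₀, t₀) →
      0 ≤ deriv (φ x₀) t₀ + (⨆ θ, opVal A H θ x₀ fun y => φ y t₀)

/-- Viscosity solution of the Cauchy problem. -/
def IsSolCP (A : Θ → E N → Matrix (Fin N) (Fin N) ℝ) (H : Θ → E N → E N → ℝ)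
    (u : E N → ℝ → ℝ) : Prop :=
  IsSubSolCP A H u ∧ IsSuperSolCP A H u

/-- Viscosity subsolution of the ergodic problem sup_θ{−tr(A_θD²v)+H_θ(x,Dv)} = c. -/
def IsSubSolErg (A : Θ → E N → Matrix (Fin N) (Fin N) ℝ) (H : Θ → E N → E N → ℝ)
    (c : ℝ) (v : E N → ℝ) : Prop :=
  ∀ φ : E N → ℝ, ContDiff ℝ 2 φ → ∀ x₀ : E N,
    IsLocalMax (fun x => v x - φ x) x₀ → (⨆ θ, opVal A H θ x₀ φ) ≤ c

/-- Viscosity supersolution of the ergodic problem. -/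
def IsSuperSolErg (A : Θ → E N → Matrix (Fin N) (Fin N) ℝ) (H : Θ → E N → E N → ℝ)
    (c : ℝ) (v : E N → ℝ) : Prop :=
  ∀ φ : E N → ℝ, ContDiff ℝ 2 φ → ∀ x₀ : E N,
    IsLocalMin (fun x => v x - φ x) x₀ → c ≤ (⨆ θ, opVal A H θ x₀ φ)

/-- Viscosity solution of the ergodic problem. -/
def IsSolErg (A : Θ → E N → Matrix (Fin N) (Fin N) ℝ) (H : Θ → E N → E N → ℝ)
    (c : ℝ) (v : E N → ℝ) : Prop :=
  IsSubSolErg A H c v ∧ IsSuperSolErg A H c v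

/-- Viscosity subsolution of the discounted equation λw + sup_θ{−tr(A_θD²w)+H_θ(x,Dw)} = 0. -/
def IsSubSolDisc (A : Θ → E N → Matrix (Fin N) (Fin N) ℝ) (H : Θ → E N → E N → ℝ)
    (lam : ℝ) (w : E N → ℝ) : Prop :=
  ∀ φ : E N → ℝ, ContDiff ℝ 2 φ → ∀ x₀ : E N,
    IsLocalMax (fun x => w x - φ x) x₀ → lam * w x₀ + (⨆ θ, opVal A H θ x₀ φ) ≤ 0

/-- Viscosity supersolution of the discounted equation. -/
def IsSuperSolDisc (A : Θ → E N → Matrix (Fin N) (Fin N) ℝ) (H : Θ → E N → E N → ℝ)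
    (lam : ℝ) (w : E N → ℝ) : Prop :=
  ∀ φ : E N → ℝ, ContDiff ℝ 2 φ → ∀ x₀ : E N,
    IsLocalMin (fun x => w x - φ x) x₀ → 0 ≤ lam * w x₀ + (⨆ θ, opVal A H θ x₀ φ)

/-- Viscosity solution of the discounted equation. -/
def IsSolDisc (A : Θ → E N → Matrix (Fin N) (Fin N) ℝ) (H : Θ → E N → E N → ℝ)
    (lam : ℝ) (w : E N → ℝ) : Prop :=
  IsSubSolDisc A H lam w ∧ IsSuperSolDisc A H lam w

/-- P_{ημ}[u](x,t) = sup_{s ≥ t} { u(x,t) − v(x) − μ(u(x,s) − v(x)) − μη(s−t) }. -/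
def Pfun (u : E N → ℝ → ℝ) (v : E N → ℝ) (η μ : ℝ) (x : E N) (t : ℝ) : ℝ :=
  sSup ((fun s => u x t - v x - μ * (u x s - v x) - μ * η * (s - t)) '' Set.Ici t)

/-- M_{ημ}[u](t) = sup_x P_{ημ}[u](x,t). -/
def Mfun (u : E N → ℝ → ℝ) (v : E N → ℝ) (η μ : ℝ) (t : ℝ) : ℝ :=
  sSup (Set.range fun x : E N => Pfun u v η μ x t)

/-- Viscosity subsolution of
  min{ U , ∂U/∂t + inf_θ{−tr(A_θ(x)D²U)} − C₀|DU| } ≤ 0 on ℝ^N×(0,∞). -/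
def IsSubSolMinIneq (A : Θ → E N → Matrix (Fin N) (Fin N) ℝ) (C₀ : ℝ)
    (U : E N → ℝ → ℝ) : Prop :=
  ∀ φ : E N → ℝ → ℝ, ContDiff ℝ 2 (fun q : E N × ℝ => φ q.1 q.2) →
    ∀ (x₀ : E N) (t₀ : ℝ), 0 < t₀ →
      IsLocalMax (fun q : E N × ℝ => U q.1 q.2 - φ q.1 q.2) (x₀, t₀) →
      U x₀ t₀ ≤ 0 ∨
        deriv (φ x₀) t₀ + (⨅ θ, -Matrix.trace (A θ x₀ * hessMatrix (fun y => φ y t₀) x₀))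
          - C₀ * ‖gradient (fun y => φ y t₀) x₀‖ ≤ 0

/-- The unit cube [0,1]^N. -/
def cube (N : ℕ) : Set (E N) := {x | ∀ i, x i ∈ Set.Icc (0:ℝ) 1}

/-- Assumption (sur-sol-stricte) with constant C. -/
def SurSolStricte (A : Θ → E N → Matrix (Fin N) (Fin N) ℝ) (C : ℝ) : Prop :=
  ∀ δ > (0:ℝ), ∃ ψ : E N → ℝ, ContDiff ℝ 2 ψ ∧
    ∃ Ω : Set (E N), IsOpen Ω ∧ Bornology.IsBounded Ω ∧ cube N ⊆ Ω ∧
      (∀ x ∈ Ω, ψ x ≤ 0) ∧ (∀ x ∉ Ω, 0 ≤ ψ x) ∧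
      ∀ x ∈ Ω, (∀ y ∈ degenSet A, δ < dist x y) →
        0 < (⨅ θ, -Matrix.trace (A θ x * hessMatrix ψ x)) - C * ‖gradient ψ x‖

/-- Assumption (inver_dege): uniform ellipticity at distance > δ from Σ. -/
def InverDege (A : Θ → E N → Matrix (Fin N) (Fin N) ℝ) : Prop :=
  ∀ δ > (0:ℝ), ∃ ν > (0:ℝ), ∀ (θ : Θ) (x : E N),
    (∀ y ∈ degenSet A, δ < dist x y) →
    (A θ x - ν • (1 : Matrix (Fin N) (Fin N) ℝ)).PosSemidef

/-- Frobenius norm of a matrix. -/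
def mnorm (M : Matrix (Fin N) (Fin N) ℝ) : ℝ := Real.sqrt (∑ i, ∑ j, (M i j)^2)

section Moreau

variable {Z : Type*} [NormedAddCommGroup Z] [InnerProductSpace ℝ Z]

theorem prox_ineq (g : Z → ℝ) (hc : ConvexOn ℝ Set.univ g) (y ξ : Z)
    (hmin : ∀ ξ', g ξ + 1/2 * ‖ξ - y‖^2 ≤ g ξ' + 1/2 * ‖ξ' - y‖^2) (ξ' : Z) :
    g ξ + inner ℝ (y - ξ) (ξ' - ξ) ≤ g ξ' := by
  have key : ∀ τ : ℝ, 0 < τ → τ ≤ 1 →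
      0 ≤ (g ξ' - g ξ) + inner ℝ (ξ - y) (ξ' - ξ) + τ * (1/2 * ‖ξ' - ξ‖^2) := by
    intro τ h0 h1
    have h2 := hc.2 (Set.mem_univ ξ) (Set.mem_univ ξ') (show (0:ℝ) ≤ 1 - τ by linarith) h0.le
      (by ring)
    have h3 := hmin ((1 - τ) • ξ + τ • ξ')
    have h4 : (1 - τ) • ξ + τ • ξ' - y = (ξ - y) + τ • (ξ' - ξ) := by module
    rw [h4, norm_add_sq_real, inner_smul_right, norm_smul, Real.norm_of_nonneg h0.le] at h3
    simp only [smul_eq_mul] at h2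
    have : 0 ≤ τ * ((g ξ' - g ξ) + inner ℝ (ξ - y) (ξ' - ξ) + τ * (1/2 * ‖ξ' - ξ‖^2)) := by
      nlinarith
    exact nonneg_of_mul_nonneg_right this h0
  have h5 : 0 ≤ (g ξ' - g ξ) + inner ℝ (ξ - y) (ξ' - ξ) := by
    by_contra hneg
    push Not at hneg
    set a := (g ξ' - g ξ) + inner ℝ (ξ - y) (ξ' - ξ) with ha
    set b := 1/2 * ‖ξ' - ξ‖^2 with hb
    have hb0 : 0 ≤ b := by positivity
    have hτ : 0 < min 1 (-a / (2 * (b + 1))) := by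
      apply lt_min one_pos; apply div_pos <;> linarith
    have h6 := key _ hτ (min_le_left _ _)
    have h7 : min 1 (-a / (2 * (b + 1))) * b ≤ (-a / (2 * (b + 1))) * (b + 1) := by
      apply mul_le_mul (min_le_right _ _) (by linarith) hb0
      apply (div_pos _ _).le <;> linarith
    have h8 : (-a / (2 * (b + 1))) * (b + 1) = -a / 2 := by field_simp
    linarith
  have h6 : inner ℝ (ξ - y) (ξ' - ξ) = - inner ℝ (y - ξ) (ξ' - ξ) := by
    rw [← inner_neg_left, neg_sub]
  linarith

theorem exists_prox [FiniteDimensional ℝ Z] (g : Z → ℝ) (hc : ConvexOn ℝ Set.univ g)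
    (hcont : Continuous g) (x0 : Z) (c0 : ℝ) (hlow : ∀ ξ, c0 + inner ℝ x0 ξ ≤ g ξ) :
    ∃ J : Z → Z, ∀ y ξ', g (J y) + inner ℝ (y - J y) (ξ' - J y) ≤ g ξ' := by
  have : ∀ y : Z, ∃ ξ, ∀ ξ', g ξ + inner ℝ (y - ξ) (ξ' - ξ) ≤ g ξ' := by
    intro y
    have hcont2 : Continuous fun ξ => g ξ + 1/2 * ‖ξ - y‖^2 := by fun_prop
    have hlim : Tendsto (fun ξ => g ξ + 1/2 * ‖ξ - y‖^2) (cocompact Z) atTop := by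
      have h1 : Tendsto (fun ξ : Z => (c0 - ‖x0 + y‖ ^2 - ‖y‖*‖x0‖ ) + 1/4 * ‖ξ - y‖) (cocompact Z) atTop := by
        apply tendsto_atTop_add_const_left
        apply Tendsto.const_mul_atTop (by norm_num)
        have := tendsto_norm_cocompact_atTop (E := Z)
        apply tendsto_atTop_mono (f := fun ξ => ‖ξ‖ + (-‖y‖))
        · intro ξ; have := norm_sub_norm_le ξ y; linarith
        · exact tendsto_atTop_add_const_right _ _ this
      have h2 : Tendsto (fun ξ : Z => ‖ξ - y‖) (cocompact Z) atTop := by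
        have := tendsto_norm_cocompact_atTop (E := Z)
        apply tendsto_atTop_mono (f := fun ξ => ‖ξ‖ + (-‖y‖))
        · intro ξ; have := norm_sub_norm_le ξ y; linarith
        · exact tendsto_atTop_add_const_right _ _ this
      have h3 : Tendsto (fun ξ : Z => (c0 - ‖x0‖ * ‖y‖ - ‖x0‖^2 - 1) + ‖ξ - y‖) (cocompact Z) atTop :=
        tendsto_atTop_add_const_left _ _ h2
      refine tendsto_atTop_mono ?_ h3
      intro ξ
      have h4 := hlow ξ
      have h5 : inner ℝ x0 ξ = inner ℝ x0 (ξ - y) + inner ℝ x0 y := by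
        rw [← inner_add_right]; simp
      have h6 := (abs_le.1 (abs_real_inner_le_norm x0 (ξ - y))).1
      have h7 := (abs_le.1 (abs_real_inner_le_norm x0 y)).1
      nlinarith [sq_nonneg (‖ξ - y‖ - ‖x0‖ - 1), norm_nonneg x0, sq_nonneg (‖x0‖ - 1)]
    obtain ⟨ξ, hξ⟩ := hcont2.exists_forall_le hlim
    exact ⟨ξ, prox_ineq g hc y ξ hξ⟩
  choose J hJ using this
  exact ⟨J, hJ⟩

/-- Moreau envelope. -/
def mor (g : Z → ℝ) (J : Z → Z) (y : Z) : ℝ := g (J y) + 1/2 * ‖J y - y‖^2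

variable {g : Z → ℝ} {J : Z → Z}

theorem prox_firm (hJ : ∀ y ξ', g (J y) + inner ℝ (y - J y) (ξ' - J y) ≤ g ξ') (y y' : Z) :
    ‖J y - J y'‖ ≤ ‖y - y'‖ := by
  have h1 := hJ y (J y')
  have h2 := hJ y' (J y)
  have h3 : inner ℝ (y - J y) (J y' - J y) + inner ℝ (y' - J y') (J y - J y')
      = ‖J y - J y'‖^2 - inner ℝ (y - y') (J y - J y') := by
    rw [← real_inner_self_eq_norm_sq]
    simp only [inner_sub_left, inner_sub_right]
    ring
  have h4 := real_inner_le_norm (y - y') (J y - J y')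
  by_contra hlt
  push Not at hlt
  have := norm_nonneg (y - y')
  nlinarith

theorem prox_lip (hJ : ∀ y ξ', g (J y) + inner ℝ (y - J y) (ξ' - J y) ≤ g ξ') :
    LipschitzWith 1 J := by
  apply LipschitzWith.of_dist_le_mul
  intro x y
  simpa [dist_eq_norm] using prox_firm hJ x y

theorem mor_lower (hJ : ∀ y ξ', g (J y) + inner ℝ (y - J y) (ξ' - J y) ≤ g ξ') (y h : Z) :
    mor g J y + inner ℝ (y - J y) h ≤ mor g J (y + h) := by
  unfold mor
  have h1 := hJ y (J (y + h))
  set ξ := J y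
  set ξ' := J (y + h)
  have h2 := sq_nonneg ‖(ξ' - (y + h)) + (y - ξ)‖
  have e1 : ‖(ξ' - (y + h)) + (y - ξ)‖^2 = ‖ξ' - (y + h)‖^2 + 2 * inner ℝ (ξ' - (y + h)) (y - ξ)
     + ‖y - ξ‖^2 := norm_add_sq_real _ _
  have e2 : ξ' - (y + h) = (ξ' - ξ) - (y - ξ) - h := by abel
  have e3 : inner ℝ (ξ' - (y + h)) (y - ξ) = inner ℝ (y - ξ) (ξ' - ξ) - ‖y - ξ‖^2
    - inner ℝ (y - ξ) h := by
    rw [e2, ← real_inner_self_eq_norm_sq, inner_sub_left, inner_sub_left,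
      real_inner_comm (y - ξ) (ξ' - ξ), real_inner_comm (y - ξ) h]
  have e4 : ‖ξ - y‖ = ‖y - ξ‖ := norm_sub_rev _ _
  rw [e4]
  nlinarith

theorem mor_le (hJ : ∀ y ξ', g (J y) + inner ℝ (y - J y) (ξ' - J y) ≤ g ξ') (y ξ : Z) :
    mor g J y ≤ g ξ + 1/2 * ‖ξ - y‖^2 := by
  unfold mor
  have h1 := hJ y ξ
  have h2 : ‖ξ - y‖^2 = ‖(ξ - J y) + (J y - y)‖^2 := by congr 2; abel
  rw [norm_add_sq_real] at h2
  have h3 : inner ℝ (ξ - J y) (J y - y) = - inner ℝ (y - J y) (ξ - J y) := by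
    rw [real_inner_comm, ← inner_neg_left, neg_sub]
  nlinarith [sq_nonneg ‖ξ - J y‖]

theorem mor_upper (hJ : ∀ y ξ', g (J y) + inner ℝ (y - J y) (ξ' - J y) ≤ g ξ') (y h : Z) :
    mor g J (y + h) ≤ mor g J y + inner ℝ (y - J y) h + 1/2 * ‖h‖^2 := by
  have h1 := mor_le hJ (y + h) (J y)
  have h2 : J y - (y + h) = (J y - y) - h := by abel
  rw [h2, norm_sub_sq_real] at h1
  have h3 : inner ℝ (J y - y) h = - inner ℝ (y - J y) h := by
    rw [← inner_neg_left, neg_sub]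
  unfold mor at *
  linarith

theorem mor_hasFDerivAt (hJ : ∀ y ξ', g (J y) + inner ℝ (y - J y) (ξ' - J y) ≤ g ξ') (y : Z) :
    HasFDerivAt (mor g J) (innerSL ℝ (y - J y)) y := by
  rw [hasFDerivAt_iff_isLittleO_nhds_zero]
  have : (fun h => mor g J (y + h) - mor g J y - innerSL ℝ (y - J y) h) =O[nhds 0]
      fun h : Z => ‖h‖^2 := by
    apply Asymptotics.IsBigO.of_bound 1
    filter_upwards with h
    have h1 := mor_lower hJ y h
    have h2 := mor_upper hJ y h
    rw [innerSL_apply_apply, Real.norm_eq_abs, Real.norm_of_nonneg (by positivity), abs_le]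
    constructor <;> nlinarith [sq_nonneg ‖h‖]
  refine this.trans_isLittleO ?_
  have := Asymptotics.isLittleO_pow_id (𝕜 := ℝ) (n := 2) (by norm_num)
  have h2 := (this.comp_tendsto (k := fun h : Z => ‖h‖) (l' := nhds 0)
    (by simpa using (continuous_norm (E := Z)).tendsto 0))
  exact h2.trans_isBigO (Asymptotics.isBigO_norm_left.2 (Asymptotics.isBigO_refl _ _))

/-- second order expansion of the Moreau envelope -/
theorem mor_second (hJ : ∀ y ξ', g (J y) + inner ℝ (y - J y) (ξ' - J y) ≤ g ξ') (y : Z)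
    (hd : DifferentiableAt ℝ J y) :
    ∃ D : Z →L[ℝ] Z, (∀ a b, inner ℝ (D a) b = inner ℝ a (D b)) ∧
      ∀ ε > 0, ∀ᶠ h in nhds (0 : Z),
        |mor g J (y + h) - mor g J y - inner ℝ (y - J y) h - 1/2 * inner ℝ (D h) h| ≤ ε * ‖h‖^2 := by
  set D : Z →L[ℝ] Z := ContinuousLinearMap.id ℝ Z - fderiv ℝ J y with hD
  have hK : HasFDerivAt (fun z => z - J z) D y := (hasFDerivAt_id y).sub hd.hasFDerivAt
  have hgrad : HasFDerivAt (fun z => innerSL ℝ (z - J z)) ((innerSL ℝ).comp D) y :=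
    (innerSL (E := Z) ℝ).hasFDerivAt.comp y hK
  have hsym := second_derivative_symmetric_of_eventually
    (Filter.Eventually.of_forall (mor_hasFDerivAt hJ)) hgrad
  have hsym' : ∀ a b, inner ℝ (D a) b = inner ℝ a (D b) := by
    intro a b
    have := hsym a b
    simp only [ContinuousLinearMap.comp_apply, innerSL_apply_apply] at this
    rw [this, real_inner_comm]
  refine ⟨D, hsym', ?_⟩
  intro ε hε
  have hlo := (hasFDerivAt_iff_isLittleO_nhds_zero.1 hK).def hε
  obtain ⟨r, hr, hball⟩ := Metric.eventually_nhds_iff_ball.1 hlo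
  rw [Metric.eventually_nhds_iff_ball]
  refine ⟨r, hr, ?_⟩
  intro h hh
  have hder : ∀ k ∈ Metric.closedBall (0:Z) ‖h‖, HasFDerivWithinAt
      (fun k => mor g J (y + k) - mor g J y - inner ℝ (y - J y) k - 1/2 * inner ℝ (D k) k)
      (innerSL ℝ ((y + k) - J (y + k)) - innerSL ℝ (y - J y) - innerSL ℝ (D k))
      (Metric.closedBall (0:Z) ‖h‖) k := by
    intro k _
    apply HasFDerivAt.hasFDerivWithinAt
    have h1 : HasFDerivAt (fun k => mor g J (y + k)) (innerSL ℝ ((y + k) - J (y + k))) k := by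
      have := (mor_hasFDerivAt hJ (y + k)).comp k ((hasFDerivAt_id k).const_add y)
      rw [ContinuousLinearMap.comp_id] at this
      exact this
    have h2 : HasFDerivAt (fun k => inner ℝ (y - J y) k) (innerSL ℝ (y - J y)) k :=
      (innerSL ℝ (y - J y)).hasFDerivAt
    have h3 : HasFDerivAt (fun k => 1/2 * inner ℝ (D k) k) (innerSL ℝ (D k)) k := by
      have := ((D.hasFDerivAt (x := k)).inner ℝ (hasFDerivAt_id k)).const_mul (1/2 : ℝ)
      refine this.congr_fderiv ?_
      ext m
      simp only [innerSL_apply_apply, ContinuousLinearMap.smul_apply, ContinuousLinearMap.comp_apply,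
        ContinuousLinearMap.prod_apply, fderivInnerCLM_apply, ContinuousLinearMap.id_apply, id,
        smul_eq_mul, hsym' m k, real_inner_comm (D k) m]
      ring
    exact (((h1.sub_const _).sub h2).sub h3)
  have hbd : ∀ k ∈ Metric.closedBall (0:Z) ‖h‖,
      ‖innerSL ℝ ((y + k) - J (y + k)) - innerSL ℝ (y - J y) - innerSL ℝ (D k)‖ ≤ ε * ‖h‖ := by
    intro k hk
    rw [mem_closedBall_zero_iff] at hk
    have h1 := hball k (by rw [mem_ball_zero_iff] at *; linarith)
    rw [← map_sub, ← map_sub, innerSL_apply_norm]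
    exact h1.trans (by gcongr)
  have := (convex_closedBall (0:Z) ‖h‖).norm_image_sub_le_of_norm_hasFDerivWithin_le hder hbd
    (x := 0) (y := h) (by simp) (by simp)
  simp at this
  convert this using 1
  · simp
  · ring

end Moreau

section Jensen

variable {F : Type*} [NormedAddCommGroup F] [InnerProductSpace ℝ F] [FiniteDimensional ℝ F]

theorem exists_avoid_null (J : F → F) (hJ : LipschitzWith 1 J) (Λ : F → F) (K : NNReal)
    (hΛ : LipschitzWith K Λ) (r : ℝ) (hr : 0 < r) :
    ∃ q : F, ‖q‖ < r ∧ ∀ y, Λ y = q → DifferentiableAt ℝ J y := by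
  borelize F
  set μ : MeasureTheory.Measure F := MeasureTheory.Measure.hausdorffMeasure (Module.finrank ℝ F)
  have h1 : ∀ᵐ y ∂μ, DifferentiableAt ℝ J y := hJ.ae_differentiableAt
  have h2 : μ {y | ¬ DifferentiableAt ℝ J y} = 0 := h1
  have h3 : μ (Λ '' {y | ¬ DifferentiableAt ℝ J y}) = 0 := by
    have := hΛ.hausdorffMeasure_image_le (d := (Module.finrank ℝ F : ℝ)) (by positivity)
      {y | ¬ DifferentiableAt ℝ J y}
    have h4 : MeasureTheory.Measure.hausdorffMeasure (Module.finrank ℝ F : ℝ)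
      {y | ¬ DifferentiableAt ℝ J y} = 0 := h2
    rw [h4, mul_zero] at this
    exact le_antisymm this bot_le
  have h4 : 0 < μ (Metric.ball (0:F) r) := Metric.measure_ball_pos μ 0 hr
  have h5 : ∃ q ∈ Metric.ball (0:F) r, q ∉ Λ '' {y | ¬ DifferentiableAt ℝ J y} := by
    by_contra hcon
    push Not at hcon
    have := MeasureTheory.measure_mono (μ := μ) hcon
    rw [h3] at this
    exact absurd (lt_of_lt_of_le h4 this) (lt_irrefl _)
  obtain ⟨q, hq, hq2⟩ := h5
  refine ⟨q, by simpa using hq, ?_⟩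
  intro y hy
  by_contra hnd
  exact hq2 ⟨y, hnd, hy⟩

theorem jensen (e : F → ℝ) (J : F → F) (hJ : LipschitzWith 1 J)
    (hgrad : ∀ y, HasFDerivAt e (innerSL ℝ (y - J y)) y) (Q : F →L[ℝ] F)
    (hsym : ∀ a b, inner ℝ (Q a) b = inner ℝ a (Q b))
    (hQ : ∀ y, e y ≤ 1/2 * inner ℝ (Q y) y) (h0 : e 0 = 0) (ι r : ℝ) (hι : 0 < ι) (hr : 0 < r) :
    ∃ y, ‖y‖ ≤ r ∧ DifferentiableAt ℝ J y ∧
      ∀ h, e (y + h) ≤ e y + inner ℝ (y - J y) h + 1/2 * inner ℝ (Q h) h + ι/2 * ‖h‖^2 := by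
  set Λ : F → F := fun y => y - J y - Q y - ι • y with hΛdef
  have hΛ : LipschitzWith (1 + 1 + ‖Q‖₊ + ‖ι‖₊ * 1) Λ := by
    have h1 : LipschitzWith (‖ι‖₊ * 1) (fun y : F => ι • y) :=
      (lipschitzWith_smul ι).comp LipschitzWith.id
    exact ((LipschitzWith.id.sub hJ).sub Q.lipschitz).sub h1
  obtain ⟨q, hq, hqd⟩ := exists_avoid_null J hJ Λ _ hΛ (ι * r / 2) (by positivity)
  set Eq : F → ℝ := fun y => (1/2 * inner ℝ (Q y) y + ι/2 * ‖y‖^2 + inner ℝ q y) - e y with hE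
  have hec : Continuous e := continuous_iff_continuousAt.2 fun y => (hgrad y).continuousAt
  have hEc : Continuous Eq := by fun_prop
  have hlow : ∀ y, ι/2 * ‖y‖^2 - ‖q‖ * ‖y‖ ≤ Eq y := by
    intro y
    have h1 := hQ y
    have h2 := (abs_le.1 (abs_real_inner_le_norm q y)).1
    simp only [hE]; linarith
  have hlim : Tendsto Eq (cocompact F) atTop := by
    have h1 := tendsto_norm_cocompact_atTop (E := F)
    have h2 : Tendsto (fun y : F => ‖y‖ * (ι/2 * ‖y‖ + (-‖q‖))) (cocompact F) atTop := by
      apply h1.atTop_mul_atTop₀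
      exact tendsto_atTop_add_const_right _ _ (h1.const_mul_atTop (by positivity))
    refine tendsto_atTop_mono ?_ h2
    intro y
    have := hlow y
    nlinarith
  obtain ⟨y, hy⟩ := hEc.exists_forall_le hlim
  have hcrit : y - J y - Q y - ι • y - q = 0 := by
    have hd : HasFDerivAt Eq ((innerSL ℝ (Q y) + ι • innerSL ℝ y + innerSL ℝ q)
        - innerSL ℝ (y - J y)) y := by
      have h3 : HasFDerivAt (fun k => 1/2 * inner ℝ (Q k) k) (innerSL ℝ (Q y)) y := by
        have := ((Q.hasFDerivAt (x := y)).inner ℝ (hasFDerivAt_id y)).const_mul (1/2 : ℝ)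
        refine this.congr_fderiv ?_
        ext m
        simp only [innerSL_apply_apply, smul_apply, ContinuousLinearMap.comp_apply,
          ContinuousLinearMap.prod_apply, fderivInnerCLM_apply, ContinuousLinearMap.id_apply, id,
          smul_eq_mul, hsym m y, real_inner_comm (Q y) m]
        ring
      have h4 : HasFDerivAt (fun k : F => ι/2 * ‖k‖^2) (ι • innerSL ℝ y) y := by
        have := ((hasFDerivAt_id (𝕜 := ℝ) y).norm_sq).const_mul (ι/2)
        refine this.congr_fderiv ?_
        ext m
        simp
        ring
      have h5 : HasFDerivAt (fun k => inner ℝ q k) (innerSL ℝ q) y := (innerSL ℝ q).hasFDerivAt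
      exact ((h3.add h4).add h5).sub (hgrad y)
    have hz := IsLocalMin.hasFDerivAt_eq_zero (Filter.Eventually.of_forall hy) hd
    have hz2 : ∀ m, inner ℝ (y - J y - Q y - ι • y - q) m = 0 := by
      intro m
      have := congrArg (fun T : F →L[ℝ] ℝ => T m) hz
      simp [inner_sub_left, inner_smul_left] at this ⊢
      linarith
    exact ext_inner_right ℝ (fun m => by rw [hz2 m]; simp)
  refine ⟨y, ?_, hqd y ?_, ?_⟩
  · have h1 := hlow y
    have h2 := hy 0
    have h3 : Eq 0 = 0 := by simp [hE, h0]
    by_contra hlt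
    push Not at hlt
    have : 0 < ‖y‖ := hr.trans hlt
    have h4 : ‖q‖ < ι / 2 * ‖y‖ := by nlinarith
    nlinarith
  · exact sub_eq_zero.1 hcrit
  · intro h
    have h1 := hy (y + h)
    have h2 : y - J y = Q y + ι • y + q := by
      rw [← sub_eq_zero, ← hcrit]; abel
    rw [h2]
    simp only [hE, map_add, inner_add_left, inner_add_right, norm_add_sq_real, inner_smul_left] at h1 ⊢
    have h3 : inner ℝ (Q h) y = inner ℝ (Q y) h := by rw [hsym h y, real_inner_comm]
    simp only [h3, conj_trivial] at h1 ⊢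
    linarith

end Jensen

section Sums

variable {Z : Type*} [NormedAddCommGroup Z] [InnerProductSpace ℝ Z]

theorem exists_conj (B : Set Z) (hB : IsCompact B) (h0 : B.Nonempty) (k : Z → ℝ)
    (hk : ContinuousOn k B) : ∃ g : Z → ℝ, ConvexOn ℝ Set.univ g ∧ Continuous g ∧
      (∀ ξ, ∀ x ∈ B, k x + inner ℝ x ξ ≤ g ξ) ∧ (∀ ξ, ∃ x ∈ B, g ξ = k x + inner ℝ x ξ) := by
  have h1 : ∀ ξ : Z, ∃ x ∈ B, ∀ x' ∈ B, k x' + inner ℝ x' ξ ≤ k x + inner ℝ x ξ := by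
    intro ξ
    obtain ⟨x, hx, hm⟩ := hB.exists_isMaxOn h0
      (show ContinuousOn (fun x => k x + inner ℝ x ξ) B from hk.add (by fun_prop))
    exact ⟨x, hx, fun x' hx' => hm hx'⟩
  choose X hXB hX using h1
  obtain ⟨R, hR⟩ := hB.isBounded.exists_norm_le
  have hup : ∀ ξ, ∀ x ∈ B, k x + inner ℝ x ξ ≤ k (X ξ) + inner ℝ (X ξ) ξ := fun ξ x hx => hX ξ x hx
  refine ⟨fun ξ => k (X ξ) + inner ℝ (X ξ) ξ, ⟨convex_univ, ?_⟩, ?_, hup,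
    fun ξ => ⟨X ξ, hXB ξ, rfl⟩⟩
  · intro ξ _ η _ a b ha hb hab
    have e1 := hup ξ _ (hXB (a • ξ + b • η))
    have e2 := hup η _ (hXB (a • ξ + b • η))
    simp only [smul_eq_mul, inner_add_right, inner_smul_right] at *
    set z := X (a • ξ + b • η)
    have : k z = a * k z + b * k z := by rw [← add_mul, hab, one_mul]
    nlinarith [mul_le_mul_of_nonneg_left e1 ha, mul_le_mul_of_nonneg_left e2 hb]
  · have : LipschitzWith R.toNNReal (fun ξ => k (X ξ) + inner ℝ (X ξ) ξ) := by
      apply LipschitzWith.of_le_add_mul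
      intro ξ η
      have e1 := hup η _ (hXB ξ)
      have e2 : inner ℝ (X ξ) ξ - inner ℝ (X ξ) η ≤ R * ‖ξ - η‖ := by
        rw [← inner_sub_right]
        exact (real_inner_le_norm _ _).trans (mul_le_mul_of_nonneg_right (hR _ (hXB ξ)) (norm_nonneg _))
      have e3 : (R.toNNReal : ℝ) = R := Real.coe_toNNReal _ ((norm_nonneg _).trans (hR _ (hXB ξ)))
      rw [e3, dist_eq_norm]
      linarith
    exact this.continuous

theorem coercive_inv [FiniteDimensional ℝ Z] (M : Z →L[ℝ] Z) (c : ℝ) (hc : 0 < c)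
    (h : ∀ x, c * ‖x‖^2 ≤ inner ℝ (M x) x) :
    ∃ Q : Z →L[ℝ] Z, (∀ x, M (Q x) = x) ∧ (∀ x, Q (M x) = x) := by
  have hinj : Function.Injective (M : Z →ₗ[ℝ] Z) := by
    rw [← LinearMap.ker_eq_bot, LinearMap.ker_eq_bot']
    intro x hx
    have := h x
    have hx' : M x = 0 := hx
    rw [hx', inner_zero_left] at this
    have h2 : ‖x‖^2 ≤ 0 := by nlinarith [sq_nonneg ‖x‖]
    have : ‖x‖ = 0 := by nlinarith [norm_nonneg x]
    exact norm_eq_zero.1 this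
  let e := LinearEquiv.ofInjectiveEndo (M : Z →ₗ[ℝ] Z) hinj
  refine ⟨LinearMap.toContinuousLinearMap (e.symm : Z →ₗ[ℝ] Z), ?_, ?_⟩
  · intro x; exact e.apply_symm_apply x
  · intro x; exact e.symm_apply_apply x

theorem quad_nonneg (q : Z → ℝ) (hq : ∀ (s : ℝ) h, q (s • h) = s^2 * q h)
    (h : ∀ ε > (0:ℝ), ∀ᶠ h in nhds (0:Z), -(ε * ‖h‖^2) ≤ q h) (x : Z) : 0 ≤ q x := by
  by_contra hneg
  push Not at hneg
  have hε : 0 < -q x / (2 * (‖x‖^2 + 1)) := by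
    apply div_pos (by linarith); positivity
  have h1 := h _ hε
  have h2 : Tendsto (fun s : ℝ => s • x) (nhdsWithin 0 (Set.Ioi 0)) (nhds 0) := by
    have : Tendsto (fun s : ℝ => s • x) (nhds 0) (nhds ((0:ℝ) • x)) := by
      apply Continuous.tendsto; fun_prop
    rw [zero_smul] at this
    exact this.mono_left nhdsWithin_le_nhds
  obtain ⟨s, hs, hs0⟩ := ((h2.eventually h1).and self_mem_nhdsWithin).exists
  have hs0 : 0 < s := hs0
  rw [hq, norm_smul, mul_pow, Real.norm_eq_abs, sq_abs] at hs
  have h3 : -q x / (2 * (‖x‖^2 + 1)) * ‖x‖^2 ≤ -q x / 2 := by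
    rw [div_mul_eq_mul_div, div_le_div_iff₀ (by positivity) (by norm_num)]
    nlinarith [sq_nonneg ‖x‖]
  have hs2 : 0 < s^2 := by positivity
  nlinarith

variable {g : Z → ℝ} {J : Z → Z} {k : Z → ℝ} {B : Set Z}

theorem dual_ineq (hg : ∀ ξ, ∀ x ∈ B, k x + inner ℝ x ξ ≤ g ξ) (x : Z) (hx : x ∈ B) (y : Z) :
    k x ≤ mor g J y - inner ℝ x y + 1/2 * ‖x‖^2 := by
  have h1 := hg (J y) x hx
  have h2 : 0 ≤ ‖x + (J y - y)‖^2 := by positivity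
  rw [norm_add_sq_real, inner_sub_right] at h2
  unfold mor
  linarith

theorem contact
    (hg : ∀ ξ, ∀ x ∈ B, k x + inner ℝ x ξ ≤ g ξ) (hat : ∀ ξ, ∃ x ∈ B, g ξ = k x + inner ℝ x ξ)
    (y : Z) (c : ℝ) (hc : c < 1/2)
    (hup : ∀ h, mor g J (y + h) ≤ mor g J y + inner ℝ (y - J y) h + c * ‖h‖^2) :
    (y - J y) ∈ B ∧ mor g J y = k (y - J y) + inner ℝ (y - J y) y - 1/2 * ‖y - J y‖^2 := by
  obtain ⟨x1, hx1, he⟩ := hat (J y)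
  have h1 := dual_ineq (J := J) hg x1 hx1 (y + (x1 - (y - J y)))
  have h2 := hup (x1 - (y - J y))
  have h3 : mor g J y = k x1 + inner ℝ x1 (J y) + 1/2 * ‖y - J y‖^2 := by
    unfold mor; rw [he, norm_sub_rev]
  set ξ := J y with hξ
  obtain ⟨a, ha⟩ : ∃ a, a = y - ξ := ⟨_, rfl⟩
  have hy : y = ξ + a := by rw [ha]; abel
  obtain ⟨e, hee⟩ : ∃ e, e = x1 - a := ⟨_, rfl⟩
  have hx : x1 = a + e := by rw [hee]; abel
  rw [← ha] at h1 h2 h3 ⊢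
  rw [← hee] at h1 h2
  have h4 : e = 0 := by
    have : (1/2 - c) * ‖e‖^2 ≤ 0 := by
      have k1 : inner ℝ x1 (y + e) = inner ℝ x1 ξ + ‖x1‖^2 := by
        rw [← real_inner_self_eq_norm_sq, ← inner_add_right, hy, hx]; congr 1; abel
      have k2 : ‖x1‖^2 = ‖a‖^2 + 2 * inner ℝ a e + ‖e‖^2 := by rw [hx, norm_add_sq_real]
      linarith
    have : ‖e‖^2 ≤ 0 := by nlinarith [sq_nonneg ‖e‖]
    have : ‖e‖ = 0 := by nlinarith [norm_nonneg e]
    exact norm_eq_zero.1 this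
  have h5 : x1 = a := by rw [hx, h4, add_zero]
  refine ⟨h5 ▸ hx1, ?_⟩
  rw [h3, h5, hy, inner_add_right, real_inner_self_eq_norm_sq]; ring

theorem contact_jet [FiniteDimensional ℝ Z]
    (hJ : ∀ y ξ', g (J y) + inner ℝ (y - J y) (ξ' - J y) ≤ g ξ')
    (hg : ∀ ξ, ∀ x ∈ B, k x + inner ℝ x ξ ≤ g ξ)
    (y : Z)
    (hk : mor g J y = k (y - J y) + inner ℝ (y - J y) y - 1/2 * ‖y - J y‖^2)
    (D : Z →L[ℝ] Z) (hDs : ∀ a b, inner ℝ (D a) b = inner ℝ a (D b))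
    (hD : ∀ ε > (0:ℝ), ∀ᶠ h in nhds (0:Z), |mor g J (y + h) - mor g J y - inner ℝ (y - J y) h
      - 1/2 * inner ℝ (D h) h| ≤ ε * ‖h‖^2) (τ : ℝ) (hτ : 0 < τ) :
    ∃ S : Z →L[ℝ] Z, (∀ a b, inner ℝ (S a) b = inner ℝ a (S b)) ∧
      (∀ ζ w : Z, 2 * inner ℝ w ζ - inner ℝ (D w) w - τ * ‖w‖^2 - ‖ζ‖^2 ≤ inner ℝ (S ζ) ζ) ∧
      ∀ ε > (0:ℝ), ∀ᶠ h in nhds (0:Z), (y - J y) + h ∈ B →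
        k ((y - J y) + h) ≤ k (y - J y) - inner ℝ (J y) h - 1/2 * inner ℝ (S h) h + ε * ‖h‖^2 := by
  have hD0 : ∀ h, 0 ≤ inner ℝ (D h) h := by
    apply quad_nonneg
    · intro s h; simp only [map_smul, inner_smul_left, inner_smul_right]; simp; ring
    · intro ε hε
      filter_upwards [hD (ε/2) (by linarith)] with h hh
      have := mor_lower hJ y h
      have := (abs_le.1 hh).2
      linarith
  obtain ⟨Lm, hL1, hL2⟩ := coercive_inv (D + τ • ContinuousLinearMap.id ℝ Z) τ hτ (by
    intro x
    have := hD0 x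
    simp only [add_apply, smul_apply, ContinuousLinearMap.id_apply,
      inner_add_left, inner_smul_left, real_inner_self_eq_norm_sq]
    simp only [conj_trivial]; linarith)
  simp only [add_apply, smul_apply, ContinuousLinearMap.id_apply] at hL1 hL2
  have hLs : ∀ a b, inner ℝ (Lm a) b = inner ℝ a (Lm b) := by
    intro a b
    have e1 := hDs (Lm a) (Lm b)
    conv_lhs => rw [← hL1 b]
    conv_rhs => rw [← hL1 a]
    rw [inner_add_right, inner_add_left, e1, inner_smul_left, inner_smul_right]; simp
  let S : Z →L[ℝ] Z := (2:ℝ) • Lm - Lm.comp (D.comp Lm) - ContinuousLinearMap.id ℝ Z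
  have hS : ∀ a b, inner ℝ (S a) b = 2 * inner ℝ (Lm a) b - inner ℝ (D (Lm a)) (Lm b)
      - inner ℝ a b := by
    intro a b
    simp only [S, sub_apply, smul_apply, ContinuousLinearMap.comp_apply,
      ContinuousLinearMap.id_apply, inner_sub_left, inner_smul_left, hLs (D (Lm a)) b]
    simp
  refine ⟨S, ?_, ?_, ?_⟩
  · intro a b
    rw [real_inner_comm (S b) a, hS a b, hS b a, hLs a b, hDs (Lm a), real_inner_comm (Lm b) a,
      real_inner_comm (D (Lm b)), real_inner_comm b a]
  · intro ζ w
    rw [hS]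
    have e1 := hD0 (w - Lm ζ)
    have e2 : D (Lm ζ) = ζ - τ • Lm ζ := by
      rw [eq_sub_iff_add_eq]; exact hL1 ζ
    have e3 : inner ℝ (D w) (Lm ζ) = inner ℝ w ζ - τ * inner ℝ w (Lm ζ) := by
      rw [hDs, e2, inner_sub_right, inner_smul_right]
    have e4 : 0 ≤ ‖w - Lm ζ‖^2 := by positivity
    rw [norm_sub_sq_real] at e4
    have e5 : inner ℝ (D (Lm ζ)) w = inner ℝ w ζ - τ * inner ℝ w (Lm ζ) := by
      rw [hDs, real_inner_comm, e3]
    have e6 : inner ℝ (D (Lm ζ)) (Lm ζ) = inner ℝ (Lm ζ) ζ - τ * ‖Lm ζ‖^2 := by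
      rw [e2, inner_sub_left, inner_smul_left, real_inner_self_eq_norm_sq, real_inner_comm]; simp
    have e7 : inner ℝ (D (w - Lm ζ)) (w - Lm ζ) = inner ℝ (D w) w - inner ℝ (D w) (Lm ζ)
      - inner ℝ (D (Lm ζ)) w + inner ℝ (D (Lm ζ)) (Lm ζ) := by
      rw [map_sub, inner_sub_left, inner_sub_right, inner_sub_right]; ring
    rw [e7, e3, e5] at e1
    rw [e6] at e1 ⊢
    rw [real_inner_self_eq_norm_sq]
    nlinarith
  · intro ε hε
    have hpos : 0 < ε / (‖Lm‖^2 + 1) := by positivity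
    have ht : Tendsto (fun h => Lm h) (nhds 0) (nhds 0) := by
      have := Lm.continuous.tendsto 0
      rwa [map_zero] at this
    filter_upwards [ht.eventually (hD _ hpos)] with h hh hB
    have e1 := dual_ineq (J := J) hg _ hB (y + Lm h)
    have e2 := (abs_le.1 hh).2
    have e3 : ε / (‖Lm‖^2 + 1) * ‖Lm h‖^2 ≤ ε * ‖h‖^2 := by
      have : ‖Lm h‖^2 ≤ (‖Lm‖^2 + 1) * ‖h‖^2 := by
        have := pow_le_pow_left₀ (norm_nonneg _) (Lm.le_opNorm h) 2
        rw [mul_pow] at this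
        nlinarith [sq_nonneg ‖h‖]
      calc _ ≤ ε / (‖Lm‖^2 + 1) * ((‖Lm‖^2 + 1) * ‖h‖^2) := by gcongr
        _ = _ := by field_simp
    rw [hS]
    rw [norm_add_sq_real, inner_add_left, inner_add_right (𝕜 := ℝ) (y - J y) y (Lm h),
      inner_add_right (𝕜 := ℝ) h y (Lm h)] at e1
    rw [real_inner_self_eq_norm_sq]
    have e4 : inner ℝ (y - J y) h = inner ℝ h y - inner ℝ (J y) h := by
      rw [inner_sub_left, real_inner_comm y]
    rw [real_inner_comm h (Lm h)]
    linarith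

end Sums

section TS

variable {Z : Type*} [NormedAddCommGroup Z] [InnerProductSpace ℝ Z]

/-- second order superjet -/
def SupJet (f : Z → ℝ) (z p : Z) (X : Z →L[ℝ] Z) : Prop :=
  (∀ a b, inner ℝ (X a) b = inner ℝ a (X b)) ∧
  ∀ ε > (0:ℝ), ∀ᶠ h in nhds (0:Z),
    f (z + h) ≤ f z + inner ℝ p h + 1/2 * inner ℝ (X h) h + ε * ‖h‖^2

variable {ι : Type*} [Fintype ι] [FiniteDimensional ℝ Z]

abbrev PF (ι Z : Type*) := PiLp 2 (fun _ : ι => Z)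

theorem theorem_on_sums0 [DecidableEq ι] (f : ι → Z → ℝ) (r : ℝ) (hr : 0 < r)
    (hf : ∀ i, ContinuousOn (f i) (Metric.closedBall 0 r)) (hf0 : ∀ i, f i 0 = 0)
    (A : PiLp 2 (fun _ : ι => Z) →L[ℝ] PiLp 2 (fun _ : ι => Z))
    (hA : ∀ a b, inner ℝ (A a) b = inner ℝ a (A b))
    (hmax : ∀ x : PiLp 2 (fun _ : ι => Z), (∀ i, ‖x i‖ ≤ r) →
      ∑ i, f i (x i) ≤ 1/2 * inner ℝ (A x) x)
    (τ : ℝ) (hτ : 0 < τ) :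
    ∃ (x p : ι → Z) (X : ι → Z →L[ℝ] Z), (∀ i, ‖x i‖ < τ) ∧ (∀ i, ‖p i‖ < τ) ∧
      (∀ i, SupJet (f i) (x i) (p i) (X i)) ∧
      ∀ ζ : PiLp 2 (fun _ : ι => Z), ∑ i, inner ℝ (X i (ζ i)) (ζ i) ≤
        inner ℝ (A ζ) ζ + τ * ‖ζ‖^2 := by
  obtain ⟨lam, hlam⟩ : ∃ lam, lam = ‖A‖ + 1 := ⟨_, rfl⟩
  have hlam1 : 1 ≤ lam := by rw [hlam]; linarith [norm_nonneg A]
  have hAb : ∀ x : (PF ι Z), inner ℝ (A x) x ≤ (lam - 1) * ‖x‖^2 := by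
    intro x
    have := (real_inner_le_norm (A x) x).trans (mul_le_mul_of_nonneg_right (A.le_opNorm x) (norm_nonneg x))
    rw [hlam]; nlinarith
  set B : Set Z := Metric.closedBall 0 r with hB
  have hBc : IsCompact B := isCompact_closedBall 0 r
  have h0B : (0:Z) ∈ B := by simp [hB, hr.le]
  obtain ⟨k, hkdef⟩ : ∃ k : ι → Z → ℝ, k = fun i x => f i x - lam/2 * ‖x‖^2 := ⟨_, rfl⟩
  have hk0 : ∀ i, k i 0 = 0 := by intro i; simp [hkdef, hf0]
  have hkc : ∀ i, ContinuousOn (k i) B := by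
    intro i; rw [hkdef]; exact (hf i).sub (by fun_prop)
  have hcj := fun i => exists_conj B hBc ⟨0, h0B⟩ (k i) (hkc i)
  choose g hgconv hgcont hgup hgat using hcj
  have hgnn : ∀ i ξ, 0 ≤ g i ξ := by
    intro i ξ; have := hgup i ξ 0 h0B; rwa [hk0, inner_zero_left, add_zero] at this
  have hJex := fun i => exists_prox (g i) (hgconv i) (hgcont i) 0 0 (by
    intro ξ; simpa using hgnn i ξ)
  choose J hJ using hJex
  let M : (PF ι Z) →L[ℝ] (PF ι Z) := (1 + lam) • ContinuousLinearMap.id ℝ (PF ι Z) - A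
  have hM : ∀ x, M x = (1 + lam) • x - A x := fun x => by simp [M]
  have hMc : ∀ x, 2 * ‖x‖^2 ≤ inner ℝ (M x) x := by
    intro x
    have := hAb x
    rw [hM, inner_sub_left, inner_smul_left, real_inner_self_eq_norm_sq]
    simp only [conj_trivial]; linarith
  have hMs : ∀ a b, inner ℝ (M a) b = inner ℝ a (M b) := by
    intro a b; rw [hM, hM, inner_sub_left, inner_sub_right, hA, inner_smul_left, inner_smul_right]
    simp
  obtain ⟨Q, hQ1, hQ2⟩ := coercive_inv M 2 (by norm_num) hMc
  have hQs : ∀ a b, inner ℝ (Q a) b = inner ℝ a (Q b) := by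
    intro a b
    conv_lhs => rw [← hQ1 b]
    rw [← hMs, hQ1]
  have hQhalf : ∀ y, inner ℝ (Q y) y ≤ 1/2 * ‖y‖^2 := by
    intro y
    have h1 := hMc (Q y)
    rw [hQ1] at h1
    have h2 := real_inner_le_norm y (Q y)
    rw [real_inner_comm]
    have h3 : 0 ≤ inner ℝ y (Q y) := by nlinarith [sq_nonneg ‖Q y‖]
    by_cases hq : ‖Q y‖ = 0
    · rw [hq] at h2; nlinarith [sq_nonneg ‖y‖]
    · have : 0 < ‖Q y‖ := lt_of_le_of_ne (norm_nonneg _) (Ne.symm hq)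
      have : 2 * ‖Q y‖ ≤ ‖y‖ := by
        by_contra hh; push Not at hh; nlinarith
      nlinarith [norm_nonneg y]
  obtain ⟨e, he⟩ : ∃ e : (PF ι Z) → ℝ, e = fun y => ∑ i, mor (g i) (J i) (y i) := ⟨_, rfl⟩
  let JJ : (PF ι Z) → (PF ι Z) := fun y => WithLp.toLp 2 (fun i => J i (y i))
  have hJJ : ∀ y i, JJ y i = J i (y i) := fun y i => rfl
  have hinner : ∀ x y : (PF ι Z), inner ℝ x y = ∑ i, inner ℝ (x i) (y i) := fun x y => PiLp.inner_apply x y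
  have hnorm : ∀ x : (PF ι Z), ‖x‖^2 = ∑ i, ‖x i‖^2 := fun x => PiLp.norm_sq_eq_of_L2 _ x
  have hJlip : LipschitzWith 1 JJ := by
    apply LipschitzWith.of_dist_le_mul
    intro x y
    rw [NNReal.coe_one, one_mul, dist_eq_norm, dist_eq_norm]
    apply le_of_sq_le_sq _ (norm_nonneg _)
    rw [hnorm, hnorm]
    apply Finset.sum_le_sum
    intro i _
    apply pow_le_pow_left₀ (norm_nonneg _)
    have := (prox_lip (hJ i)).dist_le_mul (x i) (y i)
    simpa [dist_eq_norm] using this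
  have hgrad : ∀ y, HasFDerivAt e (innerSL ℝ (y - JJ y)) y := by
    intro y
    have h1 : ∀ i ∈ (Finset.univ : Finset ι), HasFDerivAt (fun y : (PF ι Z) => mor (g i) (J i) (y i))
        ((innerSL ℝ (y i - J i (y i))).comp (PiLp.proj 2 (fun _ : ι => Z) i: PF ι Z →L[ℝ] Z)) y := by
      intro i _
      exact (mor_hasFDerivAt (hJ i) (y i)).comp y
        (PiLp.proj 2 (fun _ : ι => Z) i: PF ι Z →L[ℝ] Z).hasFDerivAt
    rw [he]
    refine (HasFDerivAt.fun_sum h1).congr_fderiv ?_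
    ext h
    simp only [sum_apply, ContinuousLinearMap.comp_apply, innerSL_apply_apply]
    rw [hinner]
    rfl
  have heQ : ∀ y, e y ≤ 1/2 * inner ℝ (Q y) y := by
    intro y
    obtain ⟨w, hw⟩ : ∃ w, w = Q y := ⟨_, rfl⟩
    have hMw : M w = y := by rw [hw, hQ1]
    have h1 : ∀ i, ∃ x ∈ B, g i ((y - w) i) = k i x + inner ℝ x ((y - w) i) := fun i => hgat i _
    choose x hxB hx using h1
    obtain ⟨xx, hxx⟩ : ∃ xx : (PF ι Z), xx = WithLp.toLp 2 x := ⟨_, rfl⟩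
    have hxi : ∀ i, xx i = x i := fun i => by rw [hxx]
    have h2 : e y ≤ ∑ i, (k i (x i) + inner ℝ (x i) ((y - w) i) + 1/2 * ‖w i‖^2) := by
      rw [he]
      apply Finset.sum_le_sum
      intro i _
      have := mor_le (hJ i) (y i) ((y - w) i)
      rw [hx] at this
      have e1 : (y - w) i - y i = - w i := by simp
      rwa [e1, norm_neg] at this
    have h3 := hmax xx (by intro i; rw [hxi]; simpa [hB] using hxB i)
    have h4 : ∑ i, (k i (x i) + inner ℝ (x i) ((y - w) i) + 1/2 * ‖w i‖^2) =
        ∑ i, f i (xx i) - lam/2 * ‖xx‖^2 + inner ℝ xx (y - w) + 1/2 * ‖w‖^2 := by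
      rw [hnorm, hnorm, hinner, Finset.sum_add_distrib, Finset.sum_add_distrib, Finset.mul_sum,
        Finset.mul_sum, ← Finset.sum_sub_distrib]
      simp only [hxi, hkdef]
    have h5 : 0 ≤ inner ℝ (M (xx - w)) (xx - w) - ‖xx - w‖^2 := by
      have := hMc (xx - w); nlinarith [sq_nonneg ‖xx - w‖]
    have h6 : inner ℝ (M xx) xx = (1 + lam) * ‖xx‖^2 - inner ℝ (A xx) xx := by
      rw [hM, inner_sub_left, inner_smul_left, real_inner_self_eq_norm_sq]; simp
    rw [norm_sub_sq_real, map_sub, hMw, inner_sub_left, inner_sub_right, inner_sub_right, h6,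
      hMs xx w, hMw, real_inner_comm xx y] at h5
    rw [inner_sub_right] at h4
    rw [← hw, real_inner_comm]
    linarith
  have hei0 : ∀ i, 0 ≤ mor (g i) (J i) 0 := by
    intro i; unfold mor; have := hgnn i (J i 0); positivity
  have he0 : e 0 = 0 := by
    apply le_antisymm
    · simpa using heQ 0
    · rw [he]; exact Finset.sum_nonneg fun i _ => hei0 i
  have hJ0 : ∀ i, J i 0 = 0 := by
    intro i
    have h1 : mor (g i) (J i) 0 = 0 := by
      have : ∑ i, mor (g i) (J i) 0 = 0 := by simpa [he] using he0
      exact (Finset.sum_eq_zero_iff_of_nonneg (fun i _ => hei0 i)).1 this i (Finset.mem_univ i)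
    unfold mor at h1
    rw [sub_zero] at h1
    have : ‖J i 0‖^2 ≤ 0 := by linarith [hgnn i (J i 0)]
    have : ‖J i 0‖ = 0 := by nlinarith [norm_nonneg (J i 0)]
    exact norm_eq_zero.1 this
  -- constants
  obtain ⟨t1, ht1⟩ : ∃ t1, t1 = min (1/4) (τ / (2 * (‖M‖^2 + 1))) := ⟨_, rfl⟩
  have ht1p : 0 < t1 := by rw [ht1]; apply lt_min (by norm_num); positivity
  have ht1h : t1 ≤ 1/4 := by rw [ht1]; exact min_le_left _ _
  have ht1M : 2 * t1 * ‖M‖^2 ≤ τ := by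
    have : t1 ≤ τ / (2 * (‖M‖^2 + 1)) := by rw [ht1]; exact min_le_right _ _
    rw [le_div_iff₀ (by positivity)] at this
    nlinarith
  obtain ⟨rr, hrr⟩ : ∃ rr, rr = min τ r / (4 * (lam + 1)) := ⟨_, rfl⟩
  have hrr0 : 0 < rr := by rw [hrr]; apply div_pos (lt_min hτ hr); linarith
  have hrr1 : rr * (4 * (lam + 1)) = min τ r := by rw [hrr]; field_simp
  have hrrτ : rr * (4 * (lam + 1)) ≤ τ := by rw [hrr1]; exact min_le_left _ _
  have hrrr : rr * (4 * (lam + 1)) ≤ r := by rw [hrr1]; exact min_le_right _ _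
  obtain ⟨y, hyr, hyd, hyup⟩ := jensen e JJ hJlip hgrad Q hQs heQ he0 t1 rr ht1p hrr0
  have hyi : ∀ i, ‖y i‖ ≤ rr := fun i => (PiLp.norm_apply_le y i).trans hyr
  have hJyi : ∀ i, ‖J i (y i)‖ ≤ rr := by
    intro i
    have := (prox_lip (hJ i)).dist_le_mul (y i) 0
    rw [hJ0] at this
    simp at this
    exact this.trans (hyi i)
  have hxi : ∀ i, ‖y i - J i (y i)‖ ≤ 2 * rr := by
    intro i; have := norm_sub_le (y i) (J i (y i)); linarith [hyi i, hJyi i]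
  -- block differentiability
  have hJd : ∀ i, DifferentiableAt ℝ (J i) (y i) := by
    intro i
    let ins : Z → (PF ι Z) := fun z => y + PiLp.single 2 i (z - y i)
    have h1 : DifferentiableAt ℝ ins (y i) := by
      have h2 : DifferentiableAt ℝ (fun z : Z => (PiLp.single 2 i (z - y i) : (PF ι Z))) (y i) := by
        have : (fun z : Z => (PiLp.single 2 i (z - y i) : (PF ι Z))) =
          fun z => (LinearMap.toContinuousLinearMap
            (((WithLp.linearEquiv 2 ℝ (ι → Z)).symm : (ι → Z) →ₗ[ℝ] (PF ι Z)).comp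
              (LinearMap.single ℝ (fun _ : ι => Z) i))) (z - y i) := by
          ext z; rfl
        rw [this]; fun_prop
      exact h2.const_add y
    have h3 : J i = fun z => (PiLp.proj 2 (fun _ : ι => Z) i: PF ι Z →L[ℝ] Z) (JJ (ins z)) := by
      ext z
      simp [ins, JJ]
    rw [h3]
    apply DifferentiableAt.comp (𝕜 := ℝ) (y i)
      (g := (PiLp.proj 2 (fun _ : ι => Z) i: PF ι Z →L[ℝ] Z))
    · fun_prop
    · have h4 : DifferentiableAt ℝ JJ (ins (y i)) := by
        have hins : ins (y i) = y := by
          ext j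
          simp [ins]
        rw [hins]; exact hyd
      exact h4.comp (y i) h1
  have hup1 : ∀ i h, mor (g i) (J i) (y i + h) ≤ mor (g i) (J i) (y i) +
      inner ℝ (y i - J i (y i)) h + 1/2 * inner ℝ (Q (PiLp.single 2 i h)) (PiLp.single 2 i h : (PF ι Z))
        + t1/2 * ‖h‖^2 := by
    intro i h
    have h1 := hyup (PiLp.single 2 i h)
    rw [PiLp.norm_single] at h1
    have h2 : e (y + PiLp.single 2 i h) = e y - mor (g i) (J i) (y i) + mor (g i) (J i) (y i + h) := by
      rw [he]
      simp only
      rw [← Finset.add_sum_erase _ _ (Finset.mem_univ i),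
        ← Finset.add_sum_erase (a := i) _ (fun j => mor (g j) (J j) (y j)) (Finset.mem_univ i)]
      have : ∑ j ∈ Finset.univ.erase i, mor (g j) (J j) ((y + PiLp.single 2 i h : (PF ι Z)) j) =
          ∑ j ∈ Finset.univ.erase i, mor (g j) (J j) (y j) := by
        apply Finset.sum_congr rfl
        intro j hj
        have : j ≠ i := Finset.ne_of_mem_erase hj
        simp [this]
      rw [this]
      simp
      ring
    have h3 : inner ℝ (y - JJ y) (PiLp.single 2 i h : (PF ι Z)) = inner ℝ (y i - J i (y i)) h := by
      rw [hinner, Finset.sum_eq_single i]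
      · simp [hJJ]
      · intro j _ hj; simp [hj]
      · simp
    rw [h2, h3] at h1
    linarith
  have hup2 : ∀ i h, mor (g i) (J i) (y i + h) ≤ mor (g i) (J i) (y i) +
      inner ℝ (y i - J i (y i)) h + (1/4 + t1/2) * ‖h‖^2 := by
    intro i h
    have h1 := hup1 i h
    have h2 := hQhalf (PiLp.single 2 i h)
    rw [PiLp.norm_single] at h2
    linarith
  -- strict coefficient
  have hct := fun i => contact (hgup i) (hgat i) (y i) (1/4 + t1/2)
    (by linarith) (hup2 i)
  have hsec := fun i => mor_second (hJ i) (y i) (hJd i)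
  choose D hDs hD using hsec
  have hjet := fun i => contact_jet (hJ i) (hgup i) (y i) (hct i).2 (D i) (hDs i) (hD i) t1 ht1p
  choose S hSs hSlow hSjet using hjet
  have hDQ : ∀ w : (PF ι Z), 0 ≤ inner ℝ (Q w) w + t1 * ‖w‖^2 - ∑ i, inner ℝ (D i (w i)) (w i) := by
    apply quad_nonneg
    · intro s h
      simp only [map_smul, inner_smul_left, inner_smul_right, norm_smul, mul_pow, Real.norm_eq_abs,
        sq_abs, PiLp.smul_apply, conj_trivial]
      simp only [← mul_assoc, ← Finset.mul_sum]; ring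
    · intro ε hε
      have h1 : ∀ i, ∀ᶠ h in nhds (0:(PF ι Z)), |mor (g i) (J i) (y i + h i) - mor (g i) (J i) (y i)
          - inner ℝ (y i - J i (y i)) (h i) - 1/2 * inner ℝ (D i (h i)) (h i)| ≤ ε/2 * ‖h i‖^2 := by
        intro i
        have ht : Tendsto (fun h : (PF ι Z) => h i) (nhds 0) (nhds 0) := by
          have := (PiLp.proj 2 (fun _ : ι => Z) i: PF ι Z →L[ℝ] Z).continuous.tendsto 0
          rw [map_zero] at this
          exact this
        exact ht.eventually (hD i (ε/2) (by linarith))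
      filter_upwards [eventually_all.2 h1] with h hh
      have h2 := hyup h
      have h3 : ∑ i, (mor (g i) (J i) (y i) + inner ℝ (y i - J i (y i)) (h i)
          + 1/2 * inner ℝ (D i (h i)) (h i) - ε/2 * ‖h i‖^2) ≤ e (y + h) := by
        rw [he]
        apply Finset.sum_le_sum
        intro i _
        have := (abs_le.1 (hh i)).1
        simp only [PiLp.add_apply]
        linarith
      simp only [Finset.sum_add_distrib, Finset.sum_sub_distrib, ← Finset.mul_sum] at h3
      rw [← hnorm] at h3
      have h4 : inner ℝ (y - JJ y) h = ∑ i, inner ℝ (y i - J i (y i)) (h i) := by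
        rw [hinner]; rfl
      have h5 : e y = ∑ i, mor (g i) (J i) (y i) := by rw [he]
      rw [h4, h5] at h2
      linarith
  refine ⟨fun i => y i - J i (y i), fun i => lam • (y i - J i (y i)) - J i (y i),
    fun i => lam • ContinuousLinearMap.id ℝ Z - S i, ?_, ?_, ?_, ?_⟩
  · intro i; have := hxi i; simp only; nlinarith
  · intro i
    simp only
    have h1 := norm_sub_le (lam • (y i - J i (y i))) (J i (y i))
    rw [norm_smul, Real.norm_eq_abs, abs_of_nonneg (by linarith)] at h1
    have := mul_le_mul_of_nonneg_left (hxi i) (show 0 ≤ lam by linarith)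
    nlinarith [hJyi i]
  · intro i
    constructor
    · intro a b
      simp [inner_sub_left, inner_sub_right, inner_smul_left, inner_smul_right, hSs i a b]
    · intro ε hε
      have hnb : ∀ᶠ h in nhds (0:Z), (y i - J i (y i)) + h ∈ B := by
        have h1 : ∀ᶠ h in nhds (0:Z), ‖h‖ < r/2 := by
          have := Metric.ball_mem_nhds (0:Z) (show 0 < r/2 by linarith)
          filter_upwards [this] with h hh
          simpa using hh
        filter_upwards [h1] with h hh
        simp only [hB, mem_closedBall_zero_iff]
        have := norm_add_le (y i - J i (y i)) h
        have := hxi i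
        nlinarith
      filter_upwards [hnb, hSjet i ε hε] with h hh1 hh2
      have h3 := hh2 hh1
      simp only [hkdef] at h3
      rw [norm_add_sq_real] at h3
      simp only [inner_sub_left, inner_smul_left, sub_apply, smul_apply,
        ContinuousLinearMap.id_apply, real_inner_self_eq_norm_sq, conj_trivial] at h3 ⊢
      linarith
  · intro ζ
    have h1 : ∑ i, (2 * inner ℝ (M ζ i) (ζ i) - inner ℝ (D i (M ζ i)) (M ζ i) - t1 * ‖M ζ i‖^2
        - ‖ζ i‖^2) ≤ ∑ i, inner ℝ (S i (ζ i)) (ζ i) :=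
      Finset.sum_le_sum fun i _ => hSlow i (ζ i) (M ζ i)
    simp only [Finset.sum_sub_distrib, ← Finset.mul_sum] at h1
    rw [← hnorm, ← hnorm, ← hinner] at h1
    have h2 := hDQ (M ζ)
    rw [hQ2] at h2
    have h3 : ‖M ζ‖^2 ≤ ‖M‖^2 * ‖ζ‖^2 := by
      rw [← mul_pow]; exact pow_le_pow_left₀ (norm_nonneg _) (M.le_opNorm ζ) 2
    have h4 : inner ℝ (M ζ) ζ = (1 + lam) * ‖ζ‖^2 - inner ℝ (A ζ) ζ := by
      rw [hM, inner_sub_left, inner_smul_left, real_inner_self_eq_norm_sq]; simp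
    rw [real_inner_comm] at h2
    have h5 : ∑ i, inner ℝ ((lam • ContinuousLinearMap.id ℝ Z - S i) (ζ i)) (ζ i) =
        lam * ‖ζ‖^2 - ∑ i, inner ℝ (S i (ζ i)) (ζ i) := by
      rw [hnorm, Finset.mul_sum, ← Finset.sum_sub_distrib]
      apply Finset.sum_congr rfl
      intro i _
      simp [inner_sub_left, inner_smul_left]
    rw [h5]
    nlinarith [sq_nonneg ‖ζ‖, mul_le_mul_of_nonneg_left h3 ht1p.le,
      mul_le_mul_of_nonneg_right ht1M (sq_nonneg ‖ζ‖)]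

end TS

section TS3

variable {Z : Type*} [NormedAddCommGroup Z] [InnerProductSpace ℝ Z]
variable {ι : Type*} [Fintype ι] [FiniteDimensional ℝ Z]

theorem theorem_on_sums [DecidableEq ι] (f : ι → Z → ℝ) (z P : ι → Z) (r : ℝ) (hr : 0 < r)
    (hf : ∀ i, ContinuousOn (f i) (Metric.closedBall (z i) r))
    (A : PF ι Z →L[ℝ] PF ι Z)
    (hA : ∀ a b, inner ℝ (A a) b = inner ℝ a (A b))
    (hmax : ∀ h : PF ι Z, (∀ i, ‖h i‖ ≤ r) →
      ∑ i, f i (z i + h i) ≤ ∑ i, (f i (z i) + inner ℝ (P i) (h i)) + 1/2 * inner ℝ (A h) h)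
    (τ : ℝ) (hτ : 0 < τ) :
    ∃ (x p : ι → Z) (X : ι → Z →L[ℝ] Z), (∀ i, ‖x i - z i‖ < τ) ∧ (∀ i, ‖p i - P i‖ < τ) ∧
      (∀ i, SupJet (f i) (x i) (p i) (X i)) ∧
      ∀ ζ : PF ι Z, ∑ i, inner ℝ (X i (ζ i)) (ζ i) ≤
        inner ℝ (A ζ) ζ + τ * ‖ζ‖^2 := by
  have c1 : ∀ i, ContinuousOn (fun h => f i (z i + h) - f i (z i) - inner ℝ (P i) h)
      (Metric.closedBall 0 r) := by
    intro i
    refine ((((hf i).comp (f := fun h => z i + h) (by fun_prop) ?_).sub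
      continuousOn_const).sub (by fun_prop))
    intro h hh
    simpa using hh
  obtain ⟨x, p, X, h1, h2, h3, h4⟩ := theorem_on_sums0
    (fun i h => f i (z i + h) - f i (z i) - inner ℝ (P i) h) r hr c1
    (by intro i; simp) A hA (by
    intro h hh
    have := hmax h hh
    simp only [Finset.sum_sub_distrib, Finset.sum_add_distrib] at this ⊢
    linarith) τ hτ
  refine ⟨fun i => z i + x i, fun i => P i + p i, X, ?_, ?_, ?_, h4⟩
  · intro i; simpa using h1 i
  · intro i; simpa using h2 i
  · intro i
    refine ⟨(h3 i).1, ?_⟩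
    intro ε hε
    filter_upwards [(h3 i).2 ε hε] with h hh
    rw [← add_assoc, inner_add_right] at hh
    rw [inner_add_left]
    linarith

theorem SupJet.of_smul {Z : Type*} [NormedAddCommGroup Z] [InnerProductSpace ℝ Z] {f : Z → ℝ} {w : ℝ} (hw : 0 < w) {z p : Z} {X : Z →L[ℝ] Z}
    (h : SupJet (fun y => w * f y) z p X) : SupJet f z (w⁻¹ • p) (w⁻¹ • X) := by
  refine ⟨?_, ?_⟩
  · intro a b; simp [inner_smul_left, inner_smul_right, h.1 a b]
  · intro ε hε
    filter_upwards [h.2 (w * ε) (by positivity)] with y hy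
    simp only [smul_apply, inner_smul_left, conj_trivial]
    have e : w⁻¹ * (w * f (z + y)) ≤ w⁻¹ * (w * f z + inner ℝ p y + 1/2 * inner ℝ (X y) y
      + w * ε * ‖y‖^2) := by gcongr
    have hw' : w⁻¹ * w = 1 := inv_mul_cancel₀ hw.ne'
    calc f (z + y) = w⁻¹ * (w * f (z + y)) := by rw [← mul_assoc, hw', one_mul]
      _ ≤ _ := e
      _ = (w⁻¹ * w) * f z + w⁻¹ * inner ℝ p y + 1/2 * (w⁻¹ * inner ℝ (X y) y)
          + (w⁻¹ * w) * ε * ‖y‖^2 := by ring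
      _ = _ := by rw [hw']; ring

variable {X : Type*} [NormedAddCommGroup X] [InnerProductSpace ℝ X] [FiniteDimensional ℝ X]

/-- space-time -/
abbrev ST (X : Type*) := WithLp 2 (X × ℝ)

/-- point of space-time -/
abbrev stp (x : X) (t : ℝ) : ST X := WithLp.toLp 2 (x, t)

theorem supjet_lip {f : ST X → ℝ} {z p : ST X} {Y : ST X →L[ℝ] ST X} (h : SupJet f z p Y)
    (K : ℝ) (hK : ∀ᶠ h in nhds (0:X), f z - K * ‖h‖ ≤ f (z + stp h 0)) (hK0 : 0 ≤ K) : ‖p.fst‖ ≤ K := by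
  by_contra hneg
  push Not at hneg
  set q := p.fst with hq
  have hq0 : 0 < ‖q‖ := lt_of_le_of_lt hK0 hneg
  -- take h = -s q
  obtain ⟨c, hc⟩ : ∃ c, c = |inner ℝ (Y (stp q 0)) (stp q 0)| + ‖q‖^2 := ⟨_, rfl⟩
  have hc0 : 0 < c := by rw [hc]; positivity
  have ht : Tendsto (fun s : ℝ => -(s • q)) (nhdsWithin 0 (Set.Ioi 0)) (nhds (0:X)) := by
    have : Tendsto (fun s : ℝ => -(s • q)) (nhds 0) (nhds (-((0:ℝ) • q))) := by
      apply Continuous.tendsto; fun_prop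
    rw [zero_smul, neg_zero] at this
    exact this.mono_left nhdsWithin_le_nhds
  have ht2 : Tendsto (fun s : ℝ => stp (-(s • q)) 0) (nhdsWithin 0 (Set.Ioi 0)) (nhds (0:ST X)) := by
    have h1 : Tendsto (fun h : X => stp h 0) (nhds 0) (nhds (stp 0 0)) := by
      apply Continuous.tendsto
      exact (WithLp.prod_continuous_toLp 2 X ℝ).comp (by fun_prop)
    have h2 : (stp (0:X) 0) = 0 := rfl
    rw [h2] at h1
    exact h1.comp ht
  have hsm : ∀ᶠ s : ℝ in nhdsWithin 0 (Set.Ioi 0), s < ‖q‖ * (‖q‖ - K) / c := by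
    apply nhdsWithin_le_nhds
    apply Iio_mem_nhds
    apply div_pos _ hc0
    apply mul_pos hq0; linarith
  obtain ⟨s, ⟨⟨hs1, hs2⟩, hs3⟩, hs0⟩ := (((ht.eventually hK).and
    (ht2.eventually (h.2 1 one_pos))).and hsm |>.and self_mem_nhdsWithin).exists
  have hs0 : 0 < s := hs0
  have e0 : stp (-(s • q)) 0 = (-s) • stp q 0 := by
    show WithLp.toLp 2 _ = (-s) • WithLp.toLp 2 _
    rw [← WithLp.toLp_smul]; simp
  rw [norm_neg, norm_smul, Real.norm_of_nonneg hs0.le] at hs1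
  rw [e0] at hs1 hs2
  rw [map_smul, inner_smul_left, inner_smul_right, inner_smul_right, norm_smul] at hs2
  have e1 : inner ℝ p (stp q 0) = ‖q‖^2 := by
    rw [WithLp.prod_inner_apply]; simp [← hq]
  have e2 : ‖stp q 0‖ = ‖q‖ := WithLp.norm_toLp_fst ..
  rw [e1, e2] at hs2
  simp only [conj_trivial, norm_neg, Real.norm_of_nonneg hs0.le] at hs2
  rw [lt_div_iff₀ hc0] at hs3
  have e3 := le_abs_self (inner ℝ (Y (stp q 0)) (stp q 0))
  have e4 : 1/2 * (-s * (-s * inner ℝ (Y (stp q 0)) (stp q 0))) + 1 * (s * ‖q‖)^2 ≤ s * (s * c) := by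
    rw [hc]
    have : s^2 * inner ℝ (Y (stp q 0)) (stp q 0) ≤ s^2 * |inner ℝ (Y (stp q 0)) (stp q 0)| := by gcongr
    have : 0 ≤ s^2 * |inner ℝ (Y (stp q 0)) (stp q 0)| := by positivity
    nlinarith
  have e5 : s * (s * c) < s * (‖q‖ * (‖q‖ - K)) := by gcongr
  nlinarith

theorem ts3 (f1 f2 f3 : ST X → ℝ) (z1 z2 z3 P1 P2 P3 : ST X) (r : ℝ) (hr : 0 < r)
    (hf1 : ContinuousOn f1 (Metric.closedBall z1 r))
    (hf2 : ContinuousOn f2 (Metric.closedBall z2 r))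
    (hf3 : ContinuousOn f3 (Metric.closedBall z3 r))
    (n κ : ℝ) (S : X →L[ℝ] X) (hS : ∀ a b, inner ℝ (S a) b = inner ℝ a (S b))
    (hmax : ∀ h1 h2 h3 : ST X, ‖h1‖ ≤ r → ‖h2‖ ≤ r → ‖h3‖ ≤ r →
      f1 (z1 + h1) + f2 (z2 + h2) + f3 (z3 + h3) ≤ f1 z1 + f2 z2 + f3 z3
        + inner ℝ P1 h1 + inner ℝ P2 h2 + inner ℝ P3 h3
        + n/2 * (‖h1.fst - h3.fst‖^2 + ‖h2.fst - h3.fst‖^2)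
        + 1/2 * inner ℝ (S h3.fst) h3.fst + κ * (h1.snd^2 + h3.snd^2))
    (τ : ℝ) (hτ : 0 < τ) :
    ∃ (x1 x2 x3 p1 p2 p3 : ST X) (X1 X2 X3 : ST X →L[ℝ] ST X),
      ‖x1 - z1‖ < τ ∧ ‖x2 - z2‖ < τ ∧ ‖x3 - z3‖ < τ ∧
      ‖p1 - P1‖ < τ ∧ ‖p2 - P2‖ < τ ∧ ‖p3 - P3‖ < τ ∧
      SupJet f1 x1 p1 X1 ∧ SupJet f2 x2 p2 X2 ∧ SupJet f3 x3 p3 X3 ∧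
      ∀ ζ1 ζ2 ζ3 : X, inner ℝ (X1 (stp ζ1 0)) (stp ζ1 0) + inner ℝ (X2 (stp ζ2 0)) (stp ζ2 0)
        + inner ℝ (X3 (stp ζ3 0)) (stp ζ3 0) ≤
        n * (‖ζ1 - ζ3‖^2 + ‖ζ2 - ζ3‖^2) + inner ℝ (S ζ3) ζ3
          + τ * (‖ζ1‖^2 + ‖ζ2‖^2 + ‖ζ3‖^2) := by
  let pr : Fin 3 → PF (Fin 3) (ST X) →L[ℝ] ST X := fun i => PiLp.proj 2 (fun _ : Fin 3 => ST X) i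
  let fs : ST X →L[ℝ] X := WithLp.fstL 2 ℝ X ℝ
  let sn : ST X →L[ℝ] ℝ := WithLp.sndL 2 ℝ X ℝ
  let T1 := fs.comp (pr 0) - fs.comp (pr 2)
  let T2 := fs.comp (pr 1) - fs.comp (pr 2)
  let T3 := fs.comp (pr 2)
  let T4 := sn.comp (pr 0)
  let T5 := sn.comp (pr 2)
  let A : PF (Fin 3) (ST X) →L[ℝ] PF (Fin 3) (ST X) :=
    n • ((ContinuousLinearMap.adjoint T1).comp T1) + n • ((ContinuousLinearMap.adjoint T2).comp T2)
     + (ContinuousLinearMap.adjoint T3).comp (S.comp T3)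
     + (2 * κ) • ((ContinuousLinearMap.adjoint T4).comp T4)
     + (2 * κ) • ((ContinuousLinearMap.adjoint T5).comp T5)
  have hAi : ∀ a b, inner ℝ (A a) b = n * inner ℝ (T1 a) (T1 b) + n * inner ℝ (T2 a) (T2 b)
      + inner ℝ (S (T3 a)) (T3 b) + 2 * κ * inner ℝ (T4 a) (T4 b) + 2 * κ * inner ℝ (T5 a) (T5 b) := by
    intro a b
    simp only [A, add_apply, smul_apply, ContinuousLinearMap.comp_apply, inner_add_left,
      inner_smul_left, ContinuousLinearMap.adjoint_inner_left, conj_trivial]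
  have hT1 : ∀ a, T1 a = (a 0).fst - (a 2).fst := fun a => rfl
  have hT2 : ∀ a, T2 a = (a 1).fst - (a 2).fst := fun a => rfl
  have hT3 : ∀ a, T3 a = (a 2).fst := fun a => rfl
  have hT4 : ∀ a, T4 a = (a 0).snd := fun a => rfl
  have hT5 : ∀ a, T5 a = (a 2).snd := fun a => rfl
  have hAs : ∀ a b, inner ℝ (A a) b = inner ℝ a (A b) := by
    intro a b
    rw [real_inner_comm (A b) a, hAi a b, hAi b a, hS, real_inner_comm (T1 b), real_inner_comm (T2 b),
      real_inner_comm (T4 b), real_inner_comm (T5 b), real_inner_comm (S (T3 b))]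
  obtain ⟨x, p, Y, h1, h2, h3, h4⟩ := theorem_on_sums ![f1, f2, f3] ![z1, z2, z3] ![P1, P2, P3] r hr
    (by intro i; fin_cases i; exacts [hf1, hf2, hf3]) A hAs (by
      intro h hh
      have := hmax (h 0) (h 1) (h 2) (hh 0) (hh 1) (hh 2)
      rw [hAi, hT1, hT2, hT3, hT4, hT5]
      simp only [Fin.sum_univ_three, real_inner_self_eq_norm_sq, Matrix.cons_val_zero,
        Matrix.cons_val_one, Matrix.cons_val, Real.norm_eq_abs, sq_abs]
      linarith) τ hτ
  refine ⟨x 0, x 1, x 2, p 0, p 1, p 2, Y 0, Y 1, Y 2, h1 0, h1 1, h1 2, h2 0, h2 1, h2 2,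
    h3 0, h3 1, h3 2, ?_⟩
  intro ζ1 ζ2 ζ3
  have h5 := h4 (WithLp.toLp 2 ![stp ζ1 0, stp ζ2 0, stp ζ3 0])
  rw [hAi, hT1, hT2, hT3, hT4, hT5, PiLp.norm_sq_eq_of_L2] at h5
  simp only [Fin.sum_univ_three, real_inner_self_eq_norm_sq, Matrix.cons_val_zero,
        Matrix.cons_val_one, Matrix.cons_val, WithLp.norm_toLp_fst, WithLp.toLp_fst,
        WithLp.toLp_snd, norm_zero] at h5
  linarith

end TS3

section Doubl

theorem ev_small (a α : ℝ) (hα : 0 < α) :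
    ∀ᶠ ε in nhdsWithin (0:ℝ) (Set.Ioi 0), a * ε ≤ α := by
  have h1 : Tendsto (fun ε : ℝ => a * ε) (nhdsWithin 0 (Set.Ioi 0)) (nhds (a * 0)) :=
    (Continuous.tendsto (by fun_prop) 0).mono_left nhdsWithin_le_nhds
  rw [mul_zero] at h1
  exact h1.eventually_le_const hα

theorem doubling_num (ι n ε L η d1 d2 dy dt ds : ℝ) (hι : 0 < ι) (hη : 0 < η) (hL : 0 ≤ L) (hε : 0 < ε)
    (hn0 : 0 < n) (hnε : n * ε = 1) (hd1n : 0 ≤ d1) (hd2n : 0 ≤ d2) (hdy : 0 ≤ dy)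
    (hε1 : 4 * ε * L ≤ η/2) (hε2 : 16 * ε * L^2 ≤ η)  (hε3 : 4 * ε * L^2 ≤ ι * (η/2)^2)
    (h5 : ι * (dy^2 + dt^2 + ds^2) + n/2 * (d1^2 + d2^2) ≤ L * (d1 + d2)) :
    dy ≤ η/2 ∧ d1 ≤ η/2 ∧ d2 ≤ η/2 ∧ |dt| ≤ η ∧ |ds| ≤ η ∧ n * d1^2 ≤ η ∧ n * d2^2 ≤ η := by
  have h6 : 0 ≤ ι * (dy^2 + dt^2 + ds^2) := by positivity
  have h7 : d1 + d2 ≤ 4 * ε * L := by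
    have e1 : n/2 * (d1^2 + d2^2) ≤ L * (d1 + d2) := by linarith
    have e2 : ε * (n/2 * (d1^2 + d2^2)) ≤ ε * (L * (d1 + d2)) := by gcongr
    have e3 : ε * (n/2 * (d1^2 + d2^2)) = (d1^2 + d2^2)/2 := by
      have : ε * (n/2 * (d1^2 + d2^2)) = (n * ε) * ((d1^2 + d2^2)/2) := by ring
      rw [this, hnε, one_mul]
    have e4 : (d1 + d2)^2 ≤ 4 * ε * L * (d1 + d2) := by nlinarith [sq_nonneg (d1 - d2)]
    by_contra hcon
    push Not at hcon
    have : 0 ≤ 4 * ε * L := by positivity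
    nlinarith
  have h8 : n/2 * (d1^2 + d2^2) + ι * (dy^2 + dt^2 + ds^2) ≤ 4 * ε * L^2 := by
    nlinarith
  have hn1 : 0 ≤ n * d1^2 := by positivity
  have hn2 : 0 ≤ n * d2^2 := by positivity
  have h9 : dy^2 + dt^2 + ds^2 ≤ (η/2)^2 := by
    have : ι * (dy^2 + dt^2 + ds^2) ≤ ι * (η/2)^2 := by nlinarith
    exact le_of_mul_le_mul_left this hι
  have hy : dy ≤ η/2 := by
    apply le_of_sq_le_sq _ (by linarith); nlinarith [sq_nonneg dt, sq_nonneg ds]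
  refine ⟨hy, by linarith, by linarith, ?_, ?_, by nlinarith, by nlinarith⟩
  · apply abs_le_of_sq_le_sq _ hη.le; nlinarith [sq_nonneg dy, sq_nonneg ds]
  · apply abs_le_of_sq_le_sq _ hη.le; nlinarith [sq_nonneg dy, sq_nonneg dt]

variable {X : Type*} [NormedAddCommGroup X] [InnerProductSpace ℝ X] [FiniteDimensional ℝ X]

theorem doubling (f1 f3 : X → ℝ → ℝ) (f2 : X → ℝ) (xh : X) (th sh r : ℝ) (hr : 0 < r)
    (hrt : r < th) (hrs : r < sh)
    (hc1 : ContinuousOn (fun z : X × ℝ => f1 z.1 z.2) {z | 0 < z.2})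
    (hc3 : ContinuousOn (fun z : X × ℝ => f3 z.1 z.2) {z | 0 < z.2})
    (L : ℝ) (hL : 0 ≤ L)
    (hl1 : ∀ t, 0 ≤ t → ∀ x y, |f1 x t - f1 y t| ≤ L * ‖x - y‖)
    (hl2 : ∀ x y, |f2 x - f2 y| ≤ L * ‖x - y‖)
    (q : X) (a b κ ι : ℝ) (S : X →L[ℝ] X) (hι : 0 < ι)
    (hmax : ∀ x t s, ‖x - xh‖ ≤ r → |t - th| ≤ r → |s - sh| ≤ r →
      f1 x t + f2 x - f3 x s ≤ f1 xh th + f2 xh - f3 xh sh + inner ℝ q (x - xh) + a * (t - th)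
        + b * (s - sh) + 1/2 * inner ℝ (S (x - xh)) (x - xh) + κ * ((t - th)^2 + (s - sh)^2)
        - ι * (‖x - xh‖^2 + (t - th)^2 + (s - sh)^2))
    (η : ℝ) (hη : 0 < η) :
    ∃ (n : ℝ) (x z y : X) (t s : ℝ), 0 < n ∧ ‖x - xh‖ ≤ η ∧ ‖z - xh‖ ≤ η ∧ ‖y - xh‖ ≤ η ∧
      |t - th| ≤ η ∧ |s - sh| ≤ η ∧ n * ‖x - y‖^2 ≤ η ∧ n * ‖z - y‖^2 ≤ η ∧
      ∀ x' z' y' t' s', ‖x' - xh‖ ≤ r → ‖z' - xh‖ ≤ r → ‖y' - xh‖ ≤ r → |t' - th| ≤ r →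
        |s' - sh| ≤ r →
        f1 x' t' + f2 z' - f3 y' s' - (inner ℝ q (y' - xh) + a * (t' - th)
        + b * (s' - sh) + 1/2 * inner ℝ (S (y' - xh)) (y' - xh) + κ * ((t' - th)^2 + (s' - sh)^2))
        - n/2 * (‖x' - y'‖^2 + ‖z' - y'‖^2) ≤
        f1 x t + f2 z - f3 y s - (inner ℝ q (y - xh) + a * (t - th)
        + b * (s - sh) + 1/2 * inner ℝ (S (y - xh)) (y - xh) + κ * ((t - th)^2 + (s - sh)^2))
        - n/2 * (‖x - y‖^2 + ‖z - y‖^2) := by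
  -- choice of n = 1/ε
  obtain ⟨ε, hε, hε1, hε2, hε3⟩ : ∃ ε : ℝ, 0 < ε ∧ 4 * ε * L ≤ η/2 ∧ 16 * ε * L^2 ≤ η ∧
      4 * ε * L^2 ≤ ι * (η/2)^2 := by
    have g1 := ev_small (4 * L) (η/2) (by linarith)
    have g2 := ev_small (16 * L^2) η hη
    have g3 := ev_small (4 * L^2) (ι * (η/2)^2) (by positivity)
    obtain ⟨ε, ⟨⟨h1, h2⟩, h3⟩, h4⟩ := ((g1.and g2).and g3 |>.and self_mem_nhdsWithin).exists
    exact ⟨ε, h4, by linarith, by linarith, by linarith⟩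
  obtain ⟨n, hn⟩ : ∃ n, n = 1/ε := ⟨_, rfl⟩
  have hn0 : 0 < n := by rw [hn]; positivity
  have hnε : n * ε = 1 := by rw [hn]; field_simp
  let K : Set (X × X × X × ℝ × ℝ) := Metric.closedBall xh r ×ˢ Metric.closedBall xh r ×ˢ
    Metric.closedBall xh r ×ˢ Metric.closedBall th r ×ˢ Metric.closedBall sh r
  have hK : IsCompact K := (isCompact_closedBall _ _).prod ((isCompact_closedBall _ _).prod
    ((isCompact_closedBall _ _).prod ((isCompact_closedBall _ _).prod (isCompact_closedBall _ _))))
  have hmem : ∀ x z y t s, (x, z, y, t, s) ∈ K ↔ (‖x - xh‖ ≤ r ∧ ‖z - xh‖ ≤ r ∧ ‖y - xh‖ ≤ r ∧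
      |t - th| ≤ r ∧ |s - sh| ≤ r) := by
    intro x z y t s
    simp [K, Set.mem_prod, dist_eq_norm]
  let Φ : X × X × X × ℝ × ℝ → ℝ := fun w => f1 w.1 w.2.2.2.1 + f2 w.2.1 - f3 w.2.2.1 w.2.2.2.2
    - (inner ℝ q (w.2.2.1 - xh) + a * (w.2.2.2.1 - th)
        + b * (w.2.2.2.2 - sh) + 1/2 * inner ℝ (S (w.2.2.1 - xh)) (w.2.2.1 - xh)
        + κ * ((w.2.2.2.1 - th)^2 + (w.2.2.2.2 - sh)^2))
        - n/2 * (‖w.1 - w.2.2.1‖^2 + ‖w.2.1 - w.2.2.1‖^2)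
  have hf2c : Continuous f2 := by
    have : LipschitzWith L.toNNReal f2 := by
      apply LipschitzWith.of_dist_le_mul
      intro x y
      rw [Real.coe_toNNReal _ hL, Real.dist_eq, dist_eq_norm]; exact hl2 x y
    exact this.continuous
  have hpos : ∀ w ∈ K, 0 < w.2.2.2.1 ∧ 0 < w.2.2.2.2 := by
    rintro ⟨x, z, y, t, s⟩ hw
    obtain ⟨_, _, _, h4, h5⟩ := (hmem _ _ _ _ _).1 hw
    have := abs_le.1 h4; have := abs_le.1 h5
    constructor <;> simp only <;> linarith
  have hΦ : ContinuousOn Φ K := by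
    have g1 : ContinuousOn (fun w : X × X × X × ℝ × ℝ => f1 w.1 w.2.2.2.1) K :=
      hc1.comp (f := fun w : X × X × X × ℝ × ℝ => (w.1, w.2.2.2.1)) (by fun_prop)
        (fun w hw => (hpos w hw).1)
    have g3 : ContinuousOn (fun w : X × X × X × ℝ × ℝ => f3 w.2.2.1 w.2.2.2.2) K :=
      hc3.comp (f := fun w : X × X × X × ℝ × ℝ => (w.2.2.1, w.2.2.2.2)) (by fun_prop)
        (fun w hw => (hpos w hw).2)
    have g2 : ContinuousOn (fun w : X × X × X × ℝ × ℝ => f2 w.2.1) K := by fun_prop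
    refine (((g1.add g2).sub g3).sub ?_).sub ?_
    · apply Continuous.continuousOn; fun_prop
    · apply Continuous.continuousOn; fun_prop
  have hhat : (xh, xh, xh, th, sh) ∈ K := by rw [hmem]; simp [hr.le]
  obtain ⟨⟨x, z, y, t, s⟩, hwK, hw⟩ := hK.exists_isMaxOn ⟨_, hhat⟩ hΦ
  obtain ⟨k1, k2, k3, k4, k5⟩ := (hmem _ _ _ _ _).1 hwK
  have h1 : Φ (xh, xh, xh, th, sh) ≤ Φ (x, z, y, t, s) := hw hhat
  have h2 := hmax y t s k3 k4 k5
  have ht0 : 0 < t := (hpos _ hwK).1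
  have h3 := (abs_le.1 (hl1 t ht0.le x y)).2
  have h4 := (abs_le.1 (hl2 z y)).2
  have h1' : f1 xh th + f2 xh - f3 xh sh ≤ f1 x t + f2 z - f3 y s - (inner ℝ q (y - xh) + a * (t - th)
        + b * (s - sh) + 1/2 * inner ℝ (S (y - xh)) (y - xh) + κ * ((t - th)^2 + (s - sh)^2))
        - n/2 * (‖x - y‖^2 + ‖z - y‖^2) := by
    refine le_trans (le_of_eq ?_) h1
    simp [Φ]
  clear h1
  have h1 := h1'
  clear h1'
  obtain ⟨d1, hd1⟩ : ∃ d1, d1 = ‖x - y‖ := ⟨_, rfl⟩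
  obtain ⟨d2, hd2⟩ : ∃ d2, d2 = ‖z - y‖ := ⟨_, rfl⟩
  have hd1n : 0 ≤ d1 := by rw [hd1]; positivity
  have hd2n : 0 ≤ d2 := by rw [hd2]; positivity
  rw [← hd1, ← hd2] at h1
  rw [← hd1] at h3
  rw [← hd2] at h4
  have h5 : ι * (‖y - xh‖^2 + (t - th)^2 + (s - sh)^2) + n/2 * (d1^2 + d2^2) ≤ L * (d1 + d2) := by
    clear hw hmax hΦ hK hmem hpos
    clear_value Φ K
    linarith
  obtain ⟨m1, m2, m3, m4, m5, m6, m7⟩ := doubling_num ι n ε L η d1 d2 _ _ _ hι hη hL hε hn0 hnε hd1n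
    hd2n (norm_nonneg _) hε1 hε2 hε3 h5
  refine ⟨n, x, z, y, t, s, hn0, ?_, ?_, by linarith, m4, m5, by rw [← hd1]; exact m6, by rw [← hd2]; exact m7, ?_⟩
  · have := norm_add_le (x - y) (y - xh)
    rw [sub_add_sub_cancel, ← hd1] at this; linarith
  · have := norm_add_le (z - y) (y - xh)
    rw [sub_add_sub_cancel, ← hd2] at this; linarith
  · intro x' z' y' t' s' g1 g2 g3 g4 g5
    exact hw ((hmem _ _ _ _ _).2 ⟨g1, g2, g3, g4, g5⟩)

end Doubl

section GLs

variable {X : Type*} [NormedAddCommGroup X] [InnerProductSpace ℝ X] [FiniteDimensional ℝ X]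

theorem st_fst_le {X : Type*} [NormedAddCommGroup X] [InnerProductSpace ℝ X] (z : ST X) :
    ‖z.fst‖ ≤ ‖z‖ := WithLp.norm_fst_le _ _

theorem st_snd_le {X : Type*} [NormedAddCommGroup X] [InnerProductSpace ℝ X] (z : ST X) :
    ‖z.snd‖ ≤ ‖z‖ := WithLp.norm_snd_le _ _

theorem key_num (n τ η Cs d D : ℝ) (hn : 0 < n) (hτ1 : τ ≤ 1) (hτ : 0 < τ) (hη : 0 < η)
    (hτn : n * τ ≤ η) (h2 : n * d^2 ≤ η) (hD : 0 ≤ D) (h4 : D ≤ Cs * (d + 2 * τ)) :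
    n * D^2 ≤ 10 * Cs^2 * η := by
  have h5 : D^2 ≤ (Cs * (d + 2 * τ))^2 := by gcongr
  have h6 : (Cs * (d + 2 * τ))^2 ≤ Cs^2 * (2 * d^2 + 8 * τ^2) := by
    rw [mul_pow]; gcongr; nlinarith [sq_nonneg (d - 2 * τ)]
  calc n * D^2 ≤ n * (Cs^2 * (2 * d^2 + 8 * τ^2)) := by gcongr; linarith
    _ = Cs^2 * (2 * (n * d^2) + 8 * ((n * τ) * τ)) := by ring
    _ ≤ Cs^2 * (2 * η + 8 * (η * 1)) := by gcongr
    _ = _ := by ring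

theorem st_inner {X : Type*} [NormedAddCommGroup X] [InnerProductSpace ℝ X] (a b : ST X) :
    inner ℝ a b = inner ℝ a.fst b.fst + a.snd * b.snd := by
  rw [WithLp.prod_inner_apply, RCLike.inner_apply, conj_trivial, mul_comm]; rfl

theorem quad_pert (S : X →L[ℝ] X) (a b : X) (Cs d : ℝ) (hCs : 0 ≤ Cs) (ha : ‖a‖ ≤ Cs) (hb : ‖b‖ ≤ Cs)
    (hab : ‖a - b‖ ≤ Cs * d) (hd : 0 ≤ d) :
    inner ℝ (S a) a ≤ inner ℝ (S b) b + 2 * ‖S‖ * Cs^2 * d := by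
  have e : inner ℝ (S a) a = inner ℝ (S b) b + inner ℝ (S (a - b)) a + inner ℝ (S b) (a - b) := by
    simp only [map_sub, inner_sub_left, inner_sub_right]; ring
  have h1 : inner ℝ (S (a - b)) a ≤ ‖S‖ * (Cs * d) * Cs := by
    calc inner ℝ (S (a - b)) a ≤ ‖S (a - b)‖ * ‖a‖ := real_inner_le_norm _ _
      _ ≤ (‖S‖ * ‖a - b‖) * ‖a‖ := by gcongr; exact S.le_opNorm _
      _ ≤ _ := by gcongr
  have h2 : inner ℝ (S b) (a - b) ≤ ‖S‖ * Cs * (Cs * d) := by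
    calc inner ℝ (S b) (a - b) ≤ ‖S b‖ * ‖a - b‖ := real_inner_le_norm _ _
      _ ≤ (‖S‖ * ‖b‖) * ‖a - b‖ := by gcongr; exact S.le_opNorm _
      _ ≤ _ := by gcongr
  rw [e]; nlinarith

theorem gl1 (f1 f3 : X → ℝ → ℝ) (f2 : X → ℝ) (xh : X) (th sh r : ℝ) (hr : 0 < r)
    (hrt : r < th) (hrs : r < sh)
    (hc1 : ContinuousOn (fun z : X × ℝ => f1 z.1 z.2) {z | 0 < z.2})
    (hc3 : ContinuousOn (fun z : X × ℝ => f3 z.1 z.2) {z | 0 < z.2})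
    (L : ℝ) (hL : 0 ≤ L)
    (hl1 : ∀ t, 0 ≤ t → ∀ x y, |f1 x t - f1 y t| ≤ L * ‖x - y‖)
    (hl2 : ∀ x y, |f2 x - f2 y| ≤ L * ‖x - y‖)
    (q : X) (a b κ ι : ℝ) (S : X →L[ℝ] X) (hι : 0 < ι) (hS : ∀ a b, inner ℝ (S a) b = inner ℝ a (S b))
    (hmax : ∀ x t s, ‖x - xh‖ ≤ r → |t - th| ≤ r → |s - sh| ≤ r →
      f1 x t + f2 x - f3 x s ≤ f1 xh th + f2 xh - f3 xh sh + inner ℝ q (x - xh) + a * (t - th)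
        + b * (s - sh) + 1/2 * inner ℝ (S (x - xh)) (x - xh) + κ * ((t - th)^2 + (s - sh)^2)
        - ι * (‖x - xh‖^2 + (t - th)^2 + (s - sh)^2))
    (η : ℝ) (hη : 0 < η) (hη1 : η ≤ 1) (hηr : η ≤ r/4) :
    ∃ (z1 z2 z3 p1 p2 p3 : ST X) (X1 X2 X3 : ST X →L[ℝ] ST X),
      ‖z1.fst - xh‖ ≤ 2 * η ∧ ‖z2.fst - xh‖ ≤ 2 * η ∧ ‖z3.fst - xh‖ ≤ 2 * η ∧
      0 < z1.snd ∧ 0 < z2.snd ∧ 0 < z3.snd ∧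
      SupJet (fun z => f1 z.fst z.snd) z1 p1 X1 ∧ SupJet (fun z => f2 z.fst) z2 p2 X2 ∧
      SupJet (fun z => - f3 z.fst z.snd) z3 p3 X3 ∧
      a - (2 * |κ| + 1) * η ≤ p1.snd ∧ - η ≤ p2.snd ∧ b - (2 * |κ| + 1) * η ≤ p3.snd ∧
      ‖p1.fst + p2.fst + p3.fst - q‖ ≤ (‖S‖ + 3) * η ∧
      ∀ (g : X → X) (Cs : ℝ), 0 ≤ Cs → (∀ x, ‖g x‖ ≤ Cs) → (∀ x y, ‖g x - g y‖ ≤ Cs * ‖x - y‖) →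
        inner ℝ (X1 (stp (g z1.fst) 0)) (stp (g z1.fst) 0)
        + inner ℝ (X2 (stp (g z2.fst) 0)) (stp (g z2.fst) 0)
        + inner ℝ (X3 (stp (g z3.fst) 0)) (stp (g z3.fst) 0) ≤
        inner ℝ (S (g xh)) (g xh) + (23 + 4 * ‖S‖) * Cs^2 * η := by
  obtain ⟨n, x, z, y, t, s, hn, hx, hz, hy, ht, hs, hnx, hnz, hM⟩ := doubling f1 f3 f2 xh th sh r hr hrt hrs
    hc1 hc3 L hL hl1 hl2 q a b κ ι S hι hmax η hη
  obtain ⟨τ, hτ, hτη, hτn⟩ : ∃ τ : ℝ, 0 < τ ∧ τ ≤ η ∧ n * τ ≤ η := by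
    refine ⟨min η (η/n), by positivity, min_le_left _ _, ?_⟩
    calc n * min η (η/n) ≤ n * (η/n) := by gcongr; exact min_le_right _ _
      _ = η := by field_simp
  have hcomp : ∀ (f : X → ℝ → ℝ) (w : X) (t' t0 : ℝ), ContinuousOn (fun z : X × ℝ => f z.1 z.2) {z | 0 < z.2} →
      |t' - t0| ≤ η → r < t0 →
      ContinuousOn (fun z : ST X => f z.fst z.snd) (Metric.closedBall (stp w t') (r/2)) := by
    intro f w t' t0 hf ht' hrt
    refine hf.comp (f := fun z : ST X => (z.fst, z.snd)) ?_ ?_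
    · exact (WithLp.prod_continuous_ofLp 2 X ℝ).continuousOn
    · intro z hz
      rw [Metric.mem_closedBall, dist_eq_norm] at hz
      have h1 := (st_snd_le (z - stp w t')).trans hz
      simp only [WithLp.sub_snd, WithLp.toLp_snd, Real.norm_eq_abs] at h1
      have h2 := abs_le.1 h1
      have h3 := abs_le.1 ht'
      show 0 < z.snd
      linarith
  have hf2c : Continuous f2 := by
    have : LipschitzWith L.toNNReal f2 := by
      apply LipschitzWith.of_dist_le_mul
      intro x y
      rw [Real.coe_toNNReal _ hL, Real.dist_eq, dist_eq_norm]; exact hl2 x y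
    exact this.continuous
  obtain ⟨z1, z2, z3, p1, p2, p3, X1, X2, X3, hz1, hz2, hz3, hp1, hp2, hp3, hj1, hj2, hj3, hX⟩ :=
    ts3 (fun z => f1 z.fst z.snd) (fun z => f2 z.fst) (fun z => - f3 z.fst z.snd)
    (stp x t) (stp z 1) (stp y s) (stp (n • (x - y)) (a + 2 * κ * (t - th))) (stp (n • (z - y)) 0)
    (stp (q + S (y - xh) - n • (x - y) - n • (z - y)) (b + 2 * κ * (s - sh))) (r/2) (by linarith)
    (hcomp f1 x t th hc1 ht hrt) 
    (by
      apply Continuous.continuousOn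
      exact hf2c.comp (continuous_fst.comp (WithLp.prod_continuous_ofLp 2 X ℝ)))
    (hcomp f3 y s sh hc3 hs hrs).neg n κ S hS
    (by
      intro h1 h2 h3 k1 k2 k3
      have e1 := (st_fst_le h1).trans k1
      have e2 := (st_fst_le h2).trans k2
      have e3 := (st_fst_le h3).trans k3
      have e4 := (st_snd_le h1).trans k1
      have e5 := (st_snd_le h3).trans k3
      rw [Real.norm_eq_abs] at e4 e5
      have hM' := hM (x + h1.fst) (z + h2.fst) (y + h3.fst) (t + h1.snd) (s + h3.snd)
        (by have := norm_add_le (x - xh) h1.fst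
            rw [show x + h1.fst - xh = x - xh + h1.fst by abel]; linarith)
        (by have := norm_add_le (z - xh) h2.fst
            rw [show z + h2.fst - xh = z - xh + h2.fst by abel]; linarith)
        (by have := norm_add_le (y - xh) h3.fst
            rw [show y + h3.fst - xh = y - xh + h3.fst by abel]; linarith)
        (by have := abs_add_le (t - th) h1.snd
            rw [show t + h1.snd - th = t - th + h1.snd by ring]; linarith)
        (by have := abs_add_le (s - sh) h3.snd
            rw [show s + h3.snd - sh = s - sh + h3.snd by ring]; linarith)
      clear hM hmax hcomp
      have g1 : ‖x + h1.fst - (y + h3.fst)‖^2 = ‖x - y‖^2 + 2 * (inner ℝ (x - y) h1.fst - inner ℝ (x - y) h3.fst)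
          + ‖h1.fst - h3.fst‖^2 := by
        rw [show x + h1.fst - (y + h3.fst) = (x - y) + (h1.fst - h3.fst) by abel,
          norm_add_sq_real, inner_sub_right]
      have g2 : ‖z + h2.fst - (y + h3.fst)‖^2 = ‖z - y‖^2 + 2 * (inner ℝ (z - y) h2.fst - inner ℝ (z - y) h3.fst)
          + ‖h2.fst - h3.fst‖^2 := by
        rw [show z + h2.fst - (y + h3.fst) = (z - y) + (h2.fst - h3.fst) by abel,
          norm_add_sq_real, inner_sub_right]
      have g3 : inner ℝ (S (y + h3.fst - xh)) (y + h3.fst - xh) = inner ℝ (S (y - xh)) (y - xh)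
          + 2 * inner ℝ (S (y - xh)) h3.fst + inner ℝ (S h3.fst) h3.fst := by
        rw [show y + h3.fst - xh = (y - xh) + h3.fst by abel, map_add, inner_add_left, inner_add_right,
          inner_add_right, hS h3.fst, real_inner_comm (S (y - xh)) h3.fst]
        ring
      have g4 : inner ℝ q (y + h3.fst - xh) = inner ℝ q (y - xh) + inner ℝ q h3.fst := by
        rw [← inner_add_right]; congr 1; abel
      rw [g1, g2, g3, g4] at hM'
      simp only [st_inner, WithLp.add_fst, WithLp.add_snd, WithLp.toLp_fst, WithLp.toLp_snd,
        inner_add_left, inner_sub_left, inner_smul_left, conj_trivial] at hM' ⊢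
      clear g1 g2 g3 g4
      linarith)
    τ hτ
  have q1 := (st_fst_le (z1 - stp x t)).trans hz1.le
  have q2 := (st_fst_le (z2 - stp z 1)).trans hz2.le
  have q3 := (st_fst_le (z3 - stp y s)).trans hz3.le
  have q4 := (st_snd_le (z1 - stp x t)).trans hz1.le
  have q5 := (st_snd_le (z2 - stp z 1)).trans hz2.le
  have q6 := (st_snd_le (z3 - stp y s)).trans hz3.le
  have r1 := (st_fst_le (p1 - _)).trans hp1.le
  have r2 := (st_fst_le (p2 - _)).trans hp2.le
  have r3 := (st_fst_le (p3 - _)).trans hp3.le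
  have r4 := (st_snd_le (p1 - _)).trans hp1.le
  have r5 := (st_snd_le (p2 - _)).trans hp2.le
  have r6 := (st_snd_le (p3 - _)).trans hp3.le
  simp only [WithLp.sub_fst, WithLp.toLp_fst, WithLp.sub_snd, WithLp.toLp_snd, Real.norm_eq_abs]
    at q1 q2 q3 q4 q5 q6 r1 r2 r3 r4 r5 r6
  have hη0 := abs_le.1 q4
  have hη2 := abs_le.1 q6
  have hη3 := abs_le.1 q5
  have htt := abs_le.1 ht
  have hss := abs_le.1 hs
  have hr4 := abs_le.1 r4
  have hr5 := abs_le.1 r5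
  have hr6 := abs_le.1 r6
  have hk1 : -(|κ| * η) ≤ κ * (t - th) := by
    have := neg_abs_le (κ * (t - th)); rw [abs_mul] at this
    have : |κ| * |t - th| ≤ |κ| * η := by gcongr
    linarith
  have hk2 : -(|κ| * η) ≤ κ * (s - sh) := by
    have := neg_abs_le (κ * (s - sh)); rw [abs_mul] at this
    have : |κ| * |s - sh| ≤ |κ| * η := by gcongr
    linarith
  have hd3 : ‖z3.fst - xh‖ ≤ 2 * η := by
    have := norm_add_le (z3.fst - y) (y - xh); rw [sub_add_sub_cancel] at this; linarith
  refine ⟨z1, z2, z3, p1, p2, p3, X1, X2, X3, ?_, ?_, hd3, by linarith, ?_, by linarith, hj1, hj2, hj3,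
    by linarith, by linarith, by linarith, ?_, ?_⟩
  · have := norm_add_le (z1.fst - x) (x - xh); rw [sub_add_sub_cancel] at this; linarith
  · have := norm_add_le (z2.fst - z) (z - xh); rw [sub_add_sub_cancel] at this; linarith
  · by_contra hneg
    have hz2s : τ < 1 ∨ 1 ≤ τ := lt_or_ge _ _
    rcases hz2s with h | h
    · linarith
    · have q5' := (st_snd_le (z2 - stp z 1)).trans_lt hz2
      simp only [WithLp.sub_snd, WithLp.toLp_snd, Real.norm_eq_abs] at q5'
      have := (abs_lt.1 q5').1
      linarith
  · have e : p1.fst + p2.fst + p3.fst - q = (p1.fst - n • (x - y)) + (p2.fst - n • (z - y))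
       + (p3.fst - (q + S (y - xh) - n • (x - y) - n • (z - y))) + S (y - xh) := by abel
    rw [e]
    have s1 : ‖S (y - xh)‖ ≤ ‖S‖ * η := (S.le_opNorm _).trans (by gcongr)
    refine (norm_add_le _ _).trans ?_
    have s2 := norm_add₃_le (a := p1.fst - n • (x - y)) (b := p2.fst - n • (z - y)) (c :=
       p3.fst - (q + S (y - xh) - n • (x - y) - n • (z - y)))
    linarith
  · intro g Cs hCs hgb hgl
    refine (hX (g z1.fst) (g z2.fst) (g z3.fst)).trans ?_
    have s1 := quad_pert S (g z3.fst) (g xh) Cs (2 * η) hCs (hgb _) (hgb _)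
      ((hgl _ _).trans (by gcongr)) (by positivity)
    have key : ∀ (w w1 : X), ‖w1 - w‖ ≤ τ → n * ‖w - y‖^2 ≤ η →
        n * ‖g w1 - g z3.fst‖^2 ≤ 10 * Cs^2 * η := by
      intro w w1 h1 h2
      have h3 : ‖w1 - z3.fst‖ ≤ ‖w - y‖ + 2 * τ := by
        rw [show w1 - z3.fst = (w1 - w) + (w - y) - (z3.fst - y) by abel]
        have := norm_sub_le ((w1 - w) + (w - y)) (z3.fst - y)
        have := norm_add_le (w1 - w) (w - y)
        linarith
      have h4 : ‖g w1 - g z3.fst‖ ≤ Cs * (‖w - y‖ + 2 * τ) := (hgl _ _).trans (by gcongr)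
      exact key_num n τ η Cs _ _ hn (hτη.trans hη1) hτ hη hτn h2 (norm_nonneg _) h4
    have s2 := key x z1.fst q1 hnx
    have s3 := key z z2.fst q2 hnz
    have s4 : τ * (‖g z1.fst‖^2 + ‖g z2.fst‖^2 + ‖g z3.fst‖^2) ≤ η * (Cs^2 + Cs^2 + Cs^2) := by
      gcongr <;> apply hgb
    linarith

end GLs

section GLm

variable {X : Type*} [NormedAddCommGroup X] [InnerProductSpace ℝ X] [FiniteDimensional ℝ X]
variable {Θ J : Type*} [Fintype J]

/-- jet subsolutions of the parabolic problem -/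
def JSub (sg : Θ → X → J → X) (H : Θ → X → X → ℝ) (f : X → ℝ → ℝ) : Prop :=
  ∀ (z p : ST X) (Y : ST X →L[ℝ] ST X), 0 < z.snd → SupJet (fun z : ST X => f z.fst z.snd) z p Y →
    ∀ θ, p.snd - ∑ c, inner ℝ (Y (stp (sg θ z.fst c) 0)) (stp (sg θ z.fst c) 0) + H θ z.fst p.fst ≤ 0

/-- jet supersolutions of the parabolic problem -/
def JSup (sg : Θ → X → J → X) (H : Θ → X → X → ℝ) (f : X → ℝ → ℝ) : Prop :=
  ∀ (z p : ST X) (Y : ST X →L[ℝ] ST X), 0 < z.snd → SupJet (fun z : ST X => - f z.fst z.snd) z p Y →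
    ∀ ε > 0, ∃ θ, -ε ≤ -p.snd + ∑ c, inner ℝ (Y (stp (sg θ z.fst c) 0)) (stp (sg θ z.fst c) 0)
      + H θ z.fst (-p.fst)

theorem gl (sg : Θ → X → J → X) (Cs : ℝ) (hCs : 0 ≤ Cs) (hsb : ∀ θ x c, ‖sg θ x c‖ ≤ Cs)
    (hsl : ∀ θ x y c, ‖sg θ x c - sg θ y c‖ ≤ Cs * ‖x - y‖)
    (H G : Θ → X → X → ℝ) (CR : ℝ) (hCR : 0 ≤ CR) (L L2 : ℝ) (hL2 : 0 ≤ L2) (hL2L : L2 ≤ L)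
    (hH : ∀ θ x y p, ‖p‖ ≤ L → |H θ x p - H θ y p| ≤ CR * ‖x - y‖)
    (hG : ∀ θ x y p, ‖p‖ ≤ L → |G θ x p - G θ y p| ≤ CR * ‖x - y‖)
    (f1 f3 : X → ℝ → ℝ) (f2 : X → ℝ) (hj1 : JSub sg H f1) (hj2 : JSub sg G (fun x _ => f2 x))
    (hj3 : JSup sg H f3)
    (hc1 : ContinuousOn (fun z : X × ℝ => f1 z.1 z.2) {z | 0 < z.2})
    (hc3 : ContinuousOn (fun z : X × ℝ => f3 z.1 z.2) {z | 0 < z.2})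
    (hl1 : ∀ t, 0 ≤ t → ∀ x y, |f1 x t - f1 y t| ≤ L * ‖x - y‖)
    (hl3 : ∀ t, 0 ≤ t → ∀ x y, |f3 x t - f3 y t| ≤ L * ‖x - y‖)
    (hl2 : ∀ x y, |f2 x - f2 y| ≤ L2 * ‖x - y‖)
    (w1 w2 w3 : ℝ) (hw1 : 0 < w1) (hw2 : 0 < w2) (hw3 : 0 < w3)
    (xh : X) (th sh r : ℝ) (hr : 0 < r) (hrt : r < th) (hrs : r < sh)
    (q : X) (a b κ ι : ℝ) (S : X →L[ℝ] X) (hι : 0 < ι) (hS : ∀ a b, inner ℝ (S a) b = inner ℝ a (S b))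
    (hmax : ∀ x t s, ‖x - xh‖ ≤ r → |t - th| ≤ r → |s - sh| ≤ r →
      w1 * f1 x t + w2 * f2 x - w3 * f3 x s ≤ w1 * f1 xh th + w2 * f2 xh - w3 * f3 xh sh
        + inner ℝ q (x - xh) + a * (t - th)
        + b * (s - sh) + 1/2 * inner ℝ (S (x - xh)) (x - xh) + κ * ((t - th)^2 + (s - sh)^2)
        - ι * (‖x - xh‖^2 + (t - th)^2 + (s - sh)^2))
    (τ : ℝ) (hτ : 0 < τ) :
    ∃ (θ : Θ) (p1 p2 p3 : X), ‖p1‖ ≤ L ∧ ‖p2‖ ≤ L2 ∧ ‖p3‖ ≤ L ∧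
      ‖w1 • p1 + w2 • p2 - w3 • p3 - q‖ ≤ τ ∧
      a + b - ∑ c, inner ℝ (S (sg θ xh c)) (sg θ xh c) + w1 * H θ xh p1 + w2 * G θ xh p2
        - w3 * H θ xh p3 ≤ τ := by
  have hL : 0 ≤ L := hL2.trans hL2L
  obtain ⟨K1, hK1⟩ : ∃ K1, K1 = (2 * |κ| + 1) + (2 * |κ| + 1) + 1 + w3
    + Fintype.card J * ((23 + 4 * ‖S‖) * Cs^2) + 2 * (w1 + w2 + w3) * CR := ⟨_, rfl⟩
  obtain ⟨η, ⟨⟨⟨g1, g2⟩, g3⟩, g4⟩, hη⟩ := ((((ev_small 1 1 one_pos).and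
    (ev_small 1 (r/4) (by positivity))).and (ev_small K1 τ hτ)).and (ev_small (‖S‖ + 3) τ hτ)
    |>.and self_mem_nhdsWithin).exists
  have hη : 0 < η := hη
  rw [one_mul] at g1 g2
  obtain ⟨z1, z2, z3, p1, p2, p3, X1, X2, X3, d1, d2, d3, s1, s2, s3, j1, j2, j3, t1, t2, t3, hp, hq⟩ :=
    gl1 (fun x t => w1 * f1 x t) (fun x t => w3 * f3 x t) (fun x => w2 * f2 x) xh th sh r hr hrt hrs
    (hc1.const_mul _) (hc3.const_mul _) ((w1 + w2) * L) (by positivity)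
    (by
      intro t ht x y
      rw [← mul_sub, abs_mul, abs_of_pos hw1]
      calc w1 * |f1 x t - f1 y t| ≤ w1 * (L * ‖x - y‖) := by gcongr; exact hl1 t ht x y
        _ ≤ (w1 + w2) * (L * ‖x - y‖) := by gcongr; linarith
        _ = _ := by ring)
    (by
      intro x y
      rw [← mul_sub, abs_mul, abs_of_pos hw2]
      calc w2 * |f2 x - f2 y| ≤ w2 * (L2 * ‖x - y‖) := by gcongr; exact hl2 x y
        _ ≤ (w1 + w2) * (L * ‖x - y‖) := by gcongr; linarith
        _ = _ := by ring)
    q a b κ ι S hι hS hmax η hη g1 g2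
  have j1' := SupJet.of_smul hw1 j1
  have j2' := SupJet.of_smul hw2 j2
  have j3' : SupJet (fun z : ST X => - f3 z.fst z.snd) z3 (w3⁻¹ • p3) (w3⁻¹ • X3) := by
    apply SupJet.of_smul hw3
    simpa only [mul_neg] using j3
  have n1 := supjet_lip j1' L (Eventually.of_forall (by
    intro h
    have := abs_le.1 (hl1 z1.snd s1.le (z1.fst + h) z1.fst)
    simp only [WithLp.add_fst, WithLp.add_snd, WithLp.toLp_fst, WithLp.toLp_snd, add_zero]
    rw [add_sub_cancel_left] at this; linarith)) hL
  have n2 := supjet_lip j2' L2 (Eventually.of_forall (by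
    intro h
    have := abs_le.1 (hl2 (z2.fst + h) z2.fst)
    simp only [WithLp.add_fst, WithLp.toLp_fst]
    rw [add_sub_cancel_left] at this; linarith)) hL2
  have n3 := supjet_lip j3' L (Eventually.of_forall (by
    intro h
    have := abs_le.1 (hl3 z3.snd s3.le (z3.fst + h) z3.fst)
    simp only [WithLp.add_fst, WithLp.add_snd, WithLp.toLp_fst, WithLp.toLp_snd, add_zero]
    rw [add_sub_cancel_left] at this; linarith)) hL
  obtain ⟨θ, hθ⟩ := hj3 _ _ _ s3 j3' η hη
  have e1 := hj1 _ _ _ s1 j1' θ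
  have e2 := hj2 _ _ _ s2 j2' θ
  simp only [smul_apply, inner_smul_left, conj_trivial, ← Finset.mul_sum, WithLp.smul_fst,
    WithLp.smul_snd, smul_eq_mul] at hθ e1 e2 n1 n2 n3
  have E1 : p1.snd - ∑ c, inner ℝ (X1 (stp (sg θ z1.fst c) 0)) (stp (sg θ z1.fst c) 0)
      + w1 * H θ z1.fst (w1⁻¹ • p1.fst) ≤ 0 := by
    have := mul_le_mul_of_nonneg_left e1 hw1.le
    have e : w1 * w1⁻¹ = 1 := mul_inv_cancel₀ hw1.ne'
    rw [mul_add, mul_sub, ← mul_assoc, ← mul_assoc, e] at this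
    linarith
  have E2 : p2.snd - ∑ c, inner ℝ (X2 (stp (sg θ z2.fst c) 0)) (stp (sg θ z2.fst c) 0)
      + w2 * G θ z2.fst (w2⁻¹ • p2.fst) ≤ 0 := by
    have := mul_le_mul_of_nonneg_left e2 hw2.le
    have e : w2 * w2⁻¹ = 1 := mul_inv_cancel₀ hw2.ne'
    rw [mul_add, mul_sub, ← mul_assoc, ← mul_assoc, e] at this
    linarith
  have E3 : -(w3 * η) ≤ - p3.snd + ∑ c, inner ℝ (X3 (stp (sg θ z3.fst c) 0)) (stp (sg θ z3.fst c) 0)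
      + w3 * H θ z3.fst (-(w3⁻¹ • p3.fst)) := by
    have := mul_le_mul_of_nonneg_left hθ hw3.le
    have e : w3 * w3⁻¹ = 1 := mul_inv_cancel₀ hw3.ne'
    rw [mul_add, mul_add, mul_neg, mul_neg, ← mul_assoc, ← mul_assoc, e] at this
    linarith
  have hsum : ∑ c, inner ℝ (X1 (stp (sg θ z1.fst c) 0)) (stp (sg θ z1.fst c) 0)
      + ∑ c, inner ℝ (X2 (stp (sg θ z2.fst c) 0)) (stp (sg θ z2.fst c) 0)
      + ∑ c, inner ℝ (X3 (stp (sg θ z3.fst c) 0)) (stp (sg θ z3.fst c) 0) ≤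
      ∑ c, inner ℝ (S (sg θ xh c)) (sg θ xh c) + Fintype.card J * ((23 + 4 * ‖S‖) * Cs^2) * η := by
    rw [← Finset.sum_add_distrib, ← Finset.sum_add_distrib]
    calc _ ≤ ∑ c, (inner ℝ (S (sg θ xh c)) (sg θ xh c) + (23 + 4 * ‖S‖) * Cs^2 * η) :=
          Finset.sum_le_sum fun c _ => hq (fun x => sg θ x c) Cs hCs (fun x => hsb θ x c)
            (fun x y => hsl θ x y c)
      _ = _ := by
        rw [Finset.sum_add_distrib, Finset.sum_const, Finset.card_univ, nsmul_eq_mul]; ring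
  have n3' : ‖-(w3⁻¹ • p3.fst)‖ ≤ L := by rw [norm_neg]; exact n3
  refine ⟨θ, w1⁻¹ • p1.fst, w2⁻¹ • p2.fst, -(w3⁻¹ • p3.fst), n1, n2, n3', ?_, ?_⟩
  · rw [smul_neg, smul_smul, smul_smul, smul_smul, mul_inv_cancel₀ hw1.ne', mul_inv_cancel₀ hw2.ne',
      mul_inv_cancel₀ hw3.ne', one_smul, one_smul, one_smul, sub_neg_eq_add]
    exact hp.trans g4
  · have h1 : w1 * H θ xh (w1⁻¹ • p1.fst) ≤ w1 * (H θ z1.fst (w1⁻¹ • p1.fst) + CR * (2 * η)) := by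
      gcongr
      have := (abs_le.1 (hH θ z1.fst xh _ n1)).1
      have : CR * ‖z1.fst - xh‖ ≤ CR * (2 * η) := by gcongr
      linarith
    have h2 : w2 * G θ xh (w2⁻¹ • p2.fst) ≤ w2 * (G θ z2.fst (w2⁻¹ • p2.fst) + CR * (2 * η)) := by
      gcongr
      have := (abs_le.1 (hG θ z2.fst xh _ (n2.trans hL2L))).1
      have : CR * ‖z2.fst - xh‖ ≤ CR * (2 * η) := by gcongr
      linarith
    have h3 : w3 * (H θ z3.fst (-(w3⁻¹ • p3.fst)) - CR * (2 * η)) ≤ w3 * H θ xh (-(w3⁻¹ • p3.fst)) := by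
      gcongr
      have := (abs_le.1 (hH θ z3.fst xh _ n3')).2
      have : CR * ‖z3.fst - xh‖ ≤ CR * (2 * η) := by gcongr
      linarith
    rw [hK1] at g3
    linarith

end GLm

section Jets

/-- columns of the diffusion matrix -/
def cols {N : ℕ} {Θ : Type*} (σm : Θ → E N → Matrix (Fin N) (Fin N) ℝ) (θ : Θ) (x : E N) (c : Fin N) : E N :=
  WithLp.toLp 2 (fun i => σm θ x i c)

theorem trace_cols {N : ℕ} (M : Matrix (Fin N) (Fin N) ℝ) (φ : E N → ℝ) (x : E N)
    (hd : DifferentiableAt ℝ (fderiv ℝ φ) x) :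
    Matrix.trace (M * Mᵀ * hessMatrix φ x) =
      ∑ c, fderiv ℝ (fderiv ℝ φ) x (WithLp.toLp 2 (fun i => M i c)) (WithLp.toLp 2 (fun i => M i c)) := by
  have h1 : ∀ i j, hessMatrix φ x i j = fderiv ℝ (fderiv ℝ φ) x (EuclideanSpace.single i 1)
      (EuclideanSpace.single j 1) := by
    intro i j
    simp only [hessMatrix, Matrix.of_apply]
    have := (hd.hasFDerivAt.clm_apply (hasFDerivAt_const (EuclideanSpace.single j (1:ℝ)) x)).fderiv
    rw [this]; simp
  have h2 : ∀ c, (WithLp.toLp 2 (fun i => M i c) : E N) = ∑ i, M i c • EuclideanSpace.single i (1:ℝ) := by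
    intro c
    ext k
    simp [Finset.sum_apply, Pi.single_apply]
  have h3 : ∀ c, fderiv ℝ (fderiv ℝ φ) x (WithLp.toLp 2 (fun i => M i c)) (WithLp.toLp 2 (fun i => M i c))
     = ∑ i, ∑ j, M i c * M j c * hessMatrix φ x i j := by
    intro c
    rw [h2 c]
    simp only [map_sum, map_smul, sum_apply, smul_apply, smul_eq_mul, h1]
    rw [Finset.sum_comm]
    refine Finset.sum_congr rfl fun i _ => ?_
    rw [Finset.mul_sum]
    refine Finset.sum_congr rfl fun j _ => ?_
    ring
  simp only [h3]
  simp only [Matrix.trace, Matrix.diag, Matrix.mul_apply, Matrix.transpose_apply, Finset.sum_mul]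
  rw [Finset.sum_comm]
  calc _ = ∑ j, ∑ c, ∑ i, M i c * M j c * hessMatrix φ x j i := by
        refine Finset.sum_congr rfl fun j _ => ?_
        rw [Finset.sum_comm]
    _ = ∑ c, ∑ j, ∑ i, M i c * M j c * hessMatrix φ x j i := Finset.sum_comm
    _ = _ := by
        refine Finset.sum_congr rfl fun c _ => Finset.sum_congr rfl fun i _ =>
          Finset.sum_congr rfl fun j _ => by ring

theorem quad_contDiff {X : Type*} [NormedAddCommGroup X] [InnerProductSpace ℝ X] (k : ℝ) (q x0 : X)
    (T : X →L[ℝ] X) : ContDiff ℝ 2 (fun y : X => k + inner ℝ q (y - x0) + 1/2 * inner ℝ (T (y - x0)) (y - x0)) := by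
  have h1 : ContDiff ℝ 2 (fun y : X => y - x0) := contDiff_id.sub contDiff_const
  have h2 : ContDiff ℝ 2 (fun y : X => T (y - x0)) := T.contDiff.comp h1
  exact (contDiff_const.add (contDiff_const.inner ℝ h1)).add (contDiff_const.mul (h2.inner ℝ h1))

theorem quad_deriv {X : Type*} [NormedAddCommGroup X] [InnerProductSpace ℝ X] (k : ℝ) (q x0 y : X)
    (T : X →L[ℝ] X) (hT : ∀ a b, inner ℝ (T a) b = inner ℝ a (T b)) :
    HasFDerivAt (fun y : X => k + inner ℝ q (y - x0) + 1/2 * inner ℝ (T (y - x0)) (y - x0))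
      (innerSL ℝ (q + T (y - x0))) y := by
  have h1 : HasFDerivAt (fun y : X => y - x0) (ContinuousLinearMap.id ℝ X) y := (hasFDerivAt_id y).sub_const x0
  have h2 : HasFDerivAt (fun y : X => T (y - x0)) (T.comp (ContinuousLinearMap.id ℝ X)) y :=
    T.hasFDerivAt.comp y h1
  have h3 := (((hasFDerivAt_const q y).inner ℝ h1).const_add k).add ((h2.inner ℝ h1).const_mul (1/2))
  refine h3.congr_fderiv ?_
  ext h
  simp [fderivInnerCLM_apply, inner_add_left]
  rw [hT h (y - x0), real_inner_comm (T (y - x0)) h]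
  simp only [map_sub, inner_sub_left]
  ring

theorem quad_grad {N : ℕ} (k : ℝ) (q x0 : E N)
    (T : E N →L[ℝ] E N) (hT : ∀ a b, inner ℝ (T a) b = inner ℝ a (T b)) :
    gradient (fun y : E N => k + inner ℝ q (y - x0) + 1/2 * inner ℝ (T (y - x0)) (y - x0)) x0 = q := by
  apply HasGradientAt.gradient
  rw [hasGradientAt_iff_hasFDerivAt]
  refine (quad_deriv k q x0 x0 T hT).congr_fderiv ?_
  ext h
  simp

theorem quad_trace {N : ℕ} (M : Matrix (Fin N) (Fin N) ℝ) (k : ℝ) (q x0 : E N)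
    (T : E N →L[ℝ] E N) (hT : ∀ a b, inner ℝ (T a) b = inner ℝ a (T b)) :
    Matrix.trace (M * Mᵀ * hessMatrix (fun y : E N => k + inner ℝ q (y - x0)
      + 1/2 * inner ℝ (T (y - x0)) (y - x0)) x0) =
      ∑ c, inner ℝ (T (WithLp.toLp 2 (fun i => M i c))) (WithLp.toLp 2 (fun i => M i c)) := by
  have h1 : fderiv ℝ (fun y : E N => k + inner ℝ q (y - x0)
      + 1/2 * inner ℝ (T (y - x0)) (y - x0)) = fun y => innerSL ℝ (q + T (y - x0)) := by
    ext1 y; exact (quad_deriv k q x0 y T hT).fderiv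
  have h2 : HasFDerivAt (fun y : E N => innerSL ℝ (q + T (y - x0))) ((innerSL ℝ).comp T) x0 := by
    have e1 : HasFDerivAt (fun y : E N => y - x0) (ContinuousLinearMap.id ℝ _) x0 := (hasFDerivAt_id x0).sub_const x0
    have e2 : HasFDerivAt (fun y : E N => T (y - x0)) (T.comp (ContinuousLinearMap.id ℝ _)) x0 :=
      T.hasFDerivAt.comp x0 e1
    exact (innerSL ℝ (E := E N)).hasFDerivAt.comp x0 (e2.const_add q)
  rw [trace_cols _ _ _ (by rw [h1]; exact h2.differentiableAt), h1, h2.fderiv]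
  rfl

/-- test function from a jet -/
theorem jet_test {N : ℕ} (x0 : E N) (t0 k : ℝ) (p : ST (E N)) (Y : ST (E N) →L[ℝ] ST (E N))
    (hY : ∀ a b, inner ℝ (Y a) b = inner ℝ a (Y b)) (ε : ℝ) :
    ∃ φ : E N → ℝ → ℝ, ContDiff ℝ 2 (fun q : E N × ℝ => φ q.1 q.2) ∧ deriv (φ x0) t0 = p.snd ∧
      gradient (fun y => φ y t0) x0 = p.fst ∧
      (∀ M : Matrix (Fin N) (Fin N) ℝ, Matrix.trace (M * Mᵀ * hessMatrix (fun y => φ y t0) x0)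
        = ∑ c, (inner ℝ (Y (stp (WithLp.toLp 2 (fun i => M i c)) 0)) (stp (WithLp.toLp 2 (fun i => M i c)) 0)
          + 2 * ε * ‖(WithLp.toLp 2 (fun i => M i c) : E N)‖^2)) ∧
      ∀ y s, φ y s = k + inner ℝ p (stp (y - x0) (s - t0))
        + 1/2 * inner ℝ (Y (stp (y - x0) (s - t0))) (stp (y - x0) (s - t0)) 
        + ε * ‖stp (y - x0) (s - t0)‖^2 := by
  let T : ST (E N) →L[ℝ] ST (E N) := Y + (2 * ε) • ContinuousLinearMap.id ℝ _
  have hTi : ∀ a b, inner ℝ (T a) b = inner ℝ (Y a) b + 2 * ε * inner ℝ a b := by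
    intro a b; simp [T, inner_add_left, inner_smul_left]
  have hT : ∀ a b, inner ℝ (T a) b = inner ℝ a (T b) := by
    intro a b
    rw [real_inner_comm (T b) a, hTi, hTi, hY, real_inner_comm (Y b), real_inner_comm b a]
  let φ : E N → ℝ → ℝ := fun y s => k + inner ℝ p (stp y s - stp x0 t0)
    + 1/2 * inner ℝ (T (stp y s - stp x0 t0)) (stp y s - stp x0 t0)
  have hsub : ∀ y s, stp y s - stp x0 t0 = stp (y - x0) (s - t0) := fun y s => rfl
  let I : E N →L[ℝ] ST (E N) := 
    ((WithLp.prodContinuousLinearEquiv 2 ℝ (E N) ℝ).symm : (E N × ℝ) →L[ℝ] ST (E N)).comp 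
      (ContinuousLinearMap.inl ℝ (E N) ℝ)
  have hI : ∀ y, I y = stp y 0 := fun y => rfl
  let T' : E N →L[ℝ] E N := (WithLp.fstL 2 ℝ (E N) ℝ).comp (T.comp I)
  have hT'i : ∀ a b, inner ℝ (T' a) b = inner ℝ (T (stp a 0)) (stp b 0) := by
    intro a b
    rw [st_inner]; simp [T', hI]
  have hT' : ∀ a b, inner ℝ (T' a) b = inner ℝ a (T' b) := by
    intro a b
    rw [real_inner_comm (T' b) a, hT'i, hT'i, hT, real_inner_comm (T _)]
  have hφ0 : (fun y => φ y t0) = fun y => k + inner ℝ p.fst (y - x0) + 1/2 * inner ℝ (T' (y - x0)) (y - x0) := by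
    ext y
    simp only [φ, hsub, sub_self, hT'i]
    rw [st_inner p]; simp
  refine ⟨φ, ?_, ?_, ?_, ?_, ?_⟩
  · have h1 := quad_contDiff k p (stp x0 t0) T
    exact h1.comp (g := fun y : ST (E N) => k + inner ℝ p (y - stp x0 t0) + 1/2 * inner ℝ (T (y - stp x0 t0)) (y - stp x0 t0)) (WithLp.prodContinuousLinearEquiv 2 ℝ (E N) ℝ).symm.contDiff
  · have h1 : ∀ s, φ x0 s = k + p.snd * (s - t0) + 1/2 * (inner ℝ (T (stp 0 1)) (stp 0 1)) * (s - t0)^2 := by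
      intro s
      have e : stp x0 s - stp x0 t0 = (s - t0) • stp (0 : E N) 1 := by
        rw [hsub, sub_self]
        show _ = WithLp.toLp 2 ((s - t0) • ((0 : E N), (1:ℝ)))
        simp
      simp only [φ]
      rw [e, map_smul, inner_smul_right, inner_smul_left, inner_smul_right, st_inner p]
      simp
      ring
    have h2 : φ x0 = fun s => k + p.snd * (s - t0) + 1/2 * (inner ℝ (T (stp 0 1)) (stp 0 1)) * (s - t0)^2 := by
      ext s; exact h1 s
    rw [h2]
    have h3 : HasDerivAt (fun s : ℝ => s - t0) 1 t0 := (hasDerivAt_id t0).sub_const t0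
    have h4 := ((h3.const_mul p.snd).const_add k).add ((h3.pow 2).const_mul (1/2 * (inner ℝ (T (stp 0 1)) (stp 0 1))))
    have h5 : HasDerivAt (fun s => k + p.snd * (s - t0) + 1/2 * (inner ℝ (T (stp 0 1)) (stp 0 1)) * (s - t0)^2)
        p.snd t0 := by
      refine HasDerivAt.congr_deriv (h4.congr_of_eventuallyEq (Eventually.of_forall fun s => ?_)) ?_
      · simp
      · simp
    exact h5.deriv
  · rw [hφ0]; exact quad_grad _ _ _ _ hT'
  · intro M
    rw [hφ0, quad_trace _ _ _ _ _ hT']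
    refine Finset.sum_congr rfl fun c _ => ?_
    rw [hT'i, hTi, real_inner_self_eq_norm_sq, WithLp.norm_toLp_fst]
  · intro y s
    simp only [φ, hsub, hTi, real_inner_self_eq_norm_sq]
    ring

end Jets

section Visc

variable {N : ℕ} {Θ : Type*}

theorem inner_le_opNorm_sq {X : Type*} [NormedAddCommGroup X] [InnerProductSpace ℝ X] (Y : X →L[ℝ] X) (a : X) (Cs : ℝ)
    (ha : ‖a‖ ≤ Cs) : |inner ℝ (Y a) a| ≤ ‖Y‖ * Cs^2 := by
  have hC : 0 ≤ Cs := (norm_nonneg a).trans ha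
  calc |inner ℝ (Y a) a| ≤ ‖Y a‖ * ‖a‖ := abs_real_inner_le_norm _ _
    _ ≤ (‖Y‖ * ‖a‖) * ‖a‖ := by gcongr; exact Y.le_opNorm _
    _ ≤ (‖Y‖ * Cs) * Cs := by gcongr
    _ = _ := by ring

theorem tendsto_stp {N : ℕ} (x0 : E N) (t0 : ℝ) :
    Tendsto (fun q : E N × ℝ => stp (q.1 - x0) (q.2 - t0)) (nhds (x0, t0)) (nhds 0) := by
  have h1 : Continuous (fun q : E N × ℝ => stp (q.1 - x0) (q.2 - t0)) :=
    (WithLp.prod_continuous_toLp 2 (E N) ℝ).comp (by fun_prop)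
  have h2 := h1.tendsto (x0, t0)
  simp only [sub_self] at h2
  exact h2

theorem jsub_of_subsol (σm A : Θ → E N → Matrix (Fin N) (Fin N) ℝ)
    (hA : ∀ (θ : Θ) (x : E N), A θ x = σm θ x * (σm θ x)ᵀ)
    (Cs : ℝ) (hCs : ∀ θ x c, ‖cols σm θ x c‖ ≤ Cs)
    (H : Θ → E N → E N → ℝ) (hHb : ∀ x p, ∃ B, ∀ θ, |H θ x p| ≤ B)
    (u : E N → ℝ → ℝ) (hu : IsSubSolCP A H u) : JSub (cols σm) H u := by
  intro z p Y hz hj θ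
  obtain ⟨K, hK⟩ : ∃ K, K = 2 * ∑ c, ‖cols σm θ z.fst c‖^2 := ⟨_, rfl⟩
  have key : ∀ ε > 0, p.snd - ∑ c, inner ℝ (Y (stp (cols σm θ z.fst c) 0)) (stp (cols σm θ z.fst c) 0)
      + H θ z.fst p.fst ≤ K * ε := by
    intro ε hε
    obtain ⟨φ, hφ1, hφ2, hφ3, hφ4, hφ5⟩ := jet_test z.fst z.snd (u z.fst z.snd) p Y hj.1 ε
    have hop : ∀ θ, opVal A H θ z.fst (fun y => φ y z.snd) = 
      - ∑ c, (inner ℝ (Y (stp (cols σm θ z.fst c) 0)) (stp (cols σm θ z.fst c) 0)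
        + 2 * ε * ‖cols σm θ z.fst c‖^2) + H θ z.fst p.fst := by
      intro θ
      rw [opVal, hA, hφ3, hφ4]; rfl
    have h1 := hu φ hφ1 z.fst z.snd hz (by
      have e := (tendsto_stp z.fst z.snd).eventually (hj.2 ε hε)
      filter_upwards [e] with q hq
      rw [hφ5, hφ5]
      simp only [sub_self]
      have e0 : stp (0 : E N) 0 = 0 := rfl
      rw [e0]
      simp only [WithLp.add_fst, WithLp.add_snd, WithLp.toLp_fst, WithLp.toLp_snd, add_sub_cancel] at hq
      simp only [inner_zero_right, norm_zero]
      linarith)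
    rw [hφ2] at h1
    have hb : BddAbove (Set.range fun θ => opVal A H θ z.fst (fun y => φ y z.snd)) := by
      obtain ⟨B, hB⟩ := hHb z.fst p.fst
      refine ⟨N * (‖Y‖ * Cs^2) + B, ?_⟩
      rintro _ ⟨θ, rfl⟩
      simp only [hop]
      have h2 := (abs_le.1 (hB θ)).2
      have h3 : ∑ c : Fin N, -(‖Y‖ * Cs^2) ≤ ∑ c, (inner ℝ (Y (stp (cols σm θ z.fst c) 0)) (stp (cols σm θ z.fst c) 0)
        + 2 * ε * ‖cols σm θ z.fst c‖^2) := by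
        refine Finset.sum_le_sum fun c _ => ?_
        have h4 := (abs_le.1 (inner_le_opNorm_sq Y (stp (cols σm θ z.fst c) 0) Cs (by
          rw [WithLp.norm_toLp_fst]; exact hCs _ _ _))).1
        have : 0 ≤ 2 * ε * ‖cols σm θ z.fst c‖^2 := by positivity
        linarith
      simp only [Finset.sum_const, Finset.card_univ, Fintype.card_fin, nsmul_eq_mul] at h3
      linarith
    have h2 := le_ciSup hb θ
    simp only [hop] at h2 h1
    rw [Finset.sum_add_distrib, ← Finset.mul_sum] at h2
    rw [hK]
    linarith
  have hlim : Tendsto (fun ε : ℝ => K * ε) (nhdsWithin 0 (Set.Ioi 0)) (nhds 0) := by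
    have : Tendsto (fun ε : ℝ => K * ε) (nhds 0) (nhds (K * 0)) := Continuous.tendsto (by fun_prop) 0
    rw [mul_zero] at this
    exact this.mono_left nhdsWithin_le_nhds
  refine ge_of_tendsto hlim ?_
  filter_upwards [self_mem_nhdsWithin] with ε hε
  exact key ε hε

theorem jsup_of_supersol [Nonempty Θ] (σm A : Θ → E N → Matrix (Fin N) (Fin N) ℝ)
    (hA : ∀ (θ : Θ) (x : E N), A θ x = σm θ x * (σm θ x)ᵀ)
    (Cs : ℝ) (hCs : ∀ θ x c, ‖cols σm θ x c‖ ≤ Cs)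
    (H : Θ → E N → E N → ℝ)
    (u : E N → ℝ → ℝ) (hu : IsSuperSolCP A H u) : JSup (cols σm) H u := by
  intro z p Y hz hj ε0 hε0
  obtain ⟨ε, hεs, hε⟩ := ((ev_small (2 * (N * Cs^2)) (ε0/2) (by linarith)).and self_mem_nhdsWithin).exists
  have hε : 0 < ε := hε
  obtain ⟨φ, hφ1, hφ2, hφ3, hφ4, hφ5⟩ := jet_test z.fst z.snd (u z.fst z.snd) (-p) (-Y) (by
    intro a b; simp [hj.1]) (-ε)
  have hop : ∀ θ, opVal A H θ z.fst (fun y => φ y z.snd) = 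
    ∑ c, inner ℝ (Y (stp (cols σm θ z.fst c) 0)) (stp (cols σm θ z.fst c) 0)
        + 2 * ε * ∑ c, ‖cols σm θ z.fst c‖^2 + H θ z.fst (-p.fst) := by
    intro θ
    rw [opVal, hA, hφ3, hφ4, Finset.mul_sum, ← Finset.sum_add_distrib, ← Finset.sum_neg_distrib]
    congr 1
    refine Finset.sum_congr rfl fun c _ => ?_
    simp only [neg_apply, inner_neg_left, cols]
    ring
  have h1 := hu φ hφ1 z.fst z.snd hz (by
      have e := (tendsto_stp z.fst z.snd).eventually (hj.2 ε hε)
      filter_upwards [e] with q hq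
      rw [hφ5, hφ5]
      simp only [sub_self]
      have e0 : stp (0 : E N) 0 = 0 := rfl
      rw [e0]
      simp only [WithLp.add_fst, WithLp.add_snd, WithLp.toLp_fst, WithLp.toLp_snd, add_sub_cancel] at hq
      simp only [inner_neg_left, neg_apply, inner_zero_right, norm_zero]
      linarith)
  rw [hφ2] at h1
  simp only [WithLp.neg_snd] at h1
  obtain ⟨θ, hθ⟩ := exists_lt_of_lt_ciSup (f := fun θ => opVal A H θ z.fst (fun y => φ y z.snd))
    (b := p.snd - ε0/2) (by linarith)
  refine ⟨θ, ?_⟩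
  simp only [hop] at hθ
  have h2 : ∑ c, ‖cols σm θ z.fst c‖^2 ≤ N * Cs^2 := by
    calc ∑ c, ‖cols σm θ z.fst c‖^2 ≤ ∑ c : Fin N, Cs^2 := Finset.sum_le_sum fun c _ => by gcongr; exact hCs _ _ _
      _ = _ := by simp
  have h3 : 2 * ε * ∑ c, ‖cols σm θ z.fst c‖^2 ≤ 2 * ε * (N * Cs^2) := by gcongr
  linarith

theorem opVal_erg_sub (A : Θ → E N → Matrix (Fin N) (Fin N) ℝ) (H : Θ → E N → E N → ℝ) (c : ℝ) (v : E N → ℝ)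
    (hv : IsSubSolErg A H c v) : IsSubSolCP A H (fun x t => v x - c * t) := by
  intro φ hφ x0 t0 ht0 hmax
  have h1 : IsLocalMax (fun x => v x - φ x t0) x0 := by
    have ht : Tendsto (fun x : E N => (x, t0)) (nhds x0) (nhds (x0, t0)) :=
      Continuous.tendsto (by fun_prop) x0
    filter_upwards [ht.eventually hmax] with x hx
    linarith
  have hd : DifferentiableAt ℝ (φ x0) t0 := by
    have : Differentiable ℝ (fun q : E N × ℝ => φ q.1 q.2) := hφ.differentiable (by norm_num)
    exact (this (x0, t0)).comp (f := fun t => (x0, t)) t0 (by fun_prop)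
  have h2 : IsLocalMax (fun t => - c * t - φ x0 t) t0 := by
    have ht : Tendsto (fun t : ℝ => (x0, t)) (nhds t0) (nhds (x0, t0)) :=
      Continuous.tendsto (by fun_prop) t0
    filter_upwards [ht.eventually hmax] with x hx
    linarith
  have h3 := h2.hasDerivAt_eq_zero (((hasDerivAt_id t0).const_mul (-c)).sub hd.hasDerivAt)
  have h4 := hv _ (hφ.comp (f := fun x : E N => (x, t0)) (by fun_prop)) x0 h1
  have h5 : (⨆ θ, opVal A H θ x0 fun y => φ y t0) ≤ c := h4
  linarith

theorem opVal_erg_super (A : Θ → E N → Matrix (Fin N) (Fin N) ℝ) (H : Θ → E N → E N → ℝ) (c : ℝ) (v : E N → ℝ)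
    (hv : IsSuperSolErg A H c v) : IsSuperSolCP A H (fun x t => v x - c * t) := by
  intro φ hφ x0 t0 ht0 hmax
  have h1 : IsLocalMin (fun x => v x - φ x t0) x0 := by
    have ht : Tendsto (fun x : E N => (x, t0)) (nhds x0) (nhds (x0, t0)) :=
      Continuous.tendsto (by fun_prop) x0
    filter_upwards [ht.eventually hmax] with x hx
    linarith
  have hd : DifferentiableAt ℝ (φ x0) t0 := by
    have : Differentiable ℝ (fun q : E N × ℝ => φ q.1 q.2) := hφ.differentiable (by norm_num)
    exact (this (x0, t0)).comp (f := fun t => (x0, t)) t0 (by fun_prop)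
  have h2 : IsLocalMin (fun t => - c * t - φ x0 t) t0 := by
    have ht : Tendsto (fun t : ℝ => (x0, t)) (nhds t0) (nhds (x0, t0)) :=
      Continuous.tendsto (by fun_prop) t0
    filter_upwards [ht.eventually hmax] with x hx
    linarith
  have h3 := h2.hasDerivAt_eq_zero (((hasDerivAt_id t0).const_mul (-c)).sub hd.hasDerivAt)
  have h4 := hv _ (hφ.comp (f := fun x : E N => (x, t0)) (by fun_prop)) x0 h1
  have h5 : c ≤ (⨆ θ, opVal A H θ x0 fun y => φ y t0) := h4
  linarith

section
variable {X : Type*} [NormedAddCommGroup X] [InnerProductSpace ℝ X] [FiniteDimensional ℝ X]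
variable {J : Type*} [Fintype J]

theorem jsub_shift (sg : Θ → X → J → X) (H : Θ → X → X → ℝ) (f : X → ℝ → ℝ) (hf : JSub sg H f) (c : ℝ) :
    JSub sg (fun θ x p => H θ x p - c) (fun x t => f x t + c * t) := by
  intro z p Y hz hj θ
  have h1 : SupJet (fun z : ST X => f z.fst z.snd) z (p - stp 0 c) Y := by
    refine ⟨hj.1, fun ε hε => ?_⟩
    filter_upwards [hj.2 ε hε] with h hh
    rw [inner_sub_left, st_inner (stp 0 c)]
    simp only [WithLp.add_fst, WithLp.add_snd, WithLp.toLp_fst, WithLp.toLp_snd, inner_zero_left] at hh ⊢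
    linarith
  have h2 := hf z _ Y hz h1 θ
  simp only [WithLp.sub_fst, WithLp.sub_snd, WithLp.toLp_fst, WithLp.toLp_snd, sub_zero] at h2
  linarith

theorem jsup_shift (sg : Θ → X → J → X) (H : Θ → X → X → ℝ) (f : X → ℝ → ℝ) (hf : JSup sg H f) (c : ℝ) :
    JSup sg (fun θ x p => H θ x p - c) (fun x t => f x t + c * t) := by
  intro z p Y hz hj ε0 hε0
  have h1 : SupJet (fun z : ST X => - f z.fst z.snd) z (p + stp 0 c) Y := by
    refine ⟨hj.1, fun ε hε => ?_⟩
    filter_upwards [hj.2 ε hε] with h hh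
    rw [inner_add_left, st_inner (stp 0 c)]
    simp only [WithLp.add_fst, WithLp.add_snd, WithLp.toLp_fst, WithLp.toLp_snd, inner_zero_left] at hh ⊢
    linarith
  obtain ⟨θ, h2⟩ := hf z _ Y hz h1 ε0 hε0
  refine ⟨θ, ?_⟩
  simp only [WithLp.add_fst, WithLp.add_snd, WithLp.toLp_fst, WithLp.toLp_snd, add_zero] at h2
  linarith

theorem jsub_const (sg : Θ → X → J → X) (k : ℝ) :
    JSub sg (fun _ _ _ => 0) (fun (_ : X) _ => k) := by
  intro z p Y hz hj θ
  have hp : p = 0 := by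
    by_contra hp
    have hp0 : 0 < ‖p‖^2 := by positivity
    have ht : Tendsto (fun s : ℝ => (-s) • p) (nhdsWithin 0 (Set.Ioi 0)) (nhds 0) := by
      have : Tendsto (fun s : ℝ => (-s) • p) (nhds 0) (nhds ((-0 : ℝ) • p)) :=
        Continuous.tendsto (by fun_prop) 0
      rw [neg_zero, zero_smul] at this
      exact this.mono_left nhdsWithin_le_nhds
    obtain ⟨s, ⟨h1, h2⟩, hs⟩ := ((ht.eventually (hj.2 1 one_pos)).and
      (ev_small (1/2 * inner ℝ (Y p) p + ‖p‖^2) (‖p‖^2/2) (by linarith)) |>.and self_mem_nhdsWithin).exists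
    have hs : 0 < s := hs
    simp only [map_smul, inner_smul_left, inner_smul_right, norm_smul, conj_trivial,
      real_inner_self_eq_norm_sq, norm_neg, Real.norm_of_nonneg hs.le] at h1
    have h3 : s * ‖p‖^2 ≤ s * ((1/2 * inner ℝ (Y p) p + ‖p‖^2) * s) := by nlinarith
    have h4 := le_of_mul_le_mul_left h3 hs
    linarith
  subst hp
  have hY : ∀ h, 0 ≤ 1/2 * inner ℝ (Y h) h := by
    intro h
    refine quad_nonneg (fun h => 1/2 * inner ℝ (Y h) h) ?_ ?_ h
    · intro s h; simp only [map_smul, inner_smul_left, inner_smul_right, conj_trivial]; ring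
    · intro ε hε
      filter_upwards [hj.2 ε hε] with h hh
      simp only [inner_zero_left] at hh
      linarith
  have : 0 ≤ ∑ c, inner ℝ (Y (stp (sg θ z.fst c) 0)) (stp (sg θ z.fst c) 0) :=
    Finset.sum_nonneg fun c _ => by have := hY (stp (sg θ z.fst c) 0); linarith
  simp only [WithLp.zero_snd]
  linarith

end

end Visc

section Comp

variable {X : Type*} [NormedAddCommGroup X] [InnerProductSpace ℝ X] [FiniteDimensional ℝ X]
variable {Θ J : Type*} [Fintype J]

theorem gl' (sg : Θ → X → J → X) (Cs : ℝ) (hCs : 0 ≤ Cs) (hsb : ∀ θ x c, ‖sg θ x c‖ ≤ Cs)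
    (hsl : ∀ θ x y c, ‖sg θ x c - sg θ y c‖ ≤ Cs * ‖x - y‖)
    (H G : Θ → X → X → ℝ) (CR : ℝ) (hCR : 0 ≤ CR) (L L2 : ℝ) (hL2 : 0 ≤ L2) (hL2L : L2 ≤ L)
    (hH : ∀ θ x y p, ‖p‖ ≤ L → |H θ x p - H θ y p| ≤ CR * ‖x - y‖)
    (hG : ∀ θ x y p, ‖p‖ ≤ L → |G θ x p - G θ y p| ≤ CR * ‖x - y‖)
    (f1 f3 : X → ℝ → ℝ) (f2 : X → ℝ) (hj1 : JSub sg H f1) (hj2 : JSub sg G (fun x _ => f2 x))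
    (hj3 : JSup sg H f3)
    (hc1 : ContinuousOn (fun z : X × ℝ => f1 z.1 z.2) {z | 0 < z.2})
    (hc3 : ContinuousOn (fun z : X × ℝ => f3 z.1 z.2) {z | 0 < z.2})
    (hl1 : ∀ t, 0 ≤ t → ∀ x y, |f1 x t - f1 y t| ≤ L * ‖x - y‖)
    (hl3 : ∀ t, 0 ≤ t → ∀ x y, |f3 x t - f3 y t| ≤ L * ‖x - y‖)
    (hl2 : ∀ x y, |f2 x - f2 y| ≤ L2 * ‖x - y‖)
    (w1 w2 w3 : ℝ) (hw1 : 0 < w1) (hw2 : 0 < w2) (hw3 : 0 < w3)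
    (xh : X) (th sh r : ℝ) (hr : 0 < r) (hrt : r < th) (hrs : r < sh)
    (q : X) (a b κ : ℝ) (S : X →L[ℝ] X) (hS : ∀ a b, inner ℝ (S a) b = inner ℝ a (S b))
    (hmax : ∀ x t s, ‖x - xh‖ ≤ r → |t - th| ≤ r → |s - sh| ≤ r →
      w1 * f1 x t + w2 * f2 x - w3 * f3 x s ≤ w1 * f1 xh th + w2 * f2 xh - w3 * f3 xh sh
        + inner ℝ q (x - xh) + a * (t - th)
        + b * (s - sh) + 1/2 * inner ℝ (S (x - xh)) (x - xh) + κ * ((t - th)^2 + (s - sh)^2))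
    (τ : ℝ) (hτ : 0 < τ) :
    ∃ (θ : Θ) (p1 p2 p3 : X), ‖p1‖ ≤ L ∧ ‖p2‖ ≤ L2 ∧ ‖p3‖ ≤ L ∧
      ‖w1 • p1 + w2 • p2 - w3 • p3 - q‖ ≤ τ ∧
      a + b - ∑ c, inner ℝ (S (sg θ xh c)) (sg θ xh c) + w1 * H θ xh p1 + w2 * G θ xh p2
        - w3 * H θ xh p3 ≤ τ := by
  obtain ⟨ι, hι1, hι⟩ := ((ev_small (2 * (Fintype.card J * Cs^2)) (τ/2) (by linarith)).and
    self_mem_nhdsWithin).exists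
  have hι : 0 < ι := hι
  have hS' : ∀ a b, inner ℝ ((S + (2 * ι) • ContinuousLinearMap.id ℝ X) a) b
      = inner ℝ (S a) b + 2 * ι * inner ℝ a b := by
    intro a b; simp [inner_add_left, inner_smul_left]
  obtain ⟨θ, p1, p2, p3, h1, h2, h3, h4, h5⟩ := gl sg Cs hCs hsb hsl H G CR hCR L L2 hL2 hL2L hH hG f1 f3 f2
    hj1 hj2 hj3 hc1 hc3 hl1 hl3 hl2 w1 w2 w3 hw1 hw2 hw3 xh th sh r hr hrt hrs q a b (κ + ι) ι
    (S + (2 * ι) • ContinuousLinearMap.id ℝ X) hι (by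
      intro a b
      rw [real_inner_comm ((S + (2 * ι) • ContinuousLinearMap.id ℝ X) b) a, hS', hS', hS, real_inner_comm (S b), real_inner_comm b a]) (by
      intro x t s hx ht hs
      have := hmax x t s hx ht hs
      rw [hS', real_inner_self_eq_norm_sq]
      linarith) (τ/2) (by linarith)
  refine ⟨θ, p1, p2, p3, h1, h2, h3, by linarith, ?_⟩
  simp only [hS', Finset.sum_add_distrib, ← Finset.mul_sum, real_inner_self_eq_norm_sq] at h5
  have h6 : ∑ c, ‖sg θ xh c‖^2 ≤ Fintype.card J * Cs^2 := by
    calc ∑ c, ‖sg θ xh c‖^2 ≤ ∑ c : J, Cs^2 := Finset.sum_le_sum fun c _ => by gcongr; exact hsb _ _ _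
      _ = _ := by simp
  have h7 : 2 * ι * ∑ c, ‖sg θ xh c‖^2 ≤ 2 * ι * (Fintype.card J * Cs^2) := by gcongr
  linarith

theorem supjet_tshift (f : X → ℝ → ℝ) (a : ℝ) (z p : ST X) (Y : ST X →L[ℝ] ST X)
    (h : SupJet (fun z : ST X => f z.fst (z.snd + a)) z p Y) :
    SupJet (fun z : ST X => f z.fst z.snd) (stp z.fst (z.snd + a)) p Y := by
  refine ⟨h.1, fun ε hε => ?_⟩
  filter_upwards [h.2 ε hε] with k hk
  simp only [WithLp.add_fst, WithLp.add_snd, WithLp.toLp_fst, WithLp.toLp_snd] at hk ⊢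
  rw [add_right_comm]; exact hk

theorem jsub_tshift (sg : Θ → X → J → X) (H : Θ → X → X → ℝ) (f : X → ℝ → ℝ) (hf : JSub sg H f) (a : ℝ)
    (ha : 0 ≤ a) : JSub sg H (fun x t => f x (t + a)) := by
  intro z p Y hz hj θ
  have := hf _ p Y (by simp only [WithLp.toLp_snd]; linarith) (supjet_tshift f a z p Y hj) θ
  simpa only [WithLp.toLp_fst] using this

theorem jsup_tshift (sg : Θ → X → J → X) (H : Θ → X → X → ℝ) (f : X → ℝ → ℝ) (hf : JSup sg H f) (a : ℝ)
    (ha : 0 ≤ a) : JSup sg H (fun x t => f x (t + a)) := by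
  intro z p Y hz hj
  have := hf _ p Y (by simp only [WithLp.toLp_snd]; linarith) (supjet_tshift (fun x t => - f x t) a z p Y hj)
  simpa only [WithLp.toLp_fst] using this

end Comp

section Per

variable {N : ℕ}

/-- integer vector -/
def iv (k : Fin N → ℤ) : E N := (WithLp.equiv 2 (Fin N → ℝ)).symm fun i => (k i : ℝ)

theorem exists_cube (x : E N) : ∃ k : Fin N → ℤ, x + iv k ∈ cube N := by
  refine ⟨fun i => -⌊x i⌋, fun i => ?_⟩
  have h1 := Int.floor_le (x i)
  have h2 := Int.lt_floor_add_one (x i)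
  simp [iv]
  constructor <;> linarith

theorem cube_compact : IsCompact (cube N) := by
  have h : cube N = (EuclideanSpace.equiv (Fin N) ℝ) ⁻¹' (Set.pi Set.univ fun _ => Set.Icc (0:ℝ) 1) := by
    ext x
    simp only [cube, Set.mem_setOf_eq, Set.mem_preimage, Set.mem_pi, Set.mem_univ, true_implies]
    rfl
  rw [h]
  exact (EuclideanSpace.equiv (Fin N) ℝ).toHomeomorph.isCompact_preimage.2
    (isCompact_univ_pi fun _ => isCompact_Icc)

theorem cube_nonempty : (cube N).Nonempty := ⟨0, fun i => by simp⟩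

end Per

section CompCP

variable {N : ℕ} {Θ : Type*}

structure Dat (sg : Θ → E N → Fin N → E N) (H : Θ → E N → E N → ℝ) (Cs CR L : ℝ) : Prop where
  hCs : 0 ≤ Cs
  hsb : ∀ θ x c, ‖sg θ x c‖ ≤ Cs
  hsl : ∀ θ x y c, ‖sg θ x c - sg θ y c‖ ≤ Cs * ‖x - y‖
  hCR : 0 ≤ CR
  hL : 0 ≤ L
  hH : ∀ θ x y p q, ‖p‖ ≤ L → ‖q‖ ≤ L → |H θ x p - H θ y q| ≤ CR * (‖x - y‖ + ‖p - q‖)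

structure Reg (L : ℝ) (f : E N → ℝ → ℝ) : Prop where
  per : ∀ x t k, f (x + iv k) t = f x t
  cont : ContinuousOn (fun z : E N × ℝ => f z.1 z.2) (Set.univ ×ˢ Set.Ici 0)
  lip : ∀ t, 0 ≤ t → ∀ x y, |f x t - f y t| ≤ L * ‖x - y‖

theorem Reg.cont' {L : ℝ} {f : E N → ℝ → ℝ} (h : Reg L f) :
    ContinuousOn (fun z : E N × ℝ => f z.1 z.2) {z | 0 < z.2} :=
  h.cont.mono fun z (hz : 0 < z.2) => ⟨trivial, Set.mem_Ici.2 hz.le⟩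

theorem Dat.hH1 {sg : Θ → E N → Fin N → E N} {H : Θ → E N → E N → ℝ} {Cs CR L : ℝ} (D : Dat sg H Cs CR L)
    (θ : Θ) (x y p : E N) (hp : ‖p‖ ≤ L) : |H θ x p - H θ y p| ≤ CR * ‖x - y‖ := by
  have := D.hH θ x y p p hp hp
  simpa using this

theorem Reg.unif {L : ℝ} {f : E N → ℝ → ℝ} (h : Reg L f) (T : ℝ) (γ : ℝ) (hγ : 0 < γ) :
    ∃ ρ > 0, ∀ x t s, t ∈ Set.Icc 0 T → s ∈ Set.Icc 0 T → |t - s| ≤ ρ → |f x t - f x s| ≤ γ := by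
  have hK : IsCompact (cube N ×ˢ Set.Icc (0:ℝ) T) := cube_compact.prod isCompact_Icc
  have huc := hK.uniformContinuousOn_of_continuous (h.cont.mono (fun z hz => ⟨trivial, hz.2.1⟩))
  rw [Metric.uniformContinuousOn_iff_le] at huc
  obtain ⟨ρ, hρ, H⟩ := huc γ hγ
  refine ⟨ρ, hρ, fun x t s ht hs hts => ?_⟩
  obtain ⟨k, hk⟩ := exists_cube x
  have := H (x + iv k, t) ⟨hk, ht⟩ (x + iv k, s) ⟨hk, hs⟩ (by
    rw [Prod.dist_eq]; simp [Real.dist_eq, hts, hρ.le])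
  simpa [Real.dist_eq, h.per] using this

theorem Reg.bdd {L : ℝ} {f : E N → ℝ → ℝ} (h : Reg L f) (T : ℝ) :
    ∃ B, 0 ≤ B ∧ ∀ x t, t ∈ Set.Icc 0 T → |f x t| ≤ B := by
  have hK : IsCompact (cube N ×ˢ Set.Icc (0:ℝ) T) := cube_compact.prod isCompact_Icc
  obtain ⟨B, hB⟩ := hK.exists_bound_of_continuousOn (h.cont.mono (fun z hz => ⟨trivial, hz.2.1⟩))
  refine ⟨max B 0, le_max_right _ _, fun x t ht => ?_⟩
  obtain ⟨k, hk⟩ := exists_cube x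
  have := hB (x + iv k, t) ⟨hk, ht⟩
  simp only [h.per, Real.norm_eq_abs] at this
  exact this.trans (le_max_left _ _)

theorem pos_sq_le (a h : ℝ) : (max 0 (a + h))^2 ≤ (max 0 a)^2 + 2 * max 0 a * h + h^2 := by
  rcases max_cases 0 a with ⟨h1, h2⟩ | ⟨h1, h2⟩ <;> rcases max_cases 0 (a + h) with ⟨h3, h4⟩ | ⟨h3, h4⟩ <;>
    rw [h1, h3] <;> nlinarith [sq_nonneg (a + h)]

theorem cmp_num {β K n M th sh t s t1 U Uh : ℝ} (hK : 0 ≤ K) (hn : 0 ≤ n)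
    (h : U - M - β * t - K * (max 0 (t - t1))^2 - n * (t - s)^2 ≤
      Uh - M - β * th - K * (max 0 (th - t1))^2 - n * (th - sh)^2) :
    U ≤ Uh + (β + 2 * K * max 0 (th - t1) + 2 * n * (th - sh)) * (t - th)
      + (- (2 * n * (th - sh))) * (s - sh) + (K + 2 * n) * ((t - th)^2 + (s - sh)^2) := by
  have h1 := pos_sq_le (th - t1) (t - th)
  rw [show th - t1 + (t - th) = t - t1 by ring] at h1
  have h2 := mul_le_mul_of_nonneg_left h1 hK
  have h3 : n * (t - s)^2 ≤ n * ((th - sh)^2 + 2 * (th - sh) * ((t - th) - (s - sh))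
      + 2 * ((t - th)^2 + (s - sh)^2)) := by
    apply mul_le_mul_of_nonneg_left _ hn
    nlinarith [sq_nonneg ((t - th) + (s - sh))]
  have h4 : 0 ≤ K * (s - sh)^2 := by positivity
  linarith

theorem cmp {sg : Θ → E N → Fin N → E N} {H : Θ → E N → E N → ℝ} {Cs CR L : ℝ} (D : Dat sg H Cs CR L)
    {u1 u2 : E N → ℝ → ℝ} (R1 : Reg L u1) (R2 : Reg L u2) (h1 : JSub sg H u1) (h2 : JSup sg H u2)
    (M : ℝ) (h0 : ∀ x, u1 x 0 ≤ u2 x 0 + M) (x1 : E N) (t1 : ℝ) (ht1 : 0 ≤ t1) :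
    u1 x1 t1 ≤ u2 x1 t1 + M := by
  by_contra hcon
  push Not at hcon
  obtain ⟨γ, hγ⟩ : ∃ γ, γ = u1 x1 t1 - u2 x1 t1 - M := ⟨_, rfl⟩
  have hγ0 : 0 < γ := by linarith
  have ht1' : 0 < t1 := by
    rcases ht1.lt_or_eq with h | h
    · exact h
    · subst h; linarith [h0 x1]
  set T := t1 + 1 with hT
  obtain ⟨B1, hB1, hb1⟩ := R1.bdd T
  obtain ⟨B2, hB2, hb2⟩ := R2.bdd T
  obtain ⟨ρ1, hρ1, hu1⟩ := R1.unif T (γ/4) (by linarith)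
  obtain ⟨ρ2, hρ2, hu2⟩ := R2.unif T (γ/4) (by linarith)
  obtain ⟨ρ, hρ, hρa, hρb, hρc⟩ : ∃ ρ > 0, ρ ≤ ρ1 ∧ ρ ≤ ρ2 ∧ ρ ≤ 1/4 :=
    ⟨min ρ1 (min ρ2 (1/4)), by positivity, by simp, by simp, by simp⟩
  set B := B1 + B2 + |M| + 1 with hB
  have hBpos : 0 < B := by positivity
  have hUB : ∀ x t s, t ∈ Set.Icc 0 T → s ∈ Set.Icc 0 T → u1 x t - u2 x s - M < B := by
    intro x t s ht hs
    have a1 := (abs_le.1 (hb1 x t ht)).2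
    have a2 := (abs_le.1 (hb2 x s hs)).1
    have a3 := neg_abs_le M
    linarith
  set β := γ / (2 * t1) with hβ
  have hβ0 : 0 < β := by positivity
  have hβt : β * t1 = γ / 2 := by rw [hβ]; field_simp
  set K := 16 * B with hK
  set n := B / ρ^2 with hn
  have hn0 : 0 < n := by positivity
  have hnρ : n * ρ^2 = B := by rw [hn]; field_simp
  set Φ : E N × ℝ × ℝ → ℝ := fun z => u1 z.1 z.2.1 - u2 z.1 z.2.2 - M - β * z.2.1
    - K * (max 0 (z.2.1 - t1))^2 - n * (z.2.1 - z.2.2)^2 with hΦ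
  have hKc : IsCompact (cube N ×ˢ (Set.Icc (0:ℝ) T ×ˢ Set.Icc (0:ℝ) T)) :=
    cube_compact.prod (isCompact_Icc.prod isCompact_Icc)
  have hΦc : ContinuousOn Φ (cube N ×ˢ (Set.Icc (0:ℝ) T ×ˢ Set.Icc (0:ℝ) T)) := by
    have c1 : ContinuousOn (fun z : E N × ℝ × ℝ => u1 z.1 z.2.1) (cube N ×ˢ (Set.Icc (0:ℝ) T ×ˢ Set.Icc (0:ℝ) T)) :=
      R1.cont.comp (f := fun z : E N × ℝ × ℝ => (z.1, z.2.1)) (by fun_prop)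
        (fun z hz => ⟨trivial, hz.2.1.1⟩)
    have c2 : ContinuousOn (fun z : E N × ℝ × ℝ => u2 z.1 z.2.2) (cube N ×ˢ (Set.Icc (0:ℝ) T ×ˢ Set.Icc (0:ℝ) T)) :=
      R2.cont.comp (f := fun z : E N × ℝ × ℝ => (z.1, z.2.2)) (by fun_prop)
        (fun z hz => ⟨trivial, hz.2.2.1⟩)
    have c3 : Continuous (fun z : E N × ℝ × ℝ => M + β * z.2.1 + K * (max 0 (z.2.1 - t1))^2
      + n * (z.2.1 - z.2.2)^2) := by fun_prop
    refine ((c1.sub c2).sub c3.continuousOn).congr fun z _ => ?_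
    simp only [hΦ, Pi.sub_apply]; ring
  obtain ⟨⟨xh, th, sh⟩, ⟨hxh, hth, hsh⟩, hmx⟩ := hKc.exists_isMaxOn
    (cube_nonempty.prod ⟨(0,0), ⟨⟨le_rfl, by positivity⟩, ⟨le_rfl, by positivity⟩⟩⟩) hΦc
  simp only at hxh hth hsh
  have hmx' : ∀ x t s, t ∈ Set.Icc 0 T → s ∈ Set.Icc 0 T →
      u1 x t - u2 x s - M - β * t - K * (max 0 (t - t1))^2 - n * (t - s)^2 ≤
      u1 xh th - u2 xh sh - M - β * th - K * (max 0 (th - t1))^2 - n * (th - sh)^2 := by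
    intro x t s ht hs
    obtain ⟨k, hk⟩ := exists_cube x
    have := hmx (show (x + iv k, t, s) ∈ _ from ⟨hk, ht, hs⟩)
    simpa only [hΦ, Set.mem_setOf_eq, R1.per, R2.per] using this
  have hval := hmx' x1 t1 t1 ⟨ht1, by linarith⟩ ⟨ht1, by linarith⟩
  simp only [sub_self, max_self] at hval
  have hbb := hUB xh th sh hth hsh
  have hP1 : 0 ≤ K * (max 0 (th - t1))^2 := by positivity
  have hP2 : 0 ≤ n * (th - sh)^2 := by positivity
  have hP3 : 0 ≤ β * th := mul_nonneg hβ0.le hth.1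
  have hU : γ / 2 ≤ u1 xh th - u2 xh sh - M := by linarith
  have hd : |th - sh| ≤ ρ := by
    have : n * (th - sh)^2 ≤ n * ρ^2 := by linarith
    exact abs_le_of_sq_le_sq (le_of_mul_le_mul_left this hn0) hρ.le
  have htt : th ≤ t1 + 1/4 := by
    have : K * (max 0 (th - t1))^2 ≤ K * (1/4)^2 := by rw [hK]; linarith
    have := abs_le_of_sq_le_sq (le_of_mul_le_mul_left this (by positivity)) (by norm_num)
    have := le_trans (le_max_right 0 (th - t1)) ((le_abs_self _).trans this)
    linarith
  have hd' := abs_le.1 hd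
  have hth0 : 0 < th := by
    rcases hth.1.lt_or_eq with h | h
    · exact h
    · exfalso
      have e1 := hu2 xh th sh hth hsh (by linarith)
      have e2 := h0 xh
      rw [← h] at e1 hU
      have := (abs_le.1 e1).2
      linarith
  have hsh0 : 0 < sh := by
    rcases hsh.1.lt_or_eq with h | h
    · exact h
    · exfalso
      have e1 := hu1 xh th sh hth hsh (by linarith)
      have e2 := h0 xh
      rw [← h] at e1 hU
      have := (abs_le.1 e1).2
      linarith
  obtain ⟨r, hr, hra, hrb, hrc⟩ : ∃ r > 0, r < th ∧ r < sh ∧ r ≤ 1/4 :=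
    ⟨min (th/2) (min (sh/2) (1/4)), by positivity, lt_of_le_of_lt (min_le_left _ _) (by linarith),
      lt_of_le_of_lt ((min_le_right _ _).trans (min_le_left _ _)) (by linarith), by simp⟩
  have hτ : 0 < β / (2 * (1 + CR)) := by have := D.hCR; positivity
  obtain ⟨θ, p1, p2, p3, q1, q2, q3, q4, q5⟩ := gl' sg Cs D.hCs D.hsb D.hsl H (fun _ _ _ => 0) CR D.hCR L 0
    le_rfl D.hL D.hH1 (by intro θ x y p _; simp only [sub_self, abs_zero]; have := D.hCR; positivity)
    u1 u2 (fun _ => 0) h1 (jsub_const sg 0) h2 R1.cont' R2.cont' R1.lip R2.lip (by intro x y; simp)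
    1 1 1 one_pos one_pos one_pos xh th sh r hr hra hrb 0
    (β + 2 * K * max 0 (th - t1) + 2 * n * (th - sh)) (- (2 * n * (th - sh))) (K + 2 * n) 0
    (by intro a b; simp) (by
      intro x t s _ ht hs
      have ht' := abs_le.1 ht
      have hs' := abs_le.1 hs
      have := cmp_num (by positivity) hn0.le (hmx' x t s ⟨by linarith, by linarith⟩ ⟨by linarith, by linarith⟩)
      simp only [zero_apply, inner_zero_left]
      linarith) _ hτ
  have hp2 : p2 = 0 := by simpa using q2
  subst hp2
  simp only [one_smul, smul_zero, add_zero, sub_zero, zero_apply, inner_zero_left, Finset.sum_const_zero] at q4 q5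
  have hHd := D.hH θ xh xh p1 p3 q1 q3
  rw [sub_self, norm_zero, zero_add] at hHd
  have e1 := (abs_le.1 hHd).1
  have e2 : CR * ‖p1 - p3‖ ≤ CR * (β / (2 * (1 + CR))) := mul_le_mul_of_nonneg_left q4 D.hCR
  have e3 : (1 + CR) * (β / (2 * (1 + CR))) = β / 2 := by have := D.hCR; field_simp
  have e4 : 0 ≤ 2 * K * max 0 (th - t1) := by positivity
  linarith

end CompCP

section Pre

theorem limsup_ex {α : Type*} (F τ : α → ℝ) (B : ℝ) (hB : ∀ z, F z ≤ B) (b : ℝ)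
    (hb : ∀ T, ∃ z, T ≤ τ z ∧ b ≤ F z) :
    ∃ m, b ≤ m ∧ (∀ ι > 0, ∃ T, ∀ z, T ≤ τ z → F z ≤ m + ι) ∧
      (∀ ι > 0, ∀ T, ∃ z, T ≤ τ z ∧ m - ι ≤ F z) := by
  set Sx := {y : ℝ | ∀ T, ∃ z, T ≤ τ z ∧ y ≤ F z} with hS
  have hbd : BddAbove Sx := ⟨B, fun y hy => by obtain ⟨z, _, h⟩ := hy 0; exact h.trans (hB z)⟩
  have hbm : b ∈ Sx := hb
  refine ⟨sSup Sx, le_csSup hbd hbm, fun ι hι => ?_, fun ι hι T => ?_⟩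
  · by_contra hcon
    push Not at hcon
    have : sSup Sx + ι ∈ Sx := fun T => by
      obtain ⟨z, h1, h2⟩ := hcon T
      exact ⟨z, h1, h2.le⟩
    linarith [le_csSup hbd this]
  · obtain ⟨y, hy, hy2⟩ := exists_lt_of_lt_csSup ⟨b, hbm⟩ (show sSup Sx - ι < sSup Sx by linarith)
    obtain ⟨z, h1, h2⟩ := hy T
    exact ⟨z, h1, by linarith⟩

variable {N : ℕ} {Θ : Type*}

theorem hessOp_ex (ψ : E N → ℝ) (hψ : ContDiff ℝ 2 ψ) (x : E N) :
    ∃ T : E N →L[ℝ] E N, (∀ a b, inner ℝ (T a) b = fderiv ℝ (fderiv ℝ ψ) x a b) ∧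
      ∀ a b, inner ℝ (T a) b = inner ℝ a (T b) := by
  set D := fderiv ℝ (fderiv ℝ ψ) x with hD
  let Tl : E N →ₗ[ℝ] E N :=
    { toFun := fun a => (InnerProductSpace.toDual ℝ (E N)).symm (D a)
      map_add' := fun a b => by simp
      map_smul' := fun a b => by simp }
  have h1 : ∀ a b, inner ℝ (Tl a) b = D a b := fun a b => by simp [Tl]
  refine ⟨LinearMap.toContinuousLinearMap Tl, fun a b => h1 a b, fun a b => ?_⟩
  have h2 := h1 a b
  have h3 := h1 b a
  rw [real_inner_comm] at h3
  simp only [LinearMap.coe_toContinuousLinearMap']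
  rw [h2, h3]
  exact (hψ.contDiffAt.isSymmSndFDerivAt (by simp)) a b

theorem taylor2 (ψ : E N → ℝ) (hψ : ContDiff ℝ 2 ψ) (x : E N) (ζ : ℝ) (hζ : 0 < ζ) :
    ∃ r > 0, ∀ y, ‖y - x‖ ≤ r → |ψ y - (ψ x + inner ℝ (gradient ψ x) (y - x)
      + 1/2 * fderiv ℝ (fderiv ℝ ψ) x (y - x) (y - x))| ≤ ζ * ‖y - x‖^2 := by
  have hd : Differentiable ℝ ψ := hψ.differentiable (by norm_num)
  have hd1 : ContDiff ℝ 1 (fderiv ℝ ψ) := hψ.fderiv_right (by norm_num)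
  have hd2 : DifferentiableAt ℝ (fderiv ℝ ψ) x := hd1.differentiable (by norm_num) x
  have hlo := hd2.hasFDerivAt.isLittleO.def hζ
  obtain ⟨r, hr, hball⟩ := Metric.eventually_nhds_iff_ball.1 hlo
  have hsym := hψ.contDiffAt.isSymmSndFDerivAt (x := x) (by simp)
  set D := fderiv ℝ (fderiv ℝ ψ) x with hD
  refine ⟨r/2, by positivity, fun y hy => ?_⟩
  set g : E N → ℝ := fun y => ψ y - (ψ x + fderiv ℝ ψ x (y - x) + 1/2 * D (y - x) (y - x)) with hg
  have hgd : ∀ z, HasFDerivAt g (fderiv ℝ ψ z - fderiv ℝ ψ x - D (z - x)) z := by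
    intro z
    have e1 : HasFDerivAt (fun y : E N => y - x) (ContinuousLinearMap.id ℝ (E N)) z := (hasFDerivAt_id z).sub_const x
    have e2 := (fderiv ℝ ψ x).hasFDerivAt.comp z e1
    have e3 := (D.hasFDerivAt.comp z e1).clm_apply e1
    have e4 := (hd z).hasFDerivAt.sub (((hasFDerivAt_const (ψ x) z).add e2).add (e3.const_mul (1/2)))
    refine e4.congr_fderiv ?_
    ext w
    have := hsym (z - x) w
    simp [← hD] at this ⊢
    linarith
  have hb : ∀ z ∈ Metric.closedBall x ‖y - x‖, ‖fderiv ℝ ψ z - fderiv ℝ ψ x - D (z - x)‖ ≤ ζ * ‖y - x‖ := by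
    intro z hz
    have hz' : ‖z - x‖ ≤ ‖y - x‖ := by simpa [dist_eq_norm] using hz
    have := hball z (by rw [Metric.mem_ball, dist_eq_norm]; linarith)
    exact this.trans (mul_le_mul_of_nonneg_left hz' hζ.le)
  have := (convex_closedBall x ‖y - x‖).norm_image_sub_le_of_norm_hasFDerivWithin_le
    (fun z _ => (hgd z).hasFDerivWithinAt) hb (Metric.mem_closedBall_self (norm_nonneg _))
    (show y ∈ _ by simp [dist_eq_norm])
  have hgx : g x = 0 := by simp [hg]
  rw [hgx, sub_zero, Real.norm_eq_abs] at this
  have hin : inner ℝ (gradient ψ x) (y - x) = fderiv ℝ ψ x (y - x) := by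
    simp [gradient]
  rw [hin]
  refine this.trans (le_of_eq (by ring))

/-- margin of a strict supersolution -/
def mg (sg : Θ → E N → Fin N → E N) (C' : ℝ) (ψ : E N → ℝ) (θ : Θ) (x : E N) : ℝ :=
  - ∑ c, fderiv ℝ (fderiv ℝ ψ) x (sg θ x c) (sg θ x c) - C' * ‖gradient ψ x‖

theorem bil_pert {X : Type*} [NormedAddCommGroup X] [NormedSpace ℝ X] (D D' : X →L[ℝ] X →L[ℝ] ℝ) (a b : X)
    (Cs d : ℝ) (ha : ‖a‖ ≤ Cs) (hb : ‖b‖ ≤ Cs) (hab : ‖a - b‖ ≤ d) :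
    |D a a - D' b b| ≤ ‖D - D'‖ * Cs^2 + 2 * ‖D'‖ * Cs * d := by
  have hCs : 0 ≤ Cs := (norm_nonneg _).trans ha
  have hd : 0 ≤ d := (norm_nonneg _).trans hab
  have e : D a a - D' b b = (D - D') a a + D' (a - b) a + D' b (a - b) := by
    simp
  have h1 : ‖(D - D') a a‖ ≤ ‖D - D'‖ * Cs * Cs :=
    ((D - D').le_opNorm₂ a a).trans (by gcongr)
  have h2 : ‖D' (a - b) a‖ ≤ ‖D'‖ * d * Cs := (D'.le_opNorm₂ _ _).trans (by gcongr)
  have h3 : ‖D' b (a - b)‖ ≤ ‖D'‖ * Cs * d := (D'.le_opNorm₂ _ _).trans (by gcongr)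
  rw [e]
  rw [Real.norm_eq_abs] at h1 h2 h3
  have := abs_add_three ((D - D') a a) (D' (a - b) a) (D' b (a - b))
  linarith

theorem mg_aux {X F X' : Type*} [NormedAddCommGroup X] [NormedAddCommGroup X'] [NormedAddCommGroup F]
    (D : X → F) (hD : Continuous D) (g : X → X') (hg : Continuous g) (n C' Cs : ℝ) (x : X) :
    Tendsto (fun y => n * (‖D y - D x‖ * Cs^2 + 2 * ‖D x‖ * Cs * (Cs * ‖y - x‖)) + C' * (‖g y‖ - ‖g x‖))
      (nhds x) (nhds 0) := by
  have : Continuous (fun y => n * (‖D y - D x‖ * Cs^2 + 2 * ‖D x‖ * Cs * (Cs * ‖y - x‖))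
      + C' * (‖g y‖ - ‖g x‖)) := by fun_prop
  have := this.tendsto x
  simpa using this

theorem mg_lower (sg : Θ → E N → Fin N → E N) (Cs : ℝ) (hCs : 0 ≤ Cs) (hsb : ∀ θ x c, ‖sg θ x c‖ ≤ Cs)
    (hsl : ∀ θ x y c, ‖sg θ x c - sg θ y c‖ ≤ Cs * ‖x - y‖)
    (C' : ℝ) (ψ : E N → ℝ) (hψ : ContDiff ℝ 2 ψ) (x : E N) (α : ℝ) (hα : 0 < α) :
    ∀ᶠ y in nhds x, ∀ θ, mg sg C' ψ θ x - α ≤ mg sg C' ψ θ y := by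
  have hd1 : ContDiff ℝ 1 (fderiv ℝ ψ) := hψ.fderiv_right (by norm_num)
  have hd2 : Continuous (fderiv ℝ (fderiv ℝ ψ)) := hd1.continuous_fderiv (by norm_num)
  have hd3 : Continuous (gradient ψ) := by
    have : Continuous (fderiv ℝ ψ) := hd1.continuous
    exact (InnerProductSpace.toDual ℝ (E N)).symm.continuous.comp this
  have this := mg_aux (fderiv ℝ (fderiv ℝ ψ)) hd2 (gradient ψ) hd3 N C' Cs x
  filter_upwards [this.eventually (gt_mem_nhds hα)] with y hy θ
  have hs : |∑ c, fderiv ℝ (fderiv ℝ ψ) y (sg θ y c) (sg θ y c) - ∑ c, fderiv ℝ (fderiv ℝ ψ) x (sg θ x c) (sg θ x c)|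
      ≤ (N:ℝ) * (‖fderiv ℝ (fderiv ℝ ψ) y - fderiv ℝ (fderiv ℝ ψ) x‖ * Cs^2
      + 2 * ‖fderiv ℝ (fderiv ℝ ψ) x‖ * Cs * (Cs * ‖y - x‖)) := by
    rw [← Finset.sum_sub_distrib]
    refine (Finset.abs_sum_le_sum_abs _ _).trans ?_
    refine (Finset.sum_le_sum fun c _ => bil_pert _ _ _ _ Cs _ (hsb θ y c) (hsb θ x c) (hsl θ y x c)).trans ?_
    rw [Finset.sum_const, Finset.card_univ, Fintype.card_fin, nsmul_eq_mul]
  have := (abs_le.1 hs).2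
  simp only [mg]
  linarith

theorem mg_unif (sg : Θ → E N → Fin N → E N) (Cs : ℝ) (hCs : 0 ≤ Cs) (hsb : ∀ θ x c, ‖sg θ x c‖ ≤ Cs)
    (hsl : ∀ θ x y c, ‖sg θ x c - sg θ y c‖ ≤ Cs * ‖x - y‖)
    (C' : ℝ) (ψ : E N → ℝ) (hψ : ContDiff ℝ 2 ψ) (Q : Set (E N)) (hQ : IsCompact Q)
    (hpos : ∀ x ∈ Q, ∃ m0 > 0, ∀ θ, m0 ≤ mg sg C' ψ θ x) :
    ∃ m0 > 0, ∀ x ∈ Q, ∀ θ, m0 ≤ mg sg C' ψ θ x := by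
  refine hQ.induction_on (p := fun Q => ∃ m0 > 0, ∀ x ∈ Q, ∀ θ, m0 ≤ mg sg C' ψ θ x) ⟨1, one_pos, by simp⟩ ?_ ?_ ?_
  · rintro s t hst ⟨m0, h0, h⟩
    exact ⟨m0, h0, fun x hx => h x (hst hx)⟩
  · rintro s t ⟨m0, h0, h⟩ ⟨m1, h1, h'⟩
    refine ⟨min m0 m1, by positivity, ?_⟩
    rintro x (hx | hx) θ
    · exact (min_le_left _ _).trans (h x hx θ)
    · exact (min_le_right _ _).trans (h' x hx θ)
  · intro x hx
    obtain ⟨m0, h0, h⟩ := hpos x hx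
    refine ⟨_, mem_nhdsWithin_of_mem_nhds (mg_lower sg Cs hCs hsb hsl C' ψ hψ x (m0/2) (by linarith)), m0/2,
      by linarith, fun y hy θ => ?_⟩
    have := hy θ
    linarith [h θ]

end Pre

section StageOne

variable {N : ℕ} {Θ : Type*}

structure PS (sg : Θ → E N → Fin N → E N) (H G : Θ → E N → E N → ℝ) (Cs CR L L2 : ℝ) (u : E N → ℝ → ℝ)
    (V : E N → ℝ) (μ η B C' : ℝ) : Prop where
  D : Dat sg H Cs CR L
  DG : Dat sg G Cs CR L
  R : Reg L u
  j1 : JSub sg H u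
  j2 : JSub sg G (fun x _ => V x)
  j3 : JSup sg H u
  hL2 : 0 ≤ L2
  hL2L : L2 ≤ L
  Vper : ∀ x k, V (x + iv k) = V x
  Vlip : ∀ x y, |V x - V y| ≤ L2 * ‖x - y‖
  bu : ∀ x t, 0 ≤ t → |u x t| ≤ B
  bV : ∀ x, |V x| ≤ B
  huV : ∀ x t, 0 ≤ t → V x ≤ u x t
  hμ : 1 < μ
  hη : 0 < η
  hC' : 0 < C'
  str : ∀ θ x p1 p2 p3, ‖p1‖ ≤ L → ‖p2‖ ≤ L2 → ‖p3‖ ≤ L →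
    -(C' * ‖p1 + (μ - 1) • p2 - μ • p3‖) ≤ H θ x p1 + (μ - 1) * G θ x p2 - μ * H θ x p3

def WW (u : E N → ℝ → ℝ) (V : E N → ℝ) (μ η : ℝ) (x : E N) (t s : ℝ) : ℝ :=
  u x t + (μ - 1) * V x - μ * u x s - μ * η * (s - t)

variable {sg : Θ → E N → Fin N → E N} {H G : Θ → E N → E N → ℝ} {Cs CR L L2 : ℝ} {u : E N → ℝ → ℝ}
    {V : E N → ℝ} {μ η B C' : ℝ}

theorem WW_le (P : PS sg H G Cs CR L L2 u V μ η B C') (x : E N) (t s : ℝ) (ht : 0 ≤ t) (hts : t ≤ s) :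
    WW u V μ η x t s ≤ 2 * μ * B - μ * η * (s - t) := by
  have h1 := (abs_le.1 (P.bu x t ht)).2
  have h2 := (abs_le.1 (P.bu x s (ht.trans hts))).1
  have h3 := (abs_le.1 (P.bV x)).2
  have hμ := P.hμ
  have h4 : (μ - 1) * V x ≤ (μ - 1) * B := mul_le_mul_of_nonneg_left h3 (by linarith)
  have h5 : μ * (-B) ≤ μ * u x s := mul_le_mul_of_nonneg_left h2 (by linarith)
  simp only [WW]
  linarith

theorem PS.hB (P : PS sg H G Cs CR L L2 u V μ η B C') : 0 ≤ B := (abs_nonneg _).trans (P.bV 0)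

theorem WW_pos (P : PS sg H G Cs CR L L2 u V μ η B C') (x : E N) (t s : ℝ) (ht : 0 ≤ t) (hts : t ≤ s)
    (hW : 0 < WW u V μ η x t s) : t < s ∧ s - t < 2 * B / η := by
  have hμ := P.hμ
  have hη := P.hη
  constructor
  · rcases hts.lt_or_eq with h | h
    · exact h
    · subst h
      exfalso
      have := mul_nonneg (show 0 ≤ μ - 1 by linarith) (sub_nonneg.2 (P.huV x t ht))
      simp only [WW, sub_self, mul_zero] at hW
      linarith
  · have := WW_le P x t s ht hts
    rw [lt_div_iff₀ hη]
    have : μ * ((s - t) * η) < μ * (2 * B) := by linarith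
    exact lt_of_mul_lt_mul_left this (by linarith)

theorem WW_lip (P : PS sg H G Cs CR L L2 u V μ η B C') (x y : E N) (t s : ℝ) (ht : 0 ≤ t) (hts : t ≤ s) :
    WW u V μ η x t s ≤ WW u V μ η y t s + 2 * μ * L * ‖x - y‖ := by
  have h1 := (abs_le.1 (P.R.lip t ht x y)).2
  have h2 := (abs_le.1 (P.R.lip s (ht.trans hts) x y)).1
  have h3 := (abs_le.1 (P.Vlip x y)).2
  have hμ := P.hμ
  have h3' : V x - V y ≤ L * ‖x - y‖ := h3.trans (mul_le_mul_of_nonneg_right P.hL2L (norm_nonneg _))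
  have h4 := mul_le_mul_of_nonneg_left h3' (show 0 ≤ μ - 1 by linarith)
  have h5 := mul_le_mul_of_nonneg_left h2 (show 0 ≤ μ by linarith)
  simp only [WW]
  linarith

theorem WW_per (P : PS sg H G Cs CR L L2 u V μ η B C') (x : E N) (k) (t s : ℝ) :
    WW u V μ η (x + iv k) t s = WW u V μ η x t s := by
  simp only [WW, P.R.per, P.Vper]

theorem WW_cont (P : PS sg H G Cs CR L L2 u V μ η B C') :
    ContinuousOn (fun z : E N × ℝ × ℝ => WW u V μ η z.1 z.2.1 (z.2.1 + z.2.2))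
      {z | 0 ≤ z.2.1 ∧ 0 ≤ z.2.2} := by
  have c1 : ContinuousOn (fun z : E N × ℝ × ℝ => u z.1 z.2.1) {z | 0 ≤ z.2.1 ∧ 0 ≤ z.2.2} :=
    P.R.cont.comp (f := fun z : E N × ℝ × ℝ => (z.1, z.2.1)) (by fun_prop)
      (fun z hz => ⟨trivial, hz.1⟩)
  have c2 : ContinuousOn (fun z : E N × ℝ × ℝ => u z.1 (z.2.1 + z.2.2)) {z | 0 ≤ z.2.1 ∧ 0 ≤ z.2.2} :=
    P.R.cont.comp (f := fun z : E N × ℝ × ℝ => (z.1, z.2.1 + z.2.2)) (by fun_prop)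
      (fun z hz => ⟨trivial, add_nonneg hz.1 hz.2⟩)
  have c3 : Continuous V := by
    refine LipschitzWith.continuous (K := ⟨L2, P.hL2⟩) (LipschitzWith.of_dist_le_mul fun x y => ?_)
    rw [Real.dist_eq, dist_eq_norm]; exact P.Vlip x y
  have c4 : Continuous (fun z : E N × ℝ × ℝ => (μ - 1) * V z.1 - μ * η * (z.2.1 + z.2.2 - z.2.1)) := by fun_prop
  refine ((c1.add c4.continuousOn).sub (continuousOn_const (c := μ) |>.mul c2)).congr fun z _ => ?_
  simp only [WW, Pi.add_apply, Pi.sub_apply, Pi.mul_apply]; ring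

theorem st1_num {μ η ε k ρ u1 V1 u3 u1h V1h u3h t s th sh t0 ψ ψh n nh a b nd dd ζ : ℝ}
    (hk : n = nh + 2 * a + nd) (hε : 0 ≤ ε) (hψ : ψ - (ψh + b + 1/2 * dd) ≤ ζ * nd)
    (h : (u1 + (μ - 1) * V1 - μ * u3 - μ * η * (s - t)) - ε * ψ - k * n - ρ * (t - t0)^2 ≤
      (u1h + (μ - 1) * V1h - μ * u3h - μ * η * (sh - th)) - ε * ψh - k * nh - ρ * (th - t0)^2) (hρ : 0 ≤ ρ) :
    1 * u1 + (μ - 1) * V1 - μ * u3 ≤ 1 * u1h + (μ - 1) * V1h - μ * u3h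
      + (ε * b + 2 * k * a) + (-(μ * η) + 2 * ρ * (th - t0)) * (t - th) + (μ * η) * (s - sh)
      + 1/2 * (ε * dd + (2 * ε * ζ + 2 * k) * nd) + ρ * ((t - th)^2 + (s - sh)^2) := by
  have h1 := mul_le_mul_of_nonneg_left hψ hε
  have h2 : 0 ≤ ρ * (s - sh)^2 := by positivity
  subst hk
  linarith

theorem st1_core (P : PS sg H G Cs CR L L2 u V μ η B C') (ψ : E N → ℝ) (hψ : ContDiff ℝ 2 ψ) (ε : ℝ) (hε : 0 < ε)
    (x0 : E N) (t0 s0 r ι S g : ℝ) (hr : 0 < r) (hι : 0 < ι) (ht0 : 2 ≤ t0) (hts : t0 ≤ s0)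
    (h0 : S - ι ≤ WW u V μ η x0 t0 s0 - ε * ψ x0)
    (hup : ∀ x t s, ‖x - x0‖ ≤ r → t0 - 1 ≤ t → t ≤ s → WW u V μ η x t s - ε * ψ x ≤ S + ι)
    (hg : ∀ x, ‖x - x0‖ ≤ r → -(ε * ψ x) ≤ g) (hpos : 0 < S - ι - g) (τ' : ℝ) (hτ' : 0 < τ') :
    ∃ xh th sh, ‖xh - x0‖ < r ∧ |th - t0| < 1 ∧ th ≤ sh ∧ S - ι ≤ WW u V μ η xh th sh - ε * ψ xh ∧
      ∃ θ, ε * mg sg C' ψ θ xh ≤ (6 + 6 / r^2 * (N * Cs^2) + 6 * C' / r) * ι + τ' := by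
  have hμ := P.hμ
  have hη := P.hη
  have hC' := P.hC'
  have hB := P.hB
  set k := 3 * ι / r^2 with hk
  have hk0 : 0 < k := by positivity
  have hkr : k * r^2 = 3 * ι := by rw [hk]; field_simp
  set ρ := 3 * ι with hρ
  have hρ0 : 0 < ρ := by positivity
  set S0 := 2 * B / η with hS0
  have hS00 : 0 ≤ S0 := by positivity
  set Φ : E N × ℝ × ℝ → ℝ := fun z => WW u V μ η z.1 z.2.1 (z.2.1 + z.2.2) - ε * ψ z.1 - k * ‖z.1 - x0‖^2
    - ρ * (z.2.1 - t0)^2 with hΦ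
  have hKc : IsCompact (Metric.closedBall x0 r ×ˢ (Set.Icc (t0 - 1) (t0 + 1) ×ˢ Set.Icc (0:ℝ) (S0 + 1))) :=
    (isCompact_closedBall _ _).prod (isCompact_Icc.prod isCompact_Icc)
  have hΦc : ContinuousOn Φ (Metric.closedBall x0 r ×ˢ (Set.Icc (t0 - 1) (t0 + 1) ×ˢ Set.Icc (0:ℝ) (S0 + 1))) := by
    have c1 := (WW_cont P).mono (t := Metric.closedBall x0 r ×ˢ (Set.Icc (t0 - 1) (t0 + 1) ×ˢ Set.Icc (0:ℝ) (S0 + 1)))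
      (fun z hz => by exact ⟨by have := hz.2.1.1; linarith, hz.2.2.1⟩)
    have c2 := hψ.continuous
    have c3 : Continuous (fun z : E N × ℝ × ℝ => ε * ψ z.1 + k * ‖z.1 - x0‖^2 + ρ * (z.2.1 - t0)^2) := by fun_prop
    refine (c1.sub c3.continuousOn).congr fun z _ => ?_
    simp only [hΦ, Pi.sub_apply]; ring
  have hgpos : 0 < WW u V μ η x0 t0 s0 := by
    have := hg x0 (by simp [hr.le]); linarith
  obtain ⟨hts', hss0⟩ := WW_pos P x0 t0 s0 (by linarith) hts hgpos
  have hmem0 : (x0, t0, s0 - t0) ∈ Metric.closedBall x0 r ×ˢ (Set.Icc (t0 - 1) (t0 + 1) ×ˢ Set.Icc (0:ℝ) (S0 + 1)) :=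
    ⟨by simp [hr.le], ⟨by linarith, by linarith⟩, ⟨by linarith, by linarith⟩⟩
  obtain ⟨⟨xh, th, dh⟩, ⟨hxh, hth, hdh⟩, hmx⟩ := hKc.exists_isMaxOn ⟨_, hmem0⟩ hΦc
  simp only [Metric.mem_closedBall, dist_eq_norm] at hxh hth hdh
  have hmx' : ∀ x t s, ‖x - x0‖ ≤ r → t ∈ Set.Icc (t0 - 1) (t0 + 1) → s - t ∈ Set.Icc 0 (S0 + 1) →
      WW u V μ η x t s - ε * ψ x - k * ‖x - x0‖^2 - ρ * (t - t0)^2 ≤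
      WW u V μ η xh th (th + dh) - ε * ψ xh - k * ‖xh - x0‖^2 - ρ * (th - t0)^2 := by
    intro x t s hx ht hs
    have := hmx (show (x, t, s - t) ∈ _ from ⟨by rwa [Metric.mem_closedBall, dist_eq_norm], ht, hs⟩)
    simpa only [hΦ, Set.mem_setOf_eq, add_sub_cancel] using this
  set sh := th + dh with hsh
  have hval := hmx' x0 t0 s0 (by simp [hr.le]) ⟨by linarith, by linarith⟩ ⟨by linarith, by linarith⟩
  simp only [sub_self, norm_zero, ne_eq, OfNat.ofNat_ne_zero, not_false_eq_true, zero_pow, mul_zero, sub_zero] at hval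
  have hthsh : th ≤ sh := by linarith [hdh.1]
  have hu1 := hup xh th sh hxh hth.1 hthsh
  have n1 : 0 ≤ k * ‖xh - x0‖^2 := by positivity
  have n2 : 0 ≤ ρ * (th - t0)^2 := by positivity
  have hxr : ‖xh - x0‖ < r := by
    have : k * ‖xh - x0‖^2 < k * r^2 := by linarith
    exact lt_of_pow_lt_pow_left₀ 2 hr.le (lt_of_mul_lt_mul_left this hk0.le)
  have htr : |th - t0| < 1 := by
    have : ρ * (th - t0)^2 < ρ * 1 := by linarith
    have := lt_of_mul_lt_mul_left this hρ0.le
    rw [← sq_abs] at this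
    exact lt_of_pow_lt_pow_left₀ 2 (by norm_num) (by simpa using this)
  have hFh : S - ι ≤ WW u V μ η xh th sh - ε * ψ xh := by linarith
  have hWh : 0 < WW u V μ η xh th sh := by have := hg xh hxh; linarith
  obtain ⟨hd1, hd2⟩ := WW_pos P xh th sh (by linarith [hth.1]) hthsh hWh
  refine ⟨xh, th, sh, hxr, htr, hthsh, hFh, ?_⟩
  obtain ⟨ζ, hζ1, hζ⟩ := ((ev_small (2 * ε * (N * Cs^2)) (τ'/2) (by linarith)).and
    self_mem_nhdsWithin).exists
  have hζ : 0 < ζ := hζ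
  obtain ⟨τ, hτ1, hτ⟩ := ((ev_small (1 + C') (τ'/2) (by linarith)).and self_mem_nhdsWithin).exists
  have hτ : 0 < τ := hτ
  obtain ⟨rT, hrT, hTay⟩ := taylor2 ψ hψ xh ζ hζ
  obtain ⟨T, hT1, hT2⟩ := hessOp_ex ψ hψ xh
  have htr' := abs_lt.1 htr
  obtain ⟨r', hr', e1, e2, e3, e4, e5⟩ : ∃ r' > 0, r' ≤ rT ∧ r' ≤ r - ‖xh - x0‖ ∧ r' ≤ 1 - |th - t0| ∧
      r' ≤ (sh - th)/2 ∧ r' ≤ 1/2 := by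
    refine ⟨min rT (min (r - ‖xh - x0‖) (min (1 - |th - t0|) (min ((sh - th)/2) (1/2)))), ?_, ?_⟩
    · have : 0 < r - ‖xh - x0‖ := by linarith
      have : 0 < 1 - |th - t0| := by linarith
      have : 0 < sh - th := by linarith
      positivity
    · simp
  set q := ε • gradient ψ xh + (2 * k) • (xh - x0) with hq
  set So := ε • T + (2 * ε * ζ + 2 * k) • ContinuousLinearMap.id ℝ (E N) with hSo
  have hSi : ∀ a b, inner ℝ (So a) b = ε * inner ℝ (T a) b + (2 * ε * ζ + 2 * k) * inner ℝ a b := by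
    intro a b; simp [hSo, inner_add_left, inner_smul_left]
  obtain ⟨θ, p1, p2, p3, q1, q2, q3, q4, q5⟩ := gl' sg Cs P.D.hCs P.D.hsb P.D.hsl H G CR P.D.hCR L L2
    P.hL2 P.hL2L P.D.hH1 P.DG.hH1 u u V P.j1 P.j2 P.j3 P.R.cont' P.R.cont' P.R.lip P.R.lip P.Vlip
    1 (μ - 1) μ one_pos (by linarith) (by linarith) xh th sh r' hr' (by linarith [hth.1]) (by linarith [hth.1]) q
    (-(μ * η) + 2 * ρ * (th - t0)) (μ * η) ρ So
    (by
      intro a b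
      rw [real_inner_comm (So b) a, hSi, hSi, hT2, real_inner_comm (T b), real_inner_comm b a]) (by
      intro x t s hx ht hs
      have ht' := abs_le.1 ht
      have hs' := abs_le.1 hs
      have hx0 : ‖x - x0‖ ≤ r := by
        have := norm_add_le (x - xh) (xh - x0)
        rw [sub_add_sub_cancel] at this; linarith
      have htt : |t - t0| ≤ 1 := by
        have := abs_add_le (t - th) (th - t0)
        rw [sub_add_sub_cancel] at this; linarith
      have htt' := abs_le.1 htt
      have hm := hmx' x t s hx0 ⟨by linarith, by linarith⟩ ⟨by linarith, by linarith⟩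
      have hn : ‖x - x0‖^2 = ‖xh - x0‖^2 + 2 * inner ℝ (xh - x0) (x - xh) + ‖x - xh‖^2 := by
        rw [← norm_add_sq_real]; congr 2; abel
      have hta := (abs_le.1 (hTay x (hx.trans e1))).2
      have := st1_num hn hε.le hta (by simpa only [WW] using hm) hρ0.le
      rw [hSi, hT1, real_inner_self_eq_norm_sq, hq, inner_add_left, inner_smul_left, inner_smul_left]
      simpa using this) τ hτ
  refine ⟨θ, ?_⟩
  have hst := P.str θ xh p1 p2 p3 q1 q2 q3
  have hqn : ‖q‖ ≤ ε * ‖gradient ψ xh‖ + 2 * k * r := by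
    rw [hq]
    refine (norm_add_le _ _).trans ?_
    rw [norm_smul, norm_smul, Real.norm_of_nonneg hε.le, Real.norm_of_nonneg (by positivity : 0 ≤ 2 * k)]
    gcongr
  have hpn : ‖p1 + (μ - 1) • p2 - μ • p3‖ ≤ τ + (ε * ‖gradient ψ xh‖ + 2 * k * r) := by
    have := norm_add_le ((1:ℝ) • p1 + (μ - 1) • p2 - μ • p3 - q) q
    rw [sub_add_cancel, one_smul] at this
    rw [one_smul] at q4
    linarith
  have hpn' := mul_le_mul_of_nonneg_left hpn hC'.le
  simp only [hSi, hT1, Finset.sum_add_distrib, ← Finset.mul_sum, real_inner_self_eq_norm_sq] at q5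
  have h6 : ∑ c, ‖sg θ xh c‖^2 ≤ N * Cs^2 := by
    calc ∑ c, ‖sg θ xh c‖^2 ≤ ∑ c : Fin N, Cs^2 := Finset.sum_le_sum fun c _ => by gcongr; exact P.D.hsb _ _ _
      _ = _ := by simp
  have h7 : (2 * ε * ζ + 2 * k) * ∑ c, ‖sg θ xh c‖^2 ≤ (2 * ε * ζ + 2 * k) * (N * Cs^2) := by gcongr
  have h8 : -1 * (2 * ρ) ≤ (th - t0) * (2 * ρ) := mul_le_mul_of_nonneg_right htr'.1.le (by positivity)
  have h9 : 2 * k * (N * Cs^2) = 6 / r^2 * (N * Cs^2) * ι := by rw [hk]; ring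
  have h10 : C' * (2 * k * r) = 6 * C' / r * ι := by rw [hk]; field_simp; ring
  simp only [mg]
  clear_value k ρ q So sh S0
  subst hρ
  linarith

end StageOne

section StageOneB

variable {N : ℕ} {Θ : Type*}

def Dg (sg : Θ → E N → Fin N → E N) : Set (E N) := {x | ∀ θ c, sg θ x c = 0}

def SSS (sg : Θ → E N → Fin N → E N) (C' : ℝ) : Prop :=
  ∀ δ > (0:ℝ), ∃ ψ : E N → ℝ, ContDiff ℝ 2 ψ ∧
    ∃ Ω : Set (E N), IsOpen Ω ∧ Bornology.IsBounded Ω ∧ cube N ⊆ Ω ∧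
      (∀ x ∈ Ω, ψ x ≤ 0) ∧ (∀ x ∉ Ω, 0 ≤ ψ x) ∧
      ∀ x ∈ Ω, (∀ y ∈ Dg sg, δ < dist x y) → ∃ m0 > 0, ∀ θ, m0 ≤ mg sg C' ψ θ x

variable {sg : Θ → E N → Fin N → E N} {H G : Θ → E N → E N → ℝ} {Cs CR L L2 : ℝ} {u : E N → ℝ → ℝ}
    {V : E N → ℝ} {μ η B C' : ℝ}

theorem stage1 (P : PS sg H G Cs CR L L2 u V μ η B C') (hS : SSS sg C') (m : ℝ) (hm : 0 < m)
    (ha : ∀ ι > 0, ∃ T, ∀ x t s, T ≤ t → t ≤ s → WW u V μ η x t s ≤ m + ι)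
    (hb : ∀ ι > 0, ∀ T, ∃ x t s, T ≤ t ∧ t ≤ s ∧ m - ι ≤ WW u V μ η x t s)
    (ι0 : ℝ) (hι0 : 0 < ι0) (T0 : ℝ) :
    ∃ y ∈ Dg sg, ∃ t s, T0 ≤ t ∧ t ≤ s ∧ m - ι0 ≤ WW u V μ η y t s := by
  have hμ := P.hμ
  have hB := P.hB
  have hL := P.D.hL
  obtain ⟨δ, hδ1, hδ⟩ := ((ev_small (2 * μ * L * 2) (ι0/3) (by linarith)).and self_mem_nhdsWithin).exists
  have hδ : 0 < δ := hδ
  obtain ⟨ψ, hψ, Ω, hΩo, hΩb, hcube, hψ1, hψ2, hψ3⟩ := hS δ hδ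
  have hcl : IsCompact (closure Ω) := hΩb.isCompact_closure
  have hψc : ∀ x ∈ closure Ω, ψ x ≤ 0 := by
    intro x hx
    exact closure_minimal (s := Ω) (t := {x | ψ x ≤ 0}) hψ1 (isClosed_le hψ.continuous continuous_const) hx
  obtain ⟨Ψ, hΨ⟩ := hcl.exists_bound_of_continuousOn hψ.continuous.continuousOn
  obtain ⟨ε, ⟨hε1, hε2⟩, hε⟩ := (((ev_small Ψ (ι0/3) (by linarith)).and (ev_small Ψ (m/4) (by linarith))).and
    self_mem_nhdsWithin).exists
  have hε : 0 < ε := hε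
  have hεψ : ∀ x ∈ closure Ω, -(ε * ψ x) ≤ Ψ * ε := by
    intro x hx
    have := mul_le_mul_of_nonneg_right (hΨ x hx) hε.le
    rw [Real.norm_eq_abs] at this
    have := mul_le_mul_of_nonneg_right (neg_abs_le (ψ x)) hε.le
    linarith
  have hεψ0 : ∀ x ∈ closure Ω, 0 ≤ -(ε * ψ x) := by
    intro x hx
    have := mul_nonneg hε.le (neg_nonneg.2 (hψc x hx)); linarith
  -- points in the cube
  have hbc : ∀ ι > 0, ∀ T, ∃ x ∈ cube N, ∃ t s, T ≤ t ∧ 0 ≤ t ∧ t ≤ s ∧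
      m - ι ≤ WW u V μ η x t s - ε * ψ x := by
    intro ι hι T
    obtain ⟨x, t, s, h1, h2, h3⟩ := hb ι hι (max T 0)
    obtain ⟨k, hk⟩ := exists_cube x
    refine ⟨_, hk, t, s, (le_max_left _ _).trans h1, (le_max_right _ _).trans h1, h2, ?_⟩
    rw [WW_per P]
    have := hεψ0 _ (subset_closure (hcube hk))
    linarith
  obtain ⟨S, -, hSa, hSb⟩ := limsup_ex
    (α := {z : E N × ℝ × ℝ // z.1 ∈ closure Ω ∧ 0 ≤ z.2.1 ∧ z.2.1 ≤ z.2.2})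
    (fun z => WW u V μ η z.1.1 z.1.2.1 z.1.2.2 - ε * ψ z.1.1) (fun z => z.1.2.1) (2 * μ * B + Ψ * ε) (by
      rintro ⟨⟨x, t, s⟩, hx, ht, hts⟩
      simp only at hx ht hts ⊢
      have h1 := WW_le P x t s ht hts
      have h2 := hεψ x hx
      have h3 : 0 ≤ μ * η * (s - t) := mul_nonneg (mul_nonneg (by linarith) P.hη.le) (by linarith)
      linarith) (m - 1) (by
      intro T
      obtain ⟨x, hx, t, s, h1, h2, h3, h4⟩ := hbc 1 one_pos T
      exact ⟨⟨(x, t, s), subset_closure (hcube hx), h2, h3⟩, h1, h4⟩)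
  have hmS : m ≤ S := by
    refine le_of_forall_pos_le_add fun e he => ?_
    obtain ⟨T, hT⟩ := hSa (e/2) (by linarith)
    obtain ⟨x, hx, t, s, h1, h2, h3, h4⟩ := hbc (e/2) (by linarith) T
    have := hT ⟨(x, t, s), subset_closure (hcube hx), h2, h3⟩ h1
    simp only at this
    linarith
  obtain ⟨Q, hQc, hQΩ, hQ⟩ : ∃ Q, IsCompact Q ∧ Q ⊆ Ω ∧ ∀ ι > 0, ∀ T, ∃ x ∈ Q, ∃ t s, T ≤ t ∧ t ≤ s ∧
      S - ι ≤ WW u V μ η x t s - ε * ψ x := by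
    rcases hmS.eq_or_lt with h | h
    · refine ⟨cube N, cube_compact, hcube, fun ι hι T => ?_⟩
      obtain ⟨x, hx, t, s, h1, h2, h3, h4⟩ := hbc ι hι T
      exact ⟨x, hx, t, s, h1, h3, by rw [← h]; exact h4⟩
    · set g := (S - m) / 4 with hg
      have hg0 : 0 < g := by rw [hg]; linarith
      refine ⟨closure Ω ∩ {x | ε * ψ x ≤ -g}, hcl.inter_right (isClosed_le
        (continuous_const.mul hψ.continuous) continuous_const), ?_, ?_⟩
      · rintro x ⟨_, hx⟩
        by_contra hx'
        have := mul_nonneg hε.le (hψ2 x hx')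
        have hx : ε * ψ x ≤ -g := hx
        linarith
      · intro ι hι T
        obtain ⟨T1, hT1⟩ := ha g hg0
        obtain ⟨⟨⟨x, t, s⟩, hx, ht, hts⟩, h1, h2⟩ := hSb (min ι g) (by positivity) (max T T1)
        simp only at hx ht hts h1 h2
        have h3 := hT1 x t s ((le_max_right _ _).trans h1) hts
        have h4 := min_le_left ι g
        have h5 := min_le_right ι g
        refine ⟨x, ⟨hx, ?_⟩, t, s, (le_max_left _ _).trans h1, hts, by linarith⟩
        show ε * ψ x ≤ -g
        linarith
  obtain ⟨r, hr, hrΩ⟩ := hQc.exists_cthickening_subset_open hΩo hQΩ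
  have hclosed : IsClosed {x : E N | ∀ y ∈ Dg sg, 2 * δ ≤ dist x y} := by
    simp only [Set.setOf_forall]
    exact isClosed_biInter fun y _ => isClosed_le continuous_const (continuous_id.dist continuous_const)
  obtain ⟨m0, hm0, hmg⟩ := mg_unif sg Cs P.D.hCs P.D.hsb P.D.hsl C' ψ hψ
    (Metric.cthickening r Q ∩ {x : E N | ∀ y ∈ Dg sg, 2 * δ ≤ dist x y}) ((hQc.cthickening).inter_right hclosed) (by
      rintro x ⟨hx1, hx2⟩
      exact hψ3 x (hrΩ hx1) fun y hy => by have := hx2 y hy; linarith)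
  have hem : 0 < ε * m0 := by positivity
  obtain ⟨ι, ⟨⟨hι1, hι2⟩, hι3⟩, hι⟩ := ((((ev_small 1 (ι0/3) (by linarith)).and (ev_small 1 (m/4) (by linarith))).and
    (ev_small (6 + 6 / r^2 * (N * Cs^2) + 6 * C' / r) (ε * m0 / 4) (by linarith))).and
    self_mem_nhdsWithin).exists
  have hι : 0 < ι := hι
  obtain ⟨T1, hT1⟩ := hSa ι hι
  obtain ⟨x0, hx0, t0, s0, h1, h2, h3⟩ := hQ ι hι (max (T0 + 1) (max (T1 + 1) 2))
  have ht0a : T0 + 1 ≤ t0 := (le_max_left _ _).trans h1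
  have ht0b : T1 + 1 ≤ t0 := ((le_max_left _ _).trans (le_max_right _ _)).trans h1
  have ht0c : 2 ≤ t0 := ((le_max_right _ _).trans (le_max_right _ _)).trans h1
  have hth : ∀ x, ‖x - x0‖ ≤ r → x ∈ Metric.cthickening r Q := fun x hx =>
    Metric.mem_cthickening_of_dist_le x x0 r Q hx0 (by rwa [dist_eq_norm])
  have hcl' : ∀ x, ‖x - x0‖ ≤ r → x ∈ closure Ω := fun x hx => subset_closure (hrΩ (hth x hx))
  obtain ⟨xh, th, sh, k1, k2, k3, k4, θ, k5⟩ := st1_core P ψ hψ ε hε x0 t0 s0 r ι S (m/4) hr hι ht0c h2 h3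
    (by
      intro x t s hx ht hts
      exact hT1 ⟨(x, t, s), hcl' x hx, by show 0 ≤ t; linarith, hts⟩ (by show T1 ≤ t; linarith))
    (fun x hx => (hεψ x (hcl' x hx)).trans hε2) (by linarith) (ε * m0 / 4) (by linarith)
  have k2' := abs_lt.1 k2
  by_cases hd : ∀ y ∈ Dg sg, 2 * δ ≤ dist xh y
  · exfalso
    have := mul_le_mul_of_nonneg_left (hmg xh ⟨hth xh k1.le, hd⟩ θ) hε.le
    linarith
  · push Not at hd
    obtain ⟨y, hy, hyd⟩ := hd
    refine ⟨y, hy, th, sh, by linarith, k3, ?_⟩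
    have w1 := WW_lip P xh y th sh (by linarith) k3
    rw [dist_eq_norm] at hyd
    have w2 : 2 * μ * L * ‖xh - y‖ ≤ 2 * μ * L * (2 * δ) :=
      mul_le_mul_of_nonneg_left hyd.le (mul_nonneg (by linarith) hL)
    have w3 := hεψ0 xh (hcl' xh k1.le)
    have w4 := hεψ xh (hcl' xh k1.le)
    linarith

end StageOneB

section StageTwo

variable {N : ℕ} {Θ : Type*}

def PH (u : E N → ℝ → ℝ) (V : E N → ℝ) (μ η n K ρ : ℝ) (y0 : E N) (t0 : ℝ) (x z y : E N) (t s : ℝ) : ℝ :=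
  u x t + (μ - 1) * V z - μ * u y s - μ * η * (s - t) - n * (‖x - y‖^2 + ‖z - y‖^2) - K * ‖y - y0‖^2
    - ρ * (t - t0)^2

variable {sg : Θ → E N → Fin N → E N} {H G : Θ → E N → E N → ℝ} {Cs CR L L2 : ℝ} {u : E N → ℝ → ℝ}
    {V : E N → ℝ} {μ η B C' : ℝ}

theorem PH_cont (P : PS sg H G Cs CR L L2 u V μ η B C') (n K ρ : ℝ) (y0 : E N) (t0 : ℝ) :
    ContinuousOn (fun w : E N × E N × E N × ℝ × ℝ =>
      PH u V μ η n K ρ y0 t0 w.1 w.2.1 w.2.2.1 w.2.2.2.1 (w.2.2.2.1 + w.2.2.2.2))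
      {w | 0 ≤ w.2.2.2.1 ∧ 0 ≤ w.2.2.2.2} := by
  have c1 : ContinuousOn (fun w : E N × E N × E N × ℝ × ℝ => u w.1 w.2.2.2.1) {w | 0 ≤ w.2.2.2.1 ∧ 0 ≤ w.2.2.2.2} :=
    P.R.cont.comp (f := fun w : E N × E N × E N × ℝ × ℝ => (w.1, w.2.2.2.1)) (by fun_prop)
      (fun z hz => ⟨trivial, hz.1⟩)
  have c2 : ContinuousOn (fun w : E N × E N × E N × ℝ × ℝ => u w.2.2.1 (w.2.2.2.1 + w.2.2.2.2))
      {w | 0 ≤ w.2.2.2.1 ∧ 0 ≤ w.2.2.2.2} :=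
    P.R.cont.comp (f := fun w : E N × E N × E N × ℝ × ℝ => (w.2.2.1, w.2.2.2.1 + w.2.2.2.2)) (by fun_prop)
      (fun z hz => ⟨trivial, add_nonneg hz.1 hz.2⟩)
  have c3 : Continuous V := by
    refine LipschitzWith.continuous (K := ⟨L2, P.hL2⟩) (LipschitzWith.of_dist_le_mul fun x y => ?_)
    rw [Real.dist_eq, dist_eq_norm]; exact P.Vlip x y
  have c4 : Continuous (fun w : E N × E N × E N × ℝ × ℝ => (μ - 1) * V w.2.1
    - μ * η * (w.2.2.2.1 + w.2.2.2.2 - w.2.2.2.1) - n * (‖w.1 - w.2.2.1‖^2 + ‖w.2.1 - w.2.2.1‖^2)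
    - K * ‖w.2.2.1 - y0‖^2 - ρ * (w.2.2.2.1 - t0)^2) := by fun_prop
  refine ((c1.add c4.continuousOn).sub (continuousOn_const (c := μ) |>.mul c2)).congr fun z _ => ?_
  simp only [PH, Pi.add_apply, Pi.sub_apply, Pi.mul_apply]; ring

theorem small_of_sq {n a b : ℝ} (hn : 0 < n) (ha : 0 ≤ a) (hb : 0 ≤ b) (h : n * a^2 ≤ b * a) : a ≤ b / n := by
  rw [le_div_iff₀ hn]
  rcases ha.eq_or_lt with h0 | h0
  · rw [← h0]; simpa using hb
  · have : a * (a * n) ≤ a * b := by linarith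
    exact le_of_mul_le_mul_left this h0

set_option maxHeartbeats 2000000 in
theorem st2_core (P : PS sg H G Cs CR L L2 u V μ η B C') (m K : ℝ) (hK : 1 ≤ K) (hKC : 2 + μ^2 * L^2 < K)
    (hKm : (2 + μ^2 * L^2) / K^3 < m) (y0 : E N) (t0 s0 : ℝ) (ht0 : 2 ≤ t0) (hts : t0 ≤ s0)
    (h0 : m - 1 / K^3 ≤ WW u V μ η y0 t0 s0)
    (hup : ∀ x t s, t0 - 1 ≤ t → t ≤ s → WW u V μ η x t s ≤ m + 1 / K^3) :
    ∃ xh zh yh th sh, ‖xh - yh‖ ≤ μ * L / K^3 ∧ ‖zh - yh‖ ≤ μ * L / K^3 ∧ K^4 * ‖yh - y0‖^2 ≤ 2 + μ^2 * L^2 ∧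
      |th - t0| < 1 ∧ ∃ r > 0, r ≤ 1/2 ∧ th ≤ sh ∧ ∀ x z y t s, ‖x - xh‖ ≤ r → ‖z - zh‖ ≤ r → ‖y - yh‖ ≤ r →
        |t - th| ≤ r → |s - sh| ≤ r →
        PH u V μ η (K^3) K (2 * (2 + μ^2 * L^2) / K^3) y0 t0 x z y t s ≤
        PH u V μ η (K^3) K (2 * (2 + μ^2 * L^2) / K^3) y0 t0 xh zh yh th sh := by
  have hμ := P.hμ
  have hη := P.hη
  have hB := P.hB
  have hL := P.D.hL
  set C4 := 2 + μ^2 * L^2 with hC4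
  have hC40 : 2 ≤ C4 := by rw [hC4]; linarith only [sq_nonneg (μ * L), mul_pow μ L 2]
  set n := K^3 with hn
  have hn0 : 0 < n := by positivity
  have hnK : K ≤ n := by rw [hn]; exact le_self_pow₀ hK (by norm_num)
  set ρ := 2 * C4 / n with hρ
  have hρ0 : 0 < ρ := by positivity
  have hμL : μ * L ≤ C4 := by rw [hC4]; nlinarith only [sq_nonneg (μ * L - 1)]
  have hμL0 : 0 ≤ μ * L := by positivity
  set S0 := 2 * B / η with hS0
  have hS00 : 0 ≤ S0 := by positivity
  have h1n : 1 / n ≤ C4 / n := by gcongr; linarith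
  have hι0 : 0 < 1 / n := by positivity
  have hsum : 1 / n + 1 / n + μ^2 * L^2 / n = C4 / n := by rw [hC4]; ring
  have hW0 : 0 < WW u V μ η y0 t0 s0 := by linarith
  obtain ⟨hts', hss0⟩ := WW_pos P y0 t0 s0 (by linarith) hts hW0
  set Bl := Metric.closedBall y0 2 with hBl
  set KK := Bl ×ˢ (Bl ×ˢ (Bl ×ˢ (Set.Icc (t0 - 1) (t0 + 1) ×ˢ Set.Icc (0:ℝ) (S0 + 1)))) with hKK
  have hKc : IsCompact KK := (isCompact_closedBall _ _).prod ((isCompact_closedBall _ _).prod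
    ((isCompact_closedBall _ _).prod (isCompact_Icc.prod isCompact_Icc)))
  have hΦc := (PH_cont P n K ρ y0 t0).mono (t := KK)
    (fun z hz => by exact ⟨by have := hz.2.2.2.1.1; linarith, hz.2.2.2.2.1⟩)
  have hy0B : y0 ∈ Bl := by simp [hBl]
  have hmem0 : (y0, y0, y0, t0, s0 - t0) ∈ KK :=
    ⟨hy0B, hy0B, hy0B, ⟨by linarith, by linarith⟩, ⟨by linarith, by linarith⟩⟩
  obtain ⟨⟨xh, zh, yh, th, dh⟩, ⟨hxh, hzh, hyh, hth, hdh⟩, hmx⟩ := hKc.exists_isMaxOn ⟨_, hmem0⟩ hΦc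
  simp only at hxh hzh hyh hth hdh
  set sh := th + dh with hsh
  have hmx' : ∀ x z y t s, x ∈ Bl → z ∈ Bl → y ∈ Bl → t ∈ Set.Icc (t0 - 1) (t0 + 1) → s - t ∈ Set.Icc 0 (S0 + 1) →
      PH u V μ η n K ρ y0 t0 x z y t s ≤ PH u V μ η n K ρ y0 t0 xh zh yh th sh := by
    intro x z y t s hx hz hy ht hs
    have := hmx (show (x, z, y, t, s - t) ∈ KK from ⟨hx, hz, hy, ht, hs⟩)
    simpa only [Set.mem_setOf_eq, add_sub_cancel] using this
  have hthsh : th ≤ sh := by linarith [hdh.1]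
  have hdh' : sh - th ∈ Set.Icc 0 (S0 + 1) := by rw [hsh, add_sub_cancel_left]; exact hdh
  have hth0 : 0 ≤ th := by linarith [hth.1]
  -- x - y
  have lx := (abs_le.1 (P.R.lip th hth0 xh yh)).2
  have lz := (abs_le.1 (P.Vlip zh yh)).2
  have lz' : (μ - 1) * (V zh - V yh) ≤ (μ - 1) * (L * ‖zh - yh‖) :=
    mul_le_mul_of_nonneg_left (lz.trans (mul_le_mul_of_nonneg_right P.hL2L (norm_nonneg _))) (by linarith)
  have hxy : ‖xh - yh‖ ≤ L / n := by
    have := hmx' yh zh yh th sh hyh hzh hyh hth hdh'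
    simp only [PH, sub_self, norm_zero] at this
    refine small_of_sq hn0 (norm_nonneg _) hL ?_
    linarith
  have hzy : ‖zh - yh‖ ≤ (μ - 1) * L / n := by
    have := hmx' xh yh yh th sh hxh hyh hyh hth hdh'
    simp only [PH, sub_self, norm_zero] at this
    refine small_of_sq hn0 (norm_nonneg _) (mul_nonneg (by linarith) hL) ?_
    linarith
  have hxy' : ‖xh - yh‖ ≤ μ * L / n := hxy.trans (by gcongr; exact le_mul_of_one_le_left hL hμ.le)
  have hzy' : ‖zh - yh‖ ≤ μ * L / n := hzy.trans (by gcongr; linarith only)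
  have hval := hmx' y0 y0 y0 t0 s0 hy0B hy0B hy0B ⟨by linarith, by linarith⟩ ⟨by linarith, by linarith⟩
  have hWy := hup yh th sh hth.1 hthsh
  have hxyL : L * ‖xh - yh‖ ≤ L * (L / n) := mul_le_mul_of_nonneg_left hxy hL
  have hzyL : (μ - 1) * (L * ‖zh - yh‖) ≤ (μ - 1) * (L * ((μ - 1) * L / n)) :=
    mul_le_mul_of_nonneg_left (mul_le_mul_of_nonneg_left hzy hL) (by linarith)
  have hC2 : L * (L / n) + (μ - 1) * (L * ((μ - 1) * L / n)) ≤ μ^2 * L^2 / n := by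
    rw [show L * (L / n) + (μ - 1) * (L * ((μ - 1) * L / n)) = (1 + (μ - 1)^2) * L^2 / n by ring]
    gcongr
    linarith only [hμ]
  have n1 : 0 ≤ n * (‖xh - yh‖^2 + ‖zh - yh‖^2) := by positivity
  have n2 : 0 ≤ K * ‖yh - y0‖^2 := by positivity
  have n3 : 0 ≤ ρ * (th - t0)^2 := by positivity
  have hmain : m - 1/n + n * (‖xh - yh‖^2 + ‖zh - yh‖^2) + K * ‖yh - y0‖^2 + ρ * (th - t0)^2 ≤
      WW u V μ η yh th sh + μ^2 * L^2 / n := by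
    simp only [PH, sub_self, norm_zero] at hval
    simp only [WW] at h0 ⊢
    linarith
  have hyb : K * ‖yh - y0‖^2 ≤ C4 / n := by linarith
  have htb : ρ * (th - t0)^2 ≤ C4 / n := by linarith
  have hWh : 0 < WW u V μ η yh th sh := by linarith
  obtain ⟨hd1, hd2⟩ := WW_pos P yh th sh hth0 hthsh hWh
  have htr : |th - t0| < 1 := by
    have : (C4 / n) * (2 * (th - t0)^2) ≤ (C4 / n) * 1 := by
      rw [hρ] at htb; linarith [htb, show 2 * C4 / n * (th - t0)^2 = (C4 / n) * (2 * (th - t0)^2) by ring]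
    have := le_of_mul_le_mul_left this (by positivity)
    rw [← sq_abs] at this
    nlinarith only [this, abs_nonneg (th - t0)]
  have hyK : K^4 * ‖yh - y0‖^2 ≤ C4 := by
    have := mul_le_mul_of_nonneg_right hyb hn0.le
    rw [div_mul_cancel₀ _ hn0.ne'] at this
    calc K^4 * ‖yh - y0‖^2 = K * ‖yh - y0‖^2 * n := by rw [hn]; ring
      _ ≤ C4 := this
  have hy1 : ‖yh - y0‖ < 1 := by
    have h4 : K ≤ K^4 := le_self_pow₀ hK (by norm_num)
    have : K^4 * ‖yh - y0‖^2 < K^4 * 1 := by linarith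
    have := lt_of_mul_lt_mul_left this (by positivity)
    exact lt_of_pow_lt_pow_left₀ 2 (by norm_num) (by simpa using this)
  have hsm : μ * L / n < 1 := by rw [div_lt_one hn0]; linarith
  have hx1 : ‖xh - y0‖ < 2 := by
    have := norm_add_le (xh - yh) (yh - y0)
    rw [sub_add_sub_cancel] at this; linarith
  have hz1 : ‖zh - y0‖ < 2 := by
    have := norm_add_le (zh - yh) (yh - y0)
    rw [sub_add_sub_cancel] at this; linarith
  obtain ⟨r, hr, e1, e2, e3, e4, e5, e6⟩ : ∃ r > 0, r ≤ 2 - ‖xh - y0‖ ∧ r ≤ 2 - ‖zh - y0‖ ∧ r ≤ 2 - ‖yh - y0‖ ∧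
      r ≤ 1 - |th - t0| ∧ r ≤ (sh - th)/2 ∧ r ≤ 1/2 := by
    refine ⟨min (2 - ‖xh - y0‖) (min (2 - ‖zh - y0‖) (min (2 - ‖yh - y0‖) (min (1 - |th - t0|)
      (min ((sh - th)/2) (1/2))))), ?_, ?_⟩
    · have : 0 < 2 - ‖xh - y0‖ := by linarith
      have : 0 < 2 - ‖zh - y0‖ := by linarith
      have : 0 < 2 - ‖yh - y0‖ := by linarith
      have : 0 < 1 - |th - t0| := by linarith
      have : 0 < sh - th := by linarith
      positivity
    · simp
  refine ⟨xh, zh, yh, th, sh, hxy', hzy', hyK, htr, r, hr, e6, hthsh, ?_⟩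
  intro x z y t s hx hz hy ht hs
  have hball : ∀ a b : E N, ‖a - b‖ ≤ r → r ≤ 2 - ‖b - y0‖ → a ∈ Bl := by
    intro a b h1 h2
    rw [hBl, Metric.mem_closedBall, dist_eq_norm]
    have := norm_add_le (a - b) (b - y0)
    rw [sub_add_sub_cancel] at this; linarith
  have htt : |t - t0| ≤ 1 := by
    have := abs_add_le (t - th) (th - t0)
    rw [sub_add_sub_cancel] at this; linarith
  have htt' := abs_le.1 htt
  have ht' := abs_le.1 ht
  have hs' := abs_le.1 hs
  exact hmx' x z y t s (hball x xh hx e1) (hball z zh hz e2) (hball y yh hy e3) ⟨by linarith, by linarith⟩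
    ⟨by linarith, by linarith⟩

end StageTwo

section StageTwoB

variable {N : ℕ} {Θ : Type*}

theorem jet_of_quad (f : E N → ℝ → ℝ) (xh : E N) (th : ℝ) (q : E N) (a k r : ℝ) (hr : 0 < r)
    (h : ∀ x t, ‖x - xh‖ ≤ r → |t - th| ≤ r →
      f x t ≤ f xh th + inner ℝ q (x - xh) + a * (t - th) + k * (‖x - xh‖^2 + (t - th)^2)) :
    SupJet (fun z : ST (E N) => f z.fst z.snd) (stp xh th) (stp q a) ((2 * k) • ContinuousLinearMap.id ℝ (ST (E N))) := by
  refine ⟨fun a b => ?_, fun ε hε => ?_⟩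
  · simp only [smul_apply, ContinuousLinearMap.id_apply, inner_smul_left, inner_smul_right, conj_trivial]
  · have : ∀ᶠ h in nhds (0 : ST (E N)), ‖h‖ < r := by
      have := Metric.ball_mem_nhds (0 : ST (E N)) hr
      filter_upwards [this] with x hx
      simpa using hx
    filter_upwards [this] with w hw
    have h1 := (st_fst_le w).trans hw.le
    have h2 := (st_snd_le w).trans hw.le
    have := h (xh + w.fst) (th + w.snd) (by simpa using h1) (by simpa using h2)
    simp only [WithLp.add_fst, WithLp.add_snd, WithLp.toLp_fst, WithLp.toLp_snd]
    simp only [add_sub_cancel_left] at this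
    rw [st_inner]
    simp only [smul_apply, ContinuousLinearMap.id_apply, inner_smul_left, conj_trivial, WithLp.toLp_fst, WithLp.toLp_snd]
    have e : inner ℝ w w = ‖w.fst‖^2 + w.snd^2 := by
      rw [st_inner, real_inner_self_eq_norm_sq]; ring
    rw [e]
    have : 0 ≤ ε * ‖w‖^2 := by positivity
    linarith

theorem jsub_quad (sg : Θ → E N → Fin N → E N) (H : Θ → E N → E N → ℝ) (f : E N → ℝ → ℝ) (hf : JSub sg H f)
    (xh : E N) (th : ℝ) (hth : 0 < th) (q : E N) (a k r : ℝ) (hr : 0 < r)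
    (h : ∀ x t, ‖x - xh‖ ≤ r → |t - th| ≤ r →
      f x t ≤ f xh th + inner ℝ q (x - xh) + a * (t - th) + k * (‖x - xh‖^2 + (t - th)^2)) (θ : Θ) :
    a - 2 * k * ∑ c, ‖sg θ xh c‖^2 + H θ xh q ≤ 0 := by
  have := hf (stp xh th) (stp q a) _ hth (jet_of_quad f xh th q a k r hr h) θ
  simp only [smul_apply, ContinuousLinearMap.id_apply, inner_smul_left, conj_trivial, WithLp.toLp_fst, WithLp.toLp_snd, st_inner, real_inner_self_eq_norm_sq] at this
  rw [Finset.mul_sum]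
  simpa using this

theorem jsup_quad (sg : Θ → E N → Fin N → E N) (H : Θ → E N → E N → ℝ) (f : E N → ℝ → ℝ) (hf : JSup sg H f)
    (xh : E N) (th : ℝ) (hth : 0 < th) (q : E N) (a k r : ℝ) (hr : 0 < r)
    (h : ∀ x t, ‖x - xh‖ ≤ r → |t - th| ≤ r →
      - f x t ≤ - f xh th + inner ℝ q (x - xh) + a * (t - th) + k * (‖x - xh‖^2 + (t - th)^2)) (ε : ℝ) (hε : 0 < ε) :
    ∃ θ, -ε ≤ - a + 2 * k * ∑ c, ‖sg θ xh c‖^2 + H θ xh (-q) := by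
  obtain ⟨θ, this⟩ := hf (stp xh th) (stp q a) _ hth (jet_of_quad (fun x t => - f x t) xh th q a k r hr h) ε hε
  refine ⟨θ, ?_⟩
  simp only [smul_apply, ContinuousLinearMap.id_apply, inner_smul_left, conj_trivial, WithLp.toLp_fst, WithLp.toLp_snd, st_inner, real_inner_self_eq_norm_sq] at this
  rw [Finset.mul_sum]
  simpa using this

theorem lip_quad (f : E N → ℝ → ℝ) (L : ℝ) (hL : 0 ≤ L)
    (xh : E N) (th : ℝ) (hl : ∀ x, |f x th - f xh th| ≤ L * ‖x - xh‖) (q : E N) (a k r : ℝ) (hr : 0 < r)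
    (h : ∀ x t, ‖x - xh‖ ≤ r → |t - th| ≤ r →
      f x t ≤ f xh th + inner ℝ q (x - xh) + a * (t - th) + k * (‖x - xh‖^2 + (t - th)^2)) : ‖q‖ ≤ L := by
  refine supjet_lip (jet_of_quad f xh th q a k r hr h) L (Eventually.of_forall fun w => ?_) hL
  simp only [WithLp.add_fst, WithLp.add_snd, WithLp.toLp_fst, WithLp.toLp_snd, add_zero]
  have := abs_le.1 (hl (xh + w))
  rw [add_sub_cancel_left] at this
  linarith [this.1]

theorem sq_exp (a b : E N) (n : ℝ) : n * ‖a + b‖^2 = n * ‖a‖^2 + inner ℝ ((2 * n) • a) b + n * ‖b‖^2 := by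
  rw [norm_add_sq_real, inner_smul_left]; simp only [conj_trivial]; ring

theorem sg_small {sg : Θ → E N → Fin N → E N} {H : Θ → E N → E N → ℝ} {Cs CR L : ℝ} (D : Dat sg H Cs CR L) (x y : E N)
    (hy : y ∈ Dg sg) (θ : Θ) : ∑ c, ‖sg θ x c‖^2 ≤ N * (Cs * ‖x - y‖)^2 := by
  have : ∀ c ∈ Finset.univ, ‖sg θ x c‖^2 ≤ (Cs * ‖x - y‖)^2 := fun c _ => by
    have := D.hsl θ x y c
    rw [hy θ c, sub_zero] at this
    gcongr
  have := Finset.sum_le_sum this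
  simpa using this

theorem sg_nonneg (sg : Θ → E N → Fin N → E N) (x : E N) (θ : Θ) : 0 ≤ ∑ c, ‖sg θ x c‖^2 :=
  Finset.sum_nonneg fun c _ => by positivity

variable {sg : Θ → E N → Fin N → E N} {H G : Θ → E N → E N → ℝ} {Cs CR L L2 : ℝ} {u : E N → ℝ → ℝ}
    {V : E N → ℝ} {μ η B C' : ℝ}

/-- jets from a local max of `PH` -/
theorem st2_jets (P : PS sg H G Cs CR L L2 u V μ η B C') (n K ρ : ℝ) (hn : 0 ≤ n) (hρ : 0 ≤ ρ) (hK : 0 ≤ K) (y0 : E N) (t0 : ℝ)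
    (xh zh yh : E N) (th sh : ℝ) (hth : 0 < th) (hsh : 0 < sh) (r : ℝ) (hr : 0 < r)
    (h : ∀ x z y t s, ‖x - xh‖ ≤ r → ‖z - zh‖ ≤ r → ‖y - yh‖ ≤ r →
        |t - th| ≤ r → |s - sh| ≤ r → PH u V μ η n K ρ y0 t0 x z y t s ≤ PH u V μ η n K ρ y0 t0 xh zh yh th sh) :
    ∃ p1 p2 p3 : E N, ‖p1‖ ≤ L ∧ ‖p2‖ ≤ L2 ∧ ‖p3‖ ≤ L ∧
      ‖p1 + (μ - 1) • p2 - μ • p3‖ ≤ 2 * K * ‖yh - y0‖ ∧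
      (∀ θ, - μ * η + 2 * ρ * (th - t0) - 2 * (n + ρ) * ∑ c, ‖sg θ xh c‖^2 + H θ xh p1 ≤ 0) ∧
      (∀ θ, - 2 * (n / (μ - 1)) * ∑ c, ‖sg θ zh c‖^2 + G θ zh p2 ≤ 0) ∧
      (∀ ε > 0, ∃ θ, - ε ≤ - η + 2 * ((2 * n + K) / μ) * ∑ c, ‖sg θ yh c‖^2 + H θ yh p3) := by
  have hμ := P.hμ
  have hμ1 : 0 < μ - 1 := by linarith
  have hμ0 : 0 < μ := by linarith
  have n0 : ∀ x : E N, ‖x - x‖ ≤ r := fun x => by simpa using hr.le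
  have n0' : ∀ x : ℝ, |x - x| ≤ r := fun x => by simpa using hr.le
  have q1 : ∀ x t, ‖x - xh‖ ≤ r → |t - th| ≤ r →
      u x t ≤ u xh th + inner ℝ ((2 * n) • (xh - yh)) (x - xh) + (- μ * η + 2 * ρ * (th - t0)) * (t - th)
        + (n + ρ) * (‖x - xh‖^2 + (t - th)^2) := by
    intro x t hx ht
    have := h x zh yh t sh hx (n0 _) (n0 _) ht (n0' _)
    have e := sq_exp (xh - yh) (x - xh) n
    rw [show xh - yh + (x - xh) = x - yh by abel] at e
    simp only [PH] at this
    have i1 : 0 ≤ ρ * ‖x - xh‖^2 := by positivity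
    have i2 : 0 ≤ n * (t - th)^2 := by positivity
    nlinarith
  have q2 : ∀ x (t : ℝ), ‖x - zh‖ ≤ r → |t - 1| ≤ r →
      (fun x _ => V x : E N → ℝ → ℝ) x t ≤ (fun x _ => V x : E N → ℝ → ℝ) zh 1
        + inner ℝ ((2 * (n / (μ - 1))) • (zh - yh)) (x - zh) + 0 * (t - 1)
        + (n / (μ - 1)) * (‖x - zh‖^2 + (t - 1)^2) := by
    intro x t hx ht
    have := h xh x yh th sh (n0 _) hx (n0 _) (n0' _) (n0' _)
    have e := sq_exp (zh - yh) (x - zh) (n / (μ - 1))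
    rw [show zh - yh + (x - zh) = x - yh by abel] at e
    simp only [PH] at this
    have i1 : 0 ≤ (n / (μ - 1)) * (t - 1)^2 := by positivity
    have i2 : (μ - 1) * V x - (μ - 1) * V zh ≤ n * ‖x - yh‖^2 - n * ‖zh - yh‖^2 := by linarith
    have i3 : V x - V zh ≤ (n / (μ - 1)) * ‖x - yh‖^2 - (n / (μ - 1)) * ‖zh - yh‖^2 := by
      rw [div_mul_eq_mul_div, div_mul_eq_mul_div, ← sub_div, le_div_iff₀ hμ1]; linarith
    show V x ≤ V zh + _ + _ + _
    linarith
  have q3 : ∀ x t, ‖x - yh‖ ≤ r → |t - sh| ≤ r →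
      - u x t ≤ - u yh sh + inner ℝ ((1 / μ) • ((2 * n) • (yh - xh) + (2 * n) • (yh - zh) + (2 * K) • (yh - y0))) (x - yh)
        + η * (t - sh) + ((2 * n + K) / μ) * (‖x - yh‖^2 + (t - sh)^2) := by
    intro x t hx ht
    have := h xh zh x th t (n0 _) (n0 _) hx (n0' _) ht
    have e1 := sq_exp (yh - xh) (x - yh) n
    have e2 := sq_exp (yh - zh) (x - yh) n
    have e3 := sq_exp (yh - y0) (x - yh) K
    rw [show yh - xh + (x - yh) = x - xh by abel] at e1
    rw [show yh - zh + (x - yh) = x - zh by abel] at e2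
    rw [show yh - y0 + (x - yh) = x - y0 by abel] at e3
    rw [inner_smul_left, inner_add_left, inner_add_left]
    simp only [conj_trivial]
    simp only [PH, norm_sub_rev xh, norm_sub_rev zh] at this
    set I := inner ℝ ((2 * n) • (yh - xh)) (x - yh) + inner ℝ ((2 * n) • (yh - zh)) (x - yh) + inner ℝ ((2 * K) • (yh - y0)) (x - yh) with hI
    have i1 : 0 ≤ ((2 * n + K) / μ) * (t - sh)^2 := by positivity
    have i2 : - u x t + u yh sh ≤ (I + (2 * n + K) * ‖x - yh‖^2 + μ * η * (t - sh)) / μ := by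
      rw [le_div_iff₀ hμ0]; linarith
    have i3 : (I + (2 * n + K) * ‖x - yh‖^2 + μ * η * (t - sh)) / μ = 1 / μ * I + (2 * n + K) / μ * ‖x - yh‖^2 + η * (t - sh) := by
      field_simp
    linarith
  refine ⟨(2 * n) • (xh - yh), (2 * (n / (μ - 1))) • (zh - yh),
    - ((1 / μ) • ((2 * n) • (yh - xh) + (2 * n) • (yh - zh) + (2 * K) • (yh - y0))), ?_, ?_, ?_, ?_, ?_, ?_, ?_⟩
  rotate_left 4
  · exact fun θ => jsub_quad sg H u P.j1 xh th hth _ _ _ r hr q1 θ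
  · intro θ
    have := jsub_quad sg G _ P.j2 zh 1 one_pos _ _ _ r hr q2 θ
    linarith
  · exact fun ε hε => jsup_quad sg H u P.j3 yh sh hsh _ _ _ r hr q3 ε hε
  · exact lip_quad u L P.D.hL xh th (fun x => P.R.lip _ hth.le _ _) _ _ _ r hr q1
  · exact lip_quad _ L2 P.hL2 zh 1 (fun x => P.Vlip _ _) _ _ _ r hr q2
  · rw [norm_neg]
    refine lip_quad (fun x t => - u x t) L P.D.hL yh sh (fun x => ?_) _ _ _ r hr q3
    have := P.R.lip _ hsh.le yh x
    rw [norm_sub_rev x]; convert this using 2; ring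
  · apply le_of_eq
    have : (2 * n) • (xh - yh) + (μ - 1) • (2 * (n / (μ - 1))) • (zh - yh) - μ • - ((1 / μ) • ((2 * n) • (yh - xh) + (2 * n) • (yh - zh) + (2 * K) • (yh - y0)))
      = (2 * K) • (yh - y0) := by
      rw [smul_neg, smul_smul, smul_smul, show (μ - 1) * (2 * (n / (μ - 1))) = 2 * n by field_simp, mul_one_div_cancel hμ0.ne', one_smul]
      module
    rw [this, norm_smul, Real.norm_of_nonneg (by positivity)]

end StageTwoB

section StageTwoC

variable {N : ℕ} {Θ : Type*}

theorem tr_num {k a K S n Cs d C4 : ℝ} (hK : 1 ≤ K) (hk : k ≤ a * K^3) (ha : 0 ≤ a) (hS0 : 0 ≤ S) (hn : 0 ≤ n) (hCs : 0 ≤ Cs)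
    (hd0 : 0 ≤ d) (hS : S ≤ n * (Cs * d)^2) (hd : d ≤ 2 * C4 / K^2) : 2 * k * S ≤ 8 * a * n * Cs^2 * C4^2 / K := by
  have hK0 : 0 < K := by linarith
  have h1 : (Cs * d)^2 ≤ (Cs * (2 * C4 / K^2))^2 := by gcongr
  calc 2 * k * S ≤ 2 * (a * K^3) * S := by gcongr
    _ ≤ 2 * (a * K^3) * (n * (Cs * (2 * C4 / K^2))^2) := by
        apply mul_le_mul_of_nonneg_left _ (by positivity)
        exact hS.trans (mul_le_mul_of_nonneg_left h1 hn)
    _ = _ := by field_simp; ring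

variable {sg : Θ → E N → Fin N → E N} {H G : Θ → E N → E N → ℝ} {Cs CR L L2 : ℝ} {u : E N → ℝ → ℝ}
    {V : E N → ℝ} {μ η B C' : ℝ}

set_option maxHeartbeats 1000000 in
theorem st2_lim (P : PS sg H G Cs CR L L2 u V μ η B C') (hS : SSS sg C') (m : ℝ) (hm : 0 < m)
    (ha : ∀ ι > 0, ∃ T, ∀ x t s, T ≤ t → t ≤ s → WW u V μ η x t s ≤ m + ι)
    (hb : ∀ ι > 0, ∀ T, ∃ x t s, T ≤ t ∧ t ≤ s ∧ m - ι ≤ WW u V μ η x t s) (κ : ℝ) (hκ : 0 < κ) :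
    ∃ y0 ∈ Dg sg, ∃ p1 p2 p3 : E N, ‖p1‖ ≤ L ∧ ‖p2‖ ≤ L2 ∧ ‖p3‖ ≤ L ∧
      ‖p1 + (μ - 1) • p2 - μ • p3‖ ≤ κ ∧ (∀ θ, - μ * η + H θ y0 p1 ≤ κ) ∧ (∀ θ, G θ y0 p2 ≤ κ) ∧
      (∃ θ, η - κ ≤ H θ y0 p3) := by
  have hμ := P.hμ
  have hμ1 : 0 < μ - 1 := by linarith
  have hμ0 : 0 < μ := by linarith
  have hL := P.D.hL
  have hCs := P.D.hCs
  have hCR := P.D.hCR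
  obtain ⟨C4, hC4⟩ : ∃ C4, C4 = 2 + μ^2 * L^2 := ⟨_, rfl⟩
  have hC40 : 2 ≤ C4 := by rw [hC4]; nlinarith [sq_nonneg (μ * L)]
  have hμL : μ * L ≤ C4 := by rw [hC4]; nlinarith [sq_nonneg (μ * L - 1)]
  obtain ⟨A0, hA0⟩ : ∃ A0, A0 = 24 * N * Cs^2 * C4^2 + 8 * (1 / (μ - 1)) * N * Cs^2 * C4^2 + 2 * CR * C4 + 4 * C4 := ⟨_, rfl⟩
  have b1 : 0 ≤ 24 * N * Cs^2 * C4^2 := by positivity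
  have b2 : 0 ≤ 8 * (1 / (μ - 1)) * N * Cs^2 * C4^2 := by positivity
  have b3 : 0 ≤ 2 * CR * C4 := by positivity
  have hA00 : 0 ≤ A0 := by linarith
  obtain ⟨K, hK⟩ : ∃ K, K = 2 + C4 + C4 / m + 2 * A0 / κ := ⟨_, rfl⟩
  have hc4m : 0 ≤ C4 / m := by positivity
  have hak : 0 ≤ 2 * A0 / κ := by positivity
  have hK1 : 1 ≤ K := by linarith
  have hK0 : 0 < K := by linarith
  have hK13 : K ≤ K^3 := le_self_pow₀ hK1 (by norm_num)
  have hKC : C4 < K := by linarith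
  have hKm : C4 / K^3 < m := by
    rw [div_lt_iff₀ (by positivity)]
    have : C4 / m < K := by linarith
    rw [div_lt_iff₀ hm] at this
    nlinarith only [this, hm, hK13]
  have hAK : A0 / K ≤ κ / 2 := by
    rw [div_le_iff₀ hK0]
    have : 2 * A0 / κ ≤ K := by linarith
    rw [div_le_iff₀ hκ] at this
    linarith
  obtain ⟨T, hT⟩ := ha (1 / K^3) (by positivity)
  obtain ⟨y0, hy0, t0, s0, ht0, hts, h0⟩ := stage1 P hS m hm ha hb (1 / K^3) (by positivity) (max 2 (T + 1))
  have ht02 : 2 ≤ t0 := (le_max_left _ _).trans ht0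
  have ht0T : T + 1 ≤ t0 := (le_max_right _ _).trans ht0
  obtain ⟨xh, zh, yh, th, sh, hxy, hzy, hy, hth, r, hr, hr2, hths, hmax⟩ := st2_core P m K hK1 (by rw [← hC4]; exact hKC)
    (by rw [← hC4]; exact hKm) y0 t0 s0 ht02 hts h0 (fun x t s h1 h2 => hT x t s (by linarith) h2)
  rw [← hC4] at hy hmax
  have hthp : 0 < th := by have := (abs_lt.1 hth).1; linarith
  obtain ⟨ρ, hρ⟩ : ∃ ρ, ρ = 2 * C4 / K^3 := ⟨_, rfl⟩
  rw [← hρ] at hmax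
  have hρ0 : 0 ≤ ρ := by rw [hρ]; positivity
  obtain ⟨p1, p2, p3, hp1, hp2, hp3, hpp, j1, j2, j3⟩ := st2_jets P (K^3) K ρ (by positivity) hρ0 hK0.le y0 t0 xh zh yh th sh
    hthp (by linarith) r hr hmax
  have dy : ‖yh - y0‖ ≤ C4 / K^2 := by
    rw [le_div_iff₀ (by positivity)]
    apply le_of_sq_le_sq _ (by linarith) |>.trans le_rfl
    nlinarith only [hy, hC40]
  have hd1 : μ * L / K^3 ≤ C4 / K^2 := by
    apply div_le_div₀ (by linarith) hμL (by positivity)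
    exact pow_le_pow_right₀ hK1 (by norm_num)
  have e2 : 2 * C4 / K^2 = C4 / K^2 + C4 / K^2 := by ring
  have dx : ‖xh - y0‖ ≤ 2 * C4 / K^2 := by
    have := norm_add_le (xh - yh) (yh - y0)
    rw [sub_add_sub_cancel] at this
    linarith
  have dz : ‖zh - y0‖ ≤ 2 * C4 / K^2 := by
    have := norm_add_le (zh - yh) (yh - y0)
    rw [sub_add_sub_cancel] at this
    linarith
  have dy' : ‖yh - y0‖ ≤ 2 * C4 / K^2 := by
    have : 0 ≤ C4 / K^2 := by positivity
    linarith
  have hdK : 2 * C4 / K^2 ≤ 2 * C4 / K := div_le_div_of_nonneg_left (by linarith) hK0 (le_self_pow₀ hK1 (by norm_num))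
  have hρK : ρ ≤ 2 * C4 / K := by
    rw [hρ]; exact div_le_div_of_nonneg_left (by linarith) hK0 hK13
  have hρ1 : ρ ≤ 2 * K^3 := by
    have : ρ ≤ 2 := by rw [hρ, div_le_iff₀ (by positivity)]; linarith
    linarith
  -- H differences
  have hHd : ∀ θ x p, ‖p‖ ≤ L → ‖x - y0‖ ≤ 2 * C4 / K^2 → |H θ x p - H θ y0 p| ≤ 2 * CR * C4 / K := by
    intro θ x p hp hx
    have := P.D.hH θ x y0 p p hp hp
    rw [sub_self, norm_zero, add_zero] at this
    refine this.trans ?_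
    calc CR * ‖x - y0‖ ≤ CR * (2 * C4 / K) := by gcongr; linarith
      _ = _ := by ring
  have hGd : ∀ θ x p, ‖p‖ ≤ L → ‖x - y0‖ ≤ 2 * C4 / K^2 → |G θ x p - G θ y0 p| ≤ 2 * CR * C4 / K := by
    intro θ x p hp hx
    have := P.DG.hH θ x y0 p p hp hp
    rw [sub_self, norm_zero, add_zero] at this
    refine this.trans ?_
    calc CR * ‖x - y0‖ ≤ CR * (2 * C4 / K) := by gcongr; linarith
      _ = _ := by ring
  have eA : A0 / K = 24 * N * Cs^2 * C4^2 / K + 8 * (1 / (μ - 1)) * N * Cs^2 * C4^2 / K + 2 * CR * C4 / K + 4 * C4 / K := by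
    rw [hA0]; ring
  have b1' : 0 ≤ 24 * N * Cs^2 * C4^2 / K := by positivity
  have b2' : 0 ≤ 8 * (1 / (μ - 1)) * N * Cs^2 * C4^2 / K := by positivity
  have b3' : 0 ≤ 2 * CR * C4 / K := by positivity
  have b4' : 0 ≤ 4 * C4 / K := by positivity
  have b4 : 4 * C4 / K = 2 * (2 * C4 / K) := by ring
  refine ⟨y0, hy0, p1, p2, p3, hp1, hp2, hp3, ?_, ?_, ?_, ?_⟩
  · have : 2 * K * ‖yh - y0‖ ≤ 2 * C4 / K := by
      calc 2 * K * ‖yh - y0‖ ≤ 2 * K * (C4 / K^2) := by gcongr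
        _ = _ := by field_simp
    linarith only [this, hpp, b1', b2', b3', b4', b4, eA, hAK, hκ]
  · intro θ
    have h1 := j1 θ
    have h2 := tr_num (a := 3) hK1 (show K^3 + ρ ≤ 3 * K^3 by linarith) (by norm_num) (sg_nonneg sg xh θ) (by positivity) hCs (norm_nonneg _) (sg_small P.D xh y0 hy0 θ) dx
    have h3 := (abs_le.1 (hHd θ xh p1 hp1 dx)).1
    have h4 : -(2 * ρ) ≤ 2 * ρ * (th - t0) := by
      have := (abs_lt.1 hth).1
      nlinarith only [this, hρ0]
    have e3 : 8 * 3 * (N:ℝ) * Cs^2 * C4^2 / K = 24 * N * Cs^2 * C4^2 / K := by ring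
    linarith only [h1, h2, h3, h4, e3, hρK, b1', b2', b3', b4', b4, eA, hAK, hκ]
  · intro θ
    have h1 := j2 θ
    have h2 := tr_num (a := 1 / (μ - 1)) hK1 (show K^3 / (μ - 1) ≤ 1 / (μ - 1) * K^3 by apply le_of_eq; ring) (by positivity) (sg_nonneg sg zh θ) (by positivity) hCs (norm_nonneg _) (sg_small P.D zh y0 hy0 θ) dz
    have h3 := (abs_le.1 (hGd θ zh p2 (hp2.trans P.hL2L) dz)).1
    linarith only [h1, h2, h3, b1', b2', b3', b4', b4, eA, hAK, hκ]
  · obtain ⟨θ, h1⟩ := j3 (κ / 2) (by linarith)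
    refine ⟨θ, ?_⟩
    have h2 := tr_num (a := 3) hK1 (show (2 * K^3 + K) / μ ≤ 3 * K^3 by
      rw [div_le_iff₀ hμ0]; nlinarith only [hK13, hμ, hK0]) (by norm_num) (sg_nonneg sg yh θ) (by positivity) hCs (norm_nonneg _) (sg_small P.D yh y0 hy0 θ) dy'
    have h3 := (abs_le.1 (hHd θ yh p3 hp3 dy')).2
    have e3 : 8 * 3 * (N:ℝ) * Cs^2 * C4^2 / K = 24 * N * Cs^2 * C4^2 / K := by ring
    linarith only [h1, h2, h3, e3, b1', b2', b3', b4', b4, eA, hAK, hκ]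

/-- compactness -/
theorem st2_cpt (P : PS sg H G Cs CR L L2 u V μ η B C') (hS : SSS sg C') (hsp : ∀ θ x c k, sg θ (x + iv k) c = sg θ x c)
    (hHp : ∀ θ x p k, H θ (x + iv k) p = H θ x p) (hGp : ∀ θ x p k, G θ (x + iv k) p = G θ x p) (m : ℝ) (hm : 0 < m)
    (ha : ∀ ι > 0, ∃ T, ∀ x t s, T ≤ t → t ≤ s → WW u V μ η x t s ≤ m + ι)
    (hb : ∀ ι > 0, ∀ T, ∃ x t s, T ≤ t ∧ t ≤ s ∧ m - ι ≤ WW u V μ η x t s) :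
    ∃ y0 ∈ Dg sg, ∃ p1 p2 p3 : E N, ‖p1‖ ≤ L ∧ ‖p2‖ ≤ L2 ∧ ‖p3‖ ≤ L ∧
      p1 + (μ - 1) • p2 = μ • p3 ∧ (∀ θ, H θ y0 p1 ≤ μ * η) ∧ (∀ θ, G θ y0 p2 ≤ 0) ∧
      (∀ κ > 0, ∃ θ, η - κ ≤ H θ y0 p3) := by
  have hCR := P.D.hCR
  have key : ∀ i : ℕ, ∃ w : E N × E N × E N × E N, (w.1 ∈ cube N ∧ w.2.1 ∈ Metric.closedBall 0 L ∧ w.2.2.1 ∈ Metric.closedBall 0 L2 ∧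
      w.2.2.2 ∈ Metric.closedBall 0 L) ∧ w.1 ∈ Dg sg ∧
      ‖w.2.1 + (μ - 1) • w.2.2.1 - μ • w.2.2.2‖ ≤ 1 / ((i:ℝ) + 1) ∧ (∀ θ, - μ * η + H θ w.1 w.2.1 ≤ 1 / ((i:ℝ) + 1)) ∧
      (∀ θ, G θ w.1 w.2.2.1 ≤ 1 / ((i:ℝ) + 1)) ∧ (∃ θ, η - 1 / ((i:ℝ) + 1) ≤ H θ w.1 w.2.2.2) := by
    intro i
    obtain ⟨y0, hy0, p1, p2, p3, h1, h2, h3, h4, h5, h6, h7⟩ := st2_lim P hS m hm ha hb (1 / ((i:ℝ) + 1)) (by positivity)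
    obtain ⟨k, hk⟩ := exists_cube y0
    refine ⟨(y0 + iv k, p1, p2, p3), ⟨hk, by simpa using h1, by simpa using h2, by simpa using h3⟩, ?_, h4, ?_, ?_, ?_⟩
    · intro θ c; simp only [hsp]; exact hy0 θ c
    · simpa only [hHp] using h5
    · simpa only [hGp] using h6
    · simpa only [hHp] using h7
  choose w hw using key
  have hcpt : IsCompact (cube N ×ˢ (Metric.closedBall (0 : E N) L ×ˢ (Metric.closedBall (0 : E N) L2 ×ˢ Metric.closedBall (0 : E N) L))) :=
    (cube_compact).prod ((isCompact_closedBall _ _).prod ((isCompact_closedBall _ _).prod (isCompact_closedBall _ _)))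
  obtain ⟨w0, hw0, φ, hφ, hlim⟩ := hcpt.tendsto_subseq (x := w) (fun i => by
    obtain ⟨⟨a, b, c, d⟩, _⟩ := hw i
    exact ⟨a, b, c, d⟩)
  obtain ⟨y, p1, p2, p3⟩ := w0
  obtain ⟨hy, hp1, hp2, hp3⟩ := hw0
  simp only [mem_closedBall_zero_iff] at hp1 hp2 hp3
  have hsm : ∀ κ > 0, ∃ i : ℕ, 1 / ((φ i : ℝ) + 1) ≤ κ ∧ ‖(w (φ i)).1 - y‖ ≤ κ ∧ ‖(w (φ i)).2.1 - p1‖ ≤ κ ∧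
      ‖(w (φ i)).2.2.1 - p2‖ ≤ κ ∧ ‖(w (φ i)).2.2.2 - p3‖ ≤ κ := by
    intro κ hκ
    have e1 := (tendsto_one_div_add_atTop_nhds_zero_nat (𝕜 := ℝ)).comp hφ.tendsto_atTop
    have e1' := e1.eventually (Iic_mem_nhds hκ)
    have e2 := hlim.eventually (Metric.closedBall_mem_nhds _ hκ)
    obtain ⟨i, h1, h2⟩ := (e1'.and e2).exists
    refine ⟨i, h1, ?_⟩
    have h2 : dist (w (φ i)) (y, p1, p2, p3) ≤ κ := h2
    simp only [Prod.dist_eq, max_le_iff] at h2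
    simpa only [dist_eq_norm] using h2
  have hn : ∀ i, ‖(w i).2.1‖ ≤ L ∧ ‖(w i).2.2.1‖ ≤ L2 ∧ ‖(w i).2.2.2‖ ≤ L := fun i => by
    have := (hw i).1; simpa using this.2
  have hμ := P.hμ
  refine ⟨y, ?_, p1, p2, p3, hp1, hp2, hp3, ?_, ?_, ?_, ?_⟩
  · intro θ c
    rw [← norm_le_zero_iff]
    apply le_of_forall_pos_le_add
    intro ε hε
    obtain ⟨κ, hκ, hκ0⟩ := ((ev_small Cs ε hε).and self_mem_nhdsWithin).exists
    obtain ⟨i, h1, h2, h3, h4, h5⟩ := hsm κ hκ0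
    have := P.D.hsl θ (w (φ i)).1 y c
    rw [(hw (φ i)).2.1 θ c, zero_sub, norm_neg] at this
    have := mul_le_mul_of_nonneg_left h2 P.D.hCs
    linarith
  · rw [← sub_eq_zero, ← norm_le_zero_iff]
    apply le_of_forall_pos_le_add
    intro ε hε
    obtain ⟨κ, hκ, hκ0⟩ := ((ev_small (1 + 1 + (μ - 1) + μ) ε hε).and self_mem_nhdsWithin).exists
    obtain ⟨i, h1, h2, h3, h4, h5⟩ := hsm κ hκ0
    have e : p1 + (μ - 1) • p2 - μ • p3 = ((w (φ i)).2.1 + (μ - 1) • (w (φ i)).2.2.1 - μ • (w (φ i)).2.2.2)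
       - (((w (φ i)).2.1 - p1) + (μ - 1) • ((w (φ i)).2.2.1 - p2) - μ • ((w (φ i)).2.2.2 - p3)) := by module
    rw [e]
    have n1 := (hw (φ i)).2.2.1
    have n2 := norm_sub_le ((w (φ i)).2.1 + (μ - 1) • (w (φ i)).2.2.1 - μ • (w (φ i)).2.2.2)
      (((w (φ i)).2.1 - p1) + (μ - 1) • ((w (φ i)).2.2.1 - p2) - μ • ((w (φ i)).2.2.2 - p3))
    have n3 := norm_sub_le (((w (φ i)).2.1 - p1) + (μ - 1) • ((w (φ i)).2.2.1 - p2)) (μ • ((w (φ i)).2.2.2 - p3))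
    have n4 := norm_add_le ((w (φ i)).2.1 - p1) ((μ - 1) • ((w (φ i)).2.2.1 - p2))
    rw [norm_smul, Real.norm_of_nonneg (by linarith)] at n3 n4
    have n5 := mul_le_mul_of_nonneg_left h4 (show 0 ≤ μ - 1 by linarith)
    have n6 := mul_le_mul_of_nonneg_left h5 (show 0 ≤ μ by linarith)
    linarith
  · intro θ
    apply le_of_forall_pos_le_add
    intro ε hε
    obtain ⟨κ, hκ, hκ0⟩ := ((ev_small (1 + 2 * CR) ε hε).and self_mem_nhdsWithin).exists
    obtain ⟨i, h1, h2, h3, h4, h5⟩ := hsm κ hκ0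
    have n1 := (hw (φ i)).2.2.2.1 θ
    have n2 := (abs_le.1 (P.D.hH θ (w (φ i)).1 y (w (φ i)).2.1 p1 (hn _).1 hp1)).1
    have n3 : CR * (‖(w (φ i)).1 - y‖ + ‖(w (φ i)).2.1 - p1‖) ≤ CR * (κ + κ) := by gcongr
    linarith
  · intro θ
    apply le_of_forall_pos_le_add
    intro ε hε
    obtain ⟨κ, hκ, hκ0⟩ := ((ev_small (1 + 2 * CR) ε hε).and self_mem_nhdsWithin).exists
    obtain ⟨i, h1, h2, h3, h4, h5⟩ := hsm κ hκ0
    have n1 := (hw (φ i)).2.2.2.2.1 θ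
    have n2 := (abs_le.1 (P.DG.hH θ (w (φ i)).1 y (w (φ i)).2.2.1 p2 ((hn _).2.1.trans P.hL2L) (hp2.trans P.hL2L))).1
    have n3 : CR * (‖(w (φ i)).1 - y‖ + ‖(w (φ i)).2.2.1 - p2‖) ≤ CR * (κ + κ) := by gcongr
    linarith
  · intro ε hε
    obtain ⟨κ, hκ, hκ0⟩ := ((ev_small (1 + 2 * CR) ε hε).and self_mem_nhdsWithin).exists
    obtain ⟨i, h1, h2, h3, h4, h5⟩ := hsm κ hκ0
    obtain ⟨θ, n1⟩ := (hw (φ i)).2.2.2.2.2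
    refine ⟨θ, ?_⟩
    have n2 := (abs_le.1 (P.D.hH θ (w (φ i)).1 y (w (φ i)).2.2.2 p3 (hn _).2.2 hp3)).2
    have n3 : CR * (‖(w (φ i)).1 - y‖ + ‖(w (φ i)).2.2.2 - p3‖) ≤ CR * (κ + κ) := by gcongr
    linarith

/-- the half-relaxed conclusion: WW is asymptotically nonpositive -/
theorem WW_asym (P : PS sg H G Cs CR L L2 u V μ η B C') (hS : SSS sg C') (hsp : ∀ θ x c k, sg θ (x + iv k) c = sg θ x c)
    (hHp : ∀ θ x p k, H θ (x + iv k) p = H θ x p) (hGp : ∀ θ x p k, G θ (x + iv k) p = G θ x p)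
    (hno : ¬ ∃ y0 ∈ Dg sg, ∃ p1 p2 p3 : E N, ‖p1‖ ≤ L ∧ ‖p2‖ ≤ L2 ∧ ‖p3‖ ≤ L ∧
      p1 + (μ - 1) • p2 = μ • p3 ∧ (∀ θ, H θ y0 p1 ≤ μ * η) ∧ (∀ θ, G θ y0 p2 ≤ 0) ∧
      (∀ κ > 0, ∃ θ, η - κ ≤ H θ y0 p3)) (ι : ℝ) (hι : 0 < ι) :
    ∃ T, ∀ x t s, T ≤ t → t ≤ s → WW u V μ η x t s ≤ ι := by
  by_contra hcon
  push Not at hcon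
  have hB : ∀ z : {z : E N × ℝ × ℝ // 0 ≤ z.2.1 ∧ z.2.1 ≤ z.2.2}, WW u V μ η z.1.1 z.1.2.1 z.1.2.2 ≤ B + (μ - 1) * B + μ * B := by
    intro z
    have h1 := abs_le.1 (P.bu z.1.1 z.1.2.1 z.2.1)
    have h2 := abs_le.1 (P.bu z.1.1 z.1.2.2 (z.2.1.trans z.2.2))
    have h3 := abs_le.1 (P.bV z.1.1)
    have hμ := P.hμ
    have hη := P.hη
    simp only [WW]
    have i1 : 0 ≤ μ * η * (z.1.2.2 - z.1.2.1) := by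
      have := z.2.2; have : 0 ≤ z.1.2.2 - z.1.2.1 := by linarith
      positivity
    nlinarith
  obtain ⟨m, hm, h1, h2⟩ := limsup_ex (fun z : {z : E N × ℝ × ℝ // 0 ≤ z.2.1 ∧ z.2.1 ≤ z.2.2} => WW u V μ η z.1.1 z.1.2.1 z.1.2.2)
    (fun z => z.1.2.1) _ hB ι (fun T => by
      obtain ⟨x, t, s, h1, h2, h3⟩ := hcon (max T 0)
      exact ⟨⟨(x, t, s), (le_max_right _ _).trans h1, h2⟩, (le_max_left _ _).trans h1, h3.le⟩)
  refine hno (st2_cpt P hS hsp hHp hGp m (by linarith) ?_ ?_)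
  · intro ι hι
    obtain ⟨T, hT⟩ := h1 ι hι
    exact ⟨max T 0, fun x t s ht hs => hT ⟨(x, t, s), (le_max_right _ _).trans ht, hs⟩ ((le_max_left _ _).trans ht)⟩
  · intro ι hι T
    obtain ⟨z, hz⟩ := h2 ι hι T
    exact ⟨_, _, _, hz.1, z.2.2, hz.2⟩

end StageTwoC

section Conv

variable {N : ℕ} {Θ : Type*}

theorem norm_le_of_coord (v : E N) (b : ℝ) (hb : 0 ≤ b) (h : ∀ i, |v i| ≤ b) : ‖v‖ ≤ N * b := by
  apply le_of_sq_le_sq _ (by positivity) |>.trans le_rfl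
  rw [EuclideanSpace.norm_sq_eq]
  calc ∑ i, ‖v i‖^2 ≤ ∑ _i : Fin N, b^2 := Finset.sum_le_sum fun i _ => by
        rw [Real.norm_eq_abs]; have := h i; gcongr
    _ = N * b^2 := by simp
    _ ≤ (N * b)^2 := by
        rw [mul_pow]; gcongr
        have : N ≤ N^2 := Nat.le_self_pow (by norm_num) N
        exact_mod_cast this

theorem cols_bd (σm : Θ → E N → Matrix (Fin N) (Fin N) ℝ) (C : ℝ) (hC : 0 < C)
    (hσbd : ∀ (θ : Θ) (x : E N) (i j : Fin N), |σm θ x i j| ≤ C) (θ : Θ) (x : E N) (c : Fin N) :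
    ‖cols σm θ x c‖ ≤ N * C := norm_le_of_coord _ C hC.le fun i => hσbd θ x i c

theorem cols_lip (σm : Θ → E N → Matrix (Fin N) (Fin N) ℝ) (C : ℝ) (hC : 0 < C)
    (hσlip : ∀ (θ : Θ) (i j : Fin N), LipschitzWith C.toNNReal fun x : E N => σm θ x i j)
    (θ : Θ) (x y : E N) (c : Fin N) : ‖cols σm θ x c - cols σm θ y c‖ ≤ N * C * ‖x - y‖ := by
  rw [mul_assoc]
  refine norm_le_of_coord _ _ (by positivity) fun i => ?_
  have := (hσlip θ i c).dist_le_mul x y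
  rw [Real.dist_eq, dist_eq_norm, Real.coe_toNNReal _ hC.le] at this
  exact this

theorem Dg_cols (σm A : Θ → E N → Matrix (Fin N) (Fin N) ℝ)
    (hA : ∀ (θ : Θ) (x : E N), A θ x = σm θ x * (σm θ x)ᵀ) : Dg (cols σm) = degenSet A := by
  ext x
  constructor
  · intro h θ
    have : σm θ x = 0 := by
      ext i c
      have := congrArg (fun v : E N => v i) (h θ c)
      simpa [cols] using this
    rw [hA, this, zero_mul]
  · intro h θ c
    have h1 := h θ
    rw [hA] at h1
    have h2 : σm θ x = 0 := by
      rw [← Matrix.self_mul_conjTranspose_eq_zero, Matrix.conjTranspose_eq_transpose_of_trivial]; exact h1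
    ext i
    simp [cols, h2]

theorem sss_cols (σm A : Θ → E N → Matrix (Fin N) (Fin N) ℝ)
    (hA : ∀ (θ : Θ) (x : E N), A θ x = σm θ x * (σm θ x)ᵀ) (C' : ℝ) (hC' : 0 < C') (h : SurSolStricte A C') :
    SSS (cols σm) C' := by
  intro δ hδ
  obtain ⟨ψ, hψ, Ω, h1, h2, h3, h4, h5, h6⟩ := h δ hδ
  refine ⟨ψ, hψ, Ω, h1, h2, h3, h4, h5, fun x hx hd => ?_⟩
  rw [Dg_cols σm A hA] at hd
  have h7 := h6 x hx hd
  refine ⟨_, h7, fun θ => ?_⟩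
  have hbb : BddBelow (Set.range fun θ => -Matrix.trace (A θ x * hessMatrix ψ x)) := by
    by_contra hb
    rw [Real.iInf_of_not_bddBelow hb] at h7
    have : 0 ≤ C' * ‖gradient ψ x‖ := by positivity
    linarith
  have h8 := ciInf_le hbb θ
  have hd2 : DifferentiableAt ℝ (fderiv ℝ ψ) x :=
    ((hψ.fderiv_right (m := 1) (by norm_num)).differentiable (by norm_num)) x
  have h9 := trace_cols (σm θ x) ψ x hd2
  rw [← hA] at h9
  simp only [mg]
  have h10 : ∑ c, fderiv ℝ (fderiv ℝ ψ) x (cols σm θ x c) (cols σm θ x c) = Matrix.trace (A θ x * hessMatrix ψ x) := h9.symm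
  rw [h10]
  linarith

theorem jsub_addk {X J : Type*} [NormedAddCommGroup X] [InnerProductSpace ℝ X] [FiniteDimensional ℝ X] [Fintype J]
    (sg : Θ → X → J → X) (H : Θ → X → X → ℝ) (f : X → ℝ → ℝ) (hf : JSub sg H f) (k : ℝ) :
    JSub sg H (fun x t => f x t - k) := by
  intro z p Y hz hj θ
  refine hf z p Y hz ⟨hj.1, fun ε hε => ?_⟩ θ
  filter_upwards [hj.2 ε hε] with h hh
  linarith

theorem out_of_compact (K : Set (E N)) (hK : IsCompact K) (y p : E N) (hp : p ≠ 0) : ∃ k, y + iv k ∉ K := by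
  obtain ⟨i, hi⟩ : ∃ i, p i ≠ 0 := by
    by_contra h
    push Not at h
    exact hp (by ext i; simpa using h i)
  obtain ⟨R, hR⟩ := hK.isBounded.exists_norm_le
  obtain ⟨n, hn⟩ := exists_int_gt (R + |y i|)
  refine ⟨fun _ => n, fun hm => ?_⟩
  have h1 := hR _ hm
  have h2 := PiLp.norm_apply_le (y + iv (fun _ => n)) i
  have h3 : (y + iv (fun _ => n) : E N) i = y i + n := by simp [iv]
  rw [h3, Real.norm_eq_abs] at h2
  have h4 := le_abs_self (y i + n)
  have h5 := neg_abs_le (y i)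
  linarith

theorem str_cvx (H : Θ → E N → E N → ℝ) (c CR L L2 μ : ℝ) (hμ : 1 < μ) (hL2 : L2 ≤ L) (hCR : 0 ≤ CR)
    (hc : ∀ (θ : Θ) (x : E N), ConvexOn ℝ Set.univ (H θ x))
    (hH : ∀ θ x y p q, ‖p‖ ≤ L → ‖q‖ ≤ L → |H θ x p - H θ y q| ≤ CR * (‖x - y‖ + ‖p - q‖))
    (θ : Θ) (x p1 p2 p3 : E N) (h1 : ‖p1‖ ≤ L) (h2 : ‖p2‖ ≤ L2) (h3 : ‖p3‖ ≤ L) :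
    -(CR * ‖p1 + (μ - 1) • p2 - μ • p3‖) ≤ (H θ x p1 - c) + (μ - 1) * (H θ x p2 - c) - μ * (H θ x p3 - c) := by
  have hμ0 : 0 < μ := by linarith
  have ha : 0 ≤ 1 / μ := by positivity
  have hb : 0 ≤ (μ - 1) / μ := div_nonneg (by linarith) hμ0.le
  have hab : 1 / μ + (μ - 1) / μ = 1 := by field_simp; ring
  have e1 := (hc θ x).2 (Set.mem_univ p1) (Set.mem_univ p2) ha hb hab
  obtain ⟨q, hq⟩ : ∃ q, q = (1 / μ) • p1 + ((μ - 1) / μ) • p2 := ⟨_, rfl⟩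
  rw [← hq] at e1
  have hqn : ‖q‖ ≤ L := by
    rw [hq]
    refine (norm_add_le _ _).trans ?_
    rw [norm_smul, norm_smul, Real.norm_of_nonneg ha, Real.norm_of_nonneg hb]
    calc _ ≤ 1 / μ * L + (μ - 1) / μ * L := by gcongr; linarith
      _ = L := by rw [← add_mul, hab, one_mul]
  have e2 := hH θ x x q p3 hqn h3
  rw [sub_self, norm_zero, zero_add] at e2
  have e3 := (abs_le.1 e2).1
  have e4 : p1 + (μ - 1) • p2 - μ • p3 = μ • (q - p3) := by
    rw [hq, smul_sub, smul_add, smul_smul, smul_smul, mul_one_div_cancel hμ0.ne', one_smul, mul_div_cancel₀ _ hμ0.ne']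
  rw [e4, norm_smul, Real.norm_of_nonneg hμ0.le]
  simp only [smul_eq_mul] at e1
  have e5 : μ * H θ x q ≤ H θ x p1 + (μ - 1) * H θ x p2 := by
    have := mul_le_mul_of_nonneg_left e1 hμ0.le
    have e6 : μ * (1 / μ * H θ x p1 + (μ - 1) / μ * H θ x p2) = H θ x p1 + (μ - 1) * H θ x p2 := by field_simp
    linarith
  have e7 := mul_le_mul_of_nonneg_left e3 hμ0.le
  linarith

theorem no_cvx (H : Θ → E N → E N → ℝ) (c L L2 μ η : ℝ) (hμ : 1 < μ) (hη : 0 < η) (S : Set (E N))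
    (hc : ∀ (θ : Θ) (x : E N), ConvexOn ℝ Set.univ (H θ x))
    (hs : ∀ x ∈ S, ∀ lam : ℝ, 0 < lam → lam < 1 → ∀ p q : E N, p ≠ q →
          0 < ⨅ θ, (lam * H θ x p + (1 - lam) * H θ x q - H θ x (lam • p + (1 - lam) • q))) :
    ¬ ∃ y0 ∈ S, ∃ p1 p2 p3 : E N, ‖p1‖ ≤ L ∧ ‖p2‖ ≤ L2 ∧ ‖p3‖ ≤ L ∧
      p1 + (μ - 1) • p2 = μ • p3 ∧ (∀ θ, H θ y0 p1 - c ≤ μ * η) ∧ (∀ θ, H θ y0 p2 - c ≤ 0) ∧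
      (∀ κ > 0, ∃ θ, η - κ ≤ H θ y0 p3 - c) := by
  rintro ⟨y, hy, p1, p2, p3, -, -, -, he, h1, h2, h3⟩
  have hμ0 : 0 < μ := by linarith
  have hl0 : 0 < 1 / μ := by positivity
  have hl1 : 1 / μ < 1 := by rw [div_lt_one hμ0]; exact hμ
  have hp3 : (1 / μ) • p1 + (1 - 1 / μ) • p2 = p3 := by
    have : p3 = (1 / μ) • (μ • p3) := by rw [smul_smul, one_div_mul_cancel hμ0.ne', one_smul]
    rw [this, ← he, smul_add, smul_smul]
    congr 2; field_simp
  by_cases hp : p1 = p2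
  · subst hp
    have : p3 = p1 := by rw [← hp3, ← add_smul]; simp
    rw [this] at h3
    obtain ⟨θ, h4⟩ := h3 (η / 2) (by linarith)
    have := h2 θ
    linarith
  · have h4 := hs y hy (1 / μ) hl0 hl1 p1 p2 hp
    rw [hp3] at h4
    obtain ⟨g, hg⟩ : ∃ g, g = ⨅ θ, (1 / μ * H θ y p1 + (1 - 1 / μ) * H θ y p2 - H θ y p3) := ⟨_, rfl⟩
    rw [← hg] at h4
    obtain ⟨θ, h5⟩ := h3 (g / 2) (by linarith)
    have h6 : g ≤ 1 / μ * H θ y p1 + (1 - 1 / μ) * H θ y p2 - H θ y p3 := by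
      rw [hg]
      refine ciInf_le ⟨0, ?_⟩ θ
      rintro _ ⟨θ', rfl⟩
      have := (hc θ' y).2 (Set.mem_univ p1) (Set.mem_univ p2) hl0.le (show 0 ≤ 1 - 1 / μ by linarith) (by ring)
      rw [hp3] at this
      simp only [smul_eq_mul] at this
      simp only
      linarith
    have h7 := mul_le_mul_of_nonneg_left (h1 θ) hl0.le
    rw [← mul_assoc, one_div_mul_cancel hμ0.ne', one_mul] at h7
    have h8 := mul_le_mul_of_nonneg_left (h2 θ) (show 0 ≤ 1 - 1 / μ by linarith)
    linarith

theorem str_H10 (H : Θ → E N → E N → ℝ) (c CR L μ : ℝ) (hμ : 1 < μ) (hμ2 : μ < 2) (hL : 0 ≤ L)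
    (hi : ∀ (θ : Θ) (x p : E N), (1 - μ) * c ≤ H θ x (μ • p) - μ * H θ x p)
    (hH : ∀ θ x y p q, ‖p‖ ≤ 2 * L → ‖q‖ ≤ 2 * L → |H θ x p - H θ y q| ≤ CR * (‖x - y‖ + ‖p - q‖))
    (θ : Θ) (x p1 p2 p3 : E N) (h1 : ‖p1‖ ≤ L) (h2 : ‖p2‖ ≤ 0) (h3 : ‖p3‖ ≤ L) :
    -(CR * ‖p1 + (μ - 1) • p2 - μ • p3‖) ≤ (H θ x p1 - c) + (μ - 1) * 0 - μ * (H θ x p3 - c) := by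
  have hp2 : p2 = 0 := norm_le_zero_iff.1 h2
  subst hp2
  rw [smul_zero, add_zero]
  have e := hH θ x x p1 (μ • p3) (by linarith) (by
    rw [norm_smul, Real.norm_of_nonneg (by linarith)]
    have := norm_nonneg p3
    nlinarith)
  rw [sub_self, norm_zero, zero_add] at e
  have e2 := (abs_le.1 e).1
  have e3 := hi θ x p3
  linarith

theorem no_H10 (H : Θ → E N → E N → ℝ) (c L μ η : ℝ) (hμ : 1 < μ) (hη : 0 < η) (S K : Set (E N)) (hK : IsCompact K)
    (hSp : ∀ x ∈ S, ∀ k, x + iv k ∈ S) (hHp : ∀ θ x p k, H θ (x + iv k) p = H θ x p)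
    (hi : ∀ (θ : Θ) (x p : E N), (1 - μ) * c ≤ H θ x (μ • p) - μ * H θ x p)
    (hs : ∀ x ∈ S, x ∉ K → ∀ p : E N, p ≠ 0 → (1 - μ) * c < ⨅ θ, (H θ x (μ • p) - μ * H θ x p)) :
    ¬ ∃ y0 ∈ S, ∃ p1 p2 p3 : E N, ‖p1‖ ≤ L ∧ ‖p2‖ ≤ 0 ∧ ‖p3‖ ≤ L ∧
      p1 + (μ - 1) • p2 = μ • p3 ∧ (∀ θ, H θ y0 p1 - c ≤ μ * η) ∧ (∀ _ : Θ, (0:ℝ) ≤ 0) ∧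
      (∀ κ > 0, ∃ θ, η - κ ≤ H θ y0 p3 - c) := by
  rintro ⟨y, hy, p1, p2, p3, -, hp2, -, he, h1, -, h3⟩
  have hμ0 : 0 < μ := by linarith
  have hp2 : p2 = 0 := norm_le_zero_iff.1 hp2
  rw [hp2, smul_zero, add_zero] at he
  subst he
  by_cases hp : p3 = 0
  · subst hp
    obtain ⟨θ, h4⟩ := h3 (η / 2) (by linarith)
    have h5 := hi θ y 0
    rw [smul_zero] at h5
    nlinarith
  · obtain ⟨k, hk⟩ := out_of_compact K hK y p3 hp
    have h4 := hs _ (hSp y hy k) hk p3 hp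
    simp only [hHp] at h4
    obtain ⟨I, hI⟩ : ∃ I, I = ⨅ θ, (H θ y (μ • p3) - μ * H θ y p3) := ⟨_, rfl⟩
    rw [← hI] at h4
    obtain ⟨g, hg⟩ : ∃ g, g = I - (1 - μ) * c := ⟨_, rfl⟩
    have hg0 : 0 < g := by linarith
    obtain ⟨θ, h5⟩ := h3 (g / (2 * μ)) (by positivity)
    have h6 : I ≤ H θ y (μ • p3) - μ * H θ y p3 := by
      rw [hI]
      refine ciInf_le ⟨(1 - μ) * c, ?_⟩ θ
      rintro _ ⟨θ', rfl⟩
      exact hi θ' y p3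
    have h7 := mul_le_mul_of_nonneg_left h5 hμ0.le
    have e : μ * (η - g / (2 * μ)) = μ * η - g / 2 := by field_simp
    have := h1 θ
    linarith

end Conv

section Stab

variable {N : ℕ} {Θ : Type*}

theorem stab_num {F Fh G0 A A0 ε n nh t th T e : ℝ} (h : F - A - 2 * ε * n - ε * (t - T)^2 ≤ Fh - A0 - 2 * ε * nh - ε * (th - T)^2) :
    F ≤ Fh + (A - A0) + 2 * ε * (n - nh) + 2 * ε * (th - T) * (t - th) + ε * (t - th)^2 := by nlinarith

theorem stab (F : E N → ℝ → ℝ) (hFc : ContinuousOn (fun z : E N × ℝ => F z.1 z.2) (Set.univ ×ˢ Set.Ici 0)) (G : E N → ℝ)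
    (hconv : ∀ ε > 0, ∃ T, ∀ x t, T ≤ t → |F x t - G x| ≤ ε) (x0 p : E N) (Q : E N →L[ℝ] E N)
    (hQ : ∀ a b, inner ℝ (Q a) b = inner ℝ a (Q b)) (ε : ℝ) (hε : 0 < ε)
    (hup : ∃ r > 0, ∀ x, ‖x - x0‖ ≤ r → G x ≤ G x0 + inner ℝ p (x - x0) + 1/2 * inner ℝ (Q (x - x0)) (x - x0) + ε * ‖x - x0‖^2) :
    ∃ xh th a, ∃ Y : ST (E N) →L[ℝ] ST (E N), 0 < th ∧ ‖xh - x0‖ ≤ ε ∧ |a| ≤ 2 * ε ∧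
      SupJet (fun z : ST (E N) => F z.fst z.snd) (stp xh th) (stp (p + Q (xh - x0) + (4 * ε) • (xh - x0)) a) Y ∧
      ∀ b, inner ℝ (Y (stp b 0)) (stp b 0) = inner ℝ (Q b) b + 4 * ε * ‖b‖^2 := by
  obtain ⟨r0, hr0, hup⟩ := hup
  obtain ⟨r, hr⟩ : ∃ r, r = min r0 ε := ⟨_, rfl⟩
  have hrp : 0 < r := by rw [hr]; exact lt_min hr0 hε
  have hrr0 : r ≤ r0 := by rw [hr]; exact min_le_left _ _
  have hrε : r ≤ ε := by rw [hr]; exact min_le_right _ _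
  obtain ⟨e, he⟩ : ∃ e, e = min (ε * r^2) ε / 4 := ⟨_, rfl⟩
  have he0 : 0 < e := by rw [he]; have : 0 < min (ε * r^2) ε := lt_min (by positivity) hε; linarith
  have he1 : 4 * e ≤ ε * r^2 := by rw [he]; have := min_le_left (ε * r^2) ε; linarith
  have he2 : 4 * e ≤ ε := by rw [he]; have := min_le_right (ε * r^2) ε; linarith
  obtain ⟨T0, hT0⟩ := hconv e he0
  obtain ⟨T, hT⟩ : ∃ T, T = max T0 0 + 2 := ⟨_, rfl⟩
  have hTT : T0 + 2 ≤ T := by rw [hT]; have := le_max_left T0 0; linarith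
  have hT2 : 2 ≤ T := by rw [hT]; have := le_max_right T0 0; linarith
  obtain ⟨q, hq⟩ : ∃ q : E N → ℝ, q = fun x => inner ℝ p (x - x0) + 1/2 * inner ℝ (Q (x - x0)) (x - x0) := ⟨_, rfl⟩
  have hqc : Continuous q := by rw [hq]; fun_prop
  have hK : IsCompact (Metric.closedBall x0 r ×ˢ Set.Icc (T - 1) (T + 1)) := (isCompact_closedBall _ _).prod isCompact_Icc
  have hc : ContinuousOn (fun z : E N × ℝ => F z.1 z.2 - q z.1 - 2 * ε * ‖z.1 - x0‖^2 - ε * (z.2 - T)^2)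
      (Metric.closedBall x0 r ×ˢ Set.Icc (T - 1) (T + 1)) := by
    have h1 : ContinuousOn (fun z : E N × ℝ => F z.1 z.2) (Metric.closedBall x0 r ×ˢ Set.Icc (T - 1) (T + 1)) :=
      hFc.mono fun z hz => ⟨trivial, by have := hz.2.1; simp only [Set.mem_Ici]; linarith⟩
    have h2 : Continuous (fun z : E N × ℝ => q z.1 + 2 * ε * ‖z.1 - x0‖^2 + ε * (z.2 - T)^2) := by fun_prop
    refine (h1.sub h2.continuousOn).congr fun z _ => ?_
    simp only [Pi.sub_apply]; ring
  obtain ⟨⟨xh, th⟩, hmem, hmax⟩ := hK.exists_isMaxOn ⟨(x0, T), by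
    refine ⟨Metric.mem_closedBall_self hrp.le, ?_, ?_⟩ <;> simp⟩ hc
  have hmax' : ∀ x t, ‖x - x0‖ ≤ r → |t - T| ≤ 1 → F x t - q x - 2 * ε * ‖x - x0‖^2 - ε * (t - T)^2 ≤
      F xh th - q xh - 2 * ε * ‖xh - x0‖^2 - ε * (th - T)^2 := by
    intro x t hx ht
    have := abs_le.1 ht
    exact hmax (a := (x, t)) ⟨by simpa [dist_eq_norm] using hx, by simp only [Set.mem_Icc]; constructor <;> linarith⟩
  obtain ⟨hm1, hm2⟩ := hmem
  simp only [Metric.mem_closedBall, dist_eq_norm, Set.mem_Icc] at hm1 hm2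
  have hq0 : q x0 = 0 := by rw [hq]; simp
  have c0 := hmax' x0 T (by simpa using hrp.le) (by simp)
  rw [hq0] at c0
  simp only [sub_self, norm_zero] at c0
  have c1 := (abs_le.1 (hT0 x0 T (by linarith))).1
  have c2 := (abs_le.1 (hT0 xh th (by linarith))).2
  have c3 : G xh ≤ G x0 + q xh + ε * ‖xh - x0‖^2 := by
    rw [hq]; have := hup xh (hm1.trans hrr0); linarith
  have c4 : ε * ‖xh - x0‖^2 + ε * (th - T)^2 ≤ 2 * e := by linarith
  have n1 : 0 ≤ ε * ‖xh - x0‖^2 := by positivity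
  have n2 : 0 ≤ ε * (th - T)^2 := by positivity
  have d1 : ‖xh - x0‖ < r := by
    have : ε * ‖xh - x0‖^2 < ε * r^2 := by linarith
    exact lt_of_pow_lt_pow_left₀ 2 hrp.le (lt_of_mul_lt_mul_left this hε.le)
  have d2 : |th - T| < 1 := by
    have : ε * (th - T)^2 < ε * 1 := by linarith
    have := lt_of_mul_lt_mul_left this hε.le
    rw [abs_lt]; constructor <;> nlinarith
  let fs : ST (E N) →L[ℝ] E N := WithLp.fstL 2 ℝ (E N) ℝ
  let sn : ST (E N) →L[ℝ] ℝ := WithLp.sndL 2 ℝ (E N) ℝ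
  have hfs : ∀ z, fs z = z.fst := fun z => rfl
  have hsn : ∀ z, sn z = z.snd := fun z => rfl
  let Y : ST (E N) →L[ℝ] ST (E N) := (ContinuousLinearMap.adjoint fs).comp (Q.comp fs)
    + (4 * ε) • ((ContinuousLinearMap.adjoint fs).comp fs) + (2 * ε) • ((ContinuousLinearMap.adjoint sn).comp sn)
  have hY : ∀ a b, inner ℝ (Y a) b = inner ℝ (Q a.fst) b.fst + 4 * ε * inner ℝ a.fst b.fst + 2 * ε * (a.snd * b.snd) := by
    intro a b
    simp only [Y, add_apply, smul_apply, ContinuousLinearMap.comp_apply, inner_add_left, inner_smul_left,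
      ContinuousLinearMap.adjoint_inner_left, conj_trivial, hfs, hsn]
    congr 2
    simp [mul_comm]
  refine ⟨xh, th, 2 * ε * (th - T), Y, by linarith, d1.le.trans hrε, ?_, ⟨?_, ?_⟩, ?_⟩
  · rw [abs_mul, abs_of_pos (by positivity : 0 < 2 * ε)]
    nlinarith
  · intro a b
    have k1 := hY a b
    have k2 := hY b a
    have k3 := hQ a.fst b.fst
    have k4 := real_inner_comm (Q b.fst) a.fst
    have k5 := real_inner_comm b.fst a.fst
    have k6 := real_inner_comm (Y b) a
    rw [k1, k6, k2, k3, k4, k5]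
    ring
  · intro ζ hζ
    have : ∀ᶠ h in nhds (0 : ST (E N)), ‖h‖ < min (r - ‖xh - x0‖) (1 - |th - T|) := by
      have := Metric.ball_mem_nhds (0 : ST (E N)) (show 0 < min (r - ‖xh - x0‖) (1 - |th - T|) from lt_min (by linarith) (by linarith))
      filter_upwards [this] with x hx
      simpa using hx
    filter_upwards [this] with w hw
    have h1 := (st_fst_le w).trans (hw.le.trans (min_le_left _ _))
    have h2 := (st_snd_le w).trans (hw.le.trans (min_le_right _ _))
    rw [Real.norm_eq_abs] at h2
    have h3 := hmax' (xh + w.fst) (th + w.snd) (by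
        rw [add_sub_right_comm]; have := norm_add_le (xh - x0) w.fst; linarith) (by
        rw [add_sub_right_comm]; have := abs_add_le (th - T) w.snd; linarith)
    have h4 := stab_num (G0 := 0) (e := 0) h3
    simp only [WithLp.add_fst, WithLp.add_snd, WithLp.toLp_fst, WithLp.toLp_snd]
    rw [st_inner, hY]
    simp only [WithLp.toLp_fst, WithLp.toLp_snd]
    have e1 : ‖xh + w.fst - x0‖^2 = ‖xh - x0‖^2 + 2 * inner ℝ (xh - x0) w.fst + ‖w.fst‖^2 := by
      rw [add_sub_right_comm, norm_add_sq_real]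
    have e2 : q (xh + w.fst) - q xh = inner ℝ p w.fst + inner ℝ (Q (xh - x0)) w.fst + 1/2 * inner ℝ (Q w.fst) w.fst := by
      simp only [hq]
      rw [show xh + w.fst - x0 = (xh - x0) + w.fst by abel, map_add, inner_add_left, inner_add_right, inner_add_right, inner_add_right, hQ w.fst (xh - x0), real_inner_comm w.fst (Q (xh - x0))]
      rw [real_inner_comm (Q (xh - x0)) w.fst]
      ring
    rw [inner_add_left, inner_add_left, inner_smul_left]
    simp only [conj_trivial, real_inner_self_eq_norm_sq]
    rw [e1, e2] at h4
    have : 0 ≤ ζ * ‖w‖^2 := by positivity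
    simp only [add_sub_cancel_left] at h4
    linarith
  · intro b
    rw [hY]
    simp [real_inner_self_eq_norm_sq]

theorem est (sg : Θ → E N → Fin N → E N) (H : Θ → E N → E N → ℝ) (Cs CR R : ℝ) (hCs : 0 ≤ Cs)
    (hsb : ∀ θ x c, ‖sg θ x c‖ ≤ Cs) (hsl : ∀ θ x y c, ‖sg θ x c - sg θ y c‖ ≤ Cs * ‖x - y‖) (hCR : 0 ≤ CR)
    (hH : ∀ θ x y p q, ‖p‖ ≤ R → ‖q‖ ≤ R → |H θ x p - H θ y q| ≤ CR * (‖x - y‖ + ‖p - q‖))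
    (θ : Θ) (x0 xh p : E N) (Q : E N →L[ℝ] E N) (hR : ‖p‖ + ‖Q‖ + 4 ≤ R) (ε : ℝ) (hε : 0 < ε) (hε1 : ε ≤ 1) (hx : ‖xh - x0‖ ≤ ε) :
    |∑ c, (inner ℝ (Q (sg θ xh c)) (sg θ xh c) + 4 * ε * ‖sg θ xh c‖^2) - ∑ c, inner ℝ (Q (sg θ x0 c)) (sg θ x0 c)|
      ≤ N * (2 * ‖Q‖ * Cs^2 + 4 * Cs^2) * ε ∧
    |H θ xh (p + Q (xh - x0) + (4 * ε) • (xh - x0)) - H θ x0 p| ≤ CR * (1 + ‖Q‖ + 4) * ε := by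
  have h1 : |∑ c, (inner ℝ (Q (sg θ xh c)) (sg θ xh c) + 4 * ε * ‖sg θ xh c‖^2) - ∑ c, inner ℝ (Q (sg θ x0 c)) (sg θ x0 c)|
      ≤ N * (2 * ‖Q‖ * Cs^2 + 4 * Cs^2) * ε := by
    rw [← Finset.sum_sub_distrib]
    refine (Finset.abs_sum_le_sum_abs _ _).trans ?_
    have : ∀ c ∈ Finset.univ, |inner ℝ (Q (sg θ xh c)) (sg θ xh c) + 4 * ε * ‖sg θ xh c‖^2 - inner ℝ (Q (sg θ x0 c)) (sg θ x0 c)|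
        ≤ (2 * ‖Q‖ * Cs^2 + 4 * Cs^2) * ε := by
      intro c _
      have a1 : ‖sg θ xh c - sg θ x0 c‖ ≤ Cs * ε := (hsl θ xh x0 c).trans (by gcongr)
      have a2 := quad_pert Q (sg θ xh c) (sg θ x0 c) Cs ε hCs (hsb _ _ _) (hsb _ _ _) a1 hε.le
      have a3 := quad_pert Q (sg θ x0 c) (sg θ xh c) Cs ε hCs (hsb _ _ _) (hsb _ _ _) (by rw [norm_sub_rev]; exact a1) hε.le
      have a4 : ‖sg θ xh c‖^2 ≤ Cs^2 := by have := hsb θ xh c; gcongr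
      have a5 : 0 ≤ ‖sg θ xh c‖^2 := by positivity
      have a6 : ε * ‖sg θ xh c‖^2 ≤ ε * Cs^2 := by gcongr
      have a7 : 0 ≤ ε * ‖sg θ xh c‖^2 := by positivity
      rw [abs_le]; constructor <;> nlinarith
    refine (Finset.sum_le_sum this).trans (le_of_eq ?_)
    simp; ring
  have h2 : ‖Q (xh - x0) + (4 * ε) • (xh - x0)‖ ≤ (‖Q‖ + 4) * ε := by
    refine (norm_add_le _ _).trans ?_
    rw [norm_smul, Real.norm_of_nonneg (by positivity)]
    have b1 := (Q.le_opNorm (xh - x0)).trans (mul_le_mul_of_nonneg_left hx (norm_nonneg _))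
    have b2 : ε * ‖xh - x0‖ ≤ 1 * ε := by gcongr
    nlinarith
  have h3 : ‖p + Q (xh - x0) + (4 * ε) • (xh - x0)‖ ≤ R := by
    rw [add_assoc]
    refine (norm_add_le _ _).trans ?_
    have : (‖Q‖ + 4) * ε ≤ (‖Q‖ + 4) * 1 := by gcongr
    linarith
  have h4 := hH θ xh x0 (p + Q (xh - x0) + (4 * ε) • (xh - x0)) p h3 (by have := norm_nonneg Q; linarith)
  rw [add_assoc p, add_sub_cancel_left] at h4
  have h5 : CR * (‖xh - x0‖ + ‖Q (xh - x0) + (4 * ε) • (xh - x0)‖) ≤ CR * (ε + (‖Q‖ + 4) * ε) := by gcongr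
  rw [← add_assoc] at h4
  exact ⟨h1, (h4.trans h5).trans (le_of_eq (by ring))⟩

theorem erg_sub (σm A : Θ → E N → Matrix (Fin N) (Fin N) ℝ)
    (hA : ∀ (θ : Θ) (x : E N), A θ x = σm θ x * (σm θ x)ᵀ) (H : Θ → E N → E N → ℝ) (c Cs : ℝ) (hCs : 0 ≤ Cs)
    (hsb : ∀ θ x c, ‖cols σm θ x c‖ ≤ Cs) (hsl : ∀ θ x y c, ‖cols σm θ x c - cols σm θ y c‖ ≤ Cs * ‖x - y‖)
    (hH : ∀ R > (0:ℝ), ∃ CR > (0:ℝ), ∀ (θ : Θ) (x y p q : E N),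
      ‖p‖ ≤ R → ‖q‖ ≤ R → |H θ x p - H θ y q| ≤ CR * (‖x - y‖ + ‖p - q‖)) [Nonempty Θ]
    (f : E N → ℝ → ℝ) (hFc : ContinuousOn (fun z : E N × ℝ => f z.1 z.2) (Set.univ ×ˢ Set.Ici 0)) (g : E N → ℝ)
    (hconv : ∀ ε > 0, ∃ T, ∀ x t, T ≤ t → |f x t - g x| ≤ ε)
    (hj : JSub (cols σm) (fun θ x p => H θ x p - c) f) : IsSubSolErg A H c g := by
  intro φ hφ x0 hmax
  apply ciSup_le
  intro θ
  obtain ⟨Q, hQ, hQs⟩ := hessOp_ex φ hφ x0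
  have hd2 : DifferentiableAt ℝ (fderiv ℝ φ) x0 :=
    ((hφ.fderiv_right (m := 1) (by norm_num)).differentiable (by norm_num)) x0
  have htr : Matrix.trace (A θ x0 * hessMatrix φ x0) = ∑ c, inner ℝ (Q (cols σm θ x0 c)) (cols σm θ x0 c) := by
    rw [hA, trace_cols _ _ _ hd2]; simp only [hQ]; rfl
  obtain ⟨CR, hCR, hHR⟩ := hH (‖gradient φ x0‖ + ‖Q‖ + 4) (by positivity)
  simp only [opVal, htr]
  apply le_of_forall_pos_le_add
  intro κ hκ
  obtain ⟨ε, ⟨hε1, hε2⟩, hε⟩ := (((ev_small (2 + (N * (2 * ‖Q‖ * Cs^2 + 4 * Cs^2) + CR * (1 + ‖Q‖ + 4))) κ hκ).and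
    (ev_small 1 1 one_pos)).and self_mem_nhdsWithin).exists
  have hε : 0 < ε := hε
  rw [one_mul] at hε2
  obtain ⟨xh, th, a, Y, hth, hxh, ha, hjet, hY⟩ := stab f hFc g hconv x0 (gradient φ x0) Q hQs ε hε (by
    obtain ⟨r1, hr1, h1⟩ := taylor2 φ hφ x0 ε hε
    obtain ⟨r2, hr2, h2⟩ := Metric.eventually_nhds_iff_ball.1 hmax
    refine ⟨min r1 (r2 / 2), by positivity, fun x hx => ?_⟩
    have h3 := (abs_le.1 (h1 x (hx.trans (min_le_left _ _)))).2
    have h4 := h2 x (by rw [Metric.mem_ball, dist_eq_norm]; have := hx.trans (min_le_right _ _); linarith)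
    rw [hQ]
    linarith)
  have h1 := hj (stp xh th) _ Y hth hjet θ
  simp only [WithLp.toLp_fst, WithLp.toLp_snd, hY] at h1
  have h2 := est (cols σm) H Cs CR _ hCs hsb hsl hCR.le hHR θ x0 xh (gradient φ x0) Q le_rfl ε hε hε2 hxh
  have h4 := (abs_le.1 h2.1).2
  have h5 := (abs_le.1 h2.2).1
  have h3 := (abs_le.1 ha).1
  linarith

theorem erg_sup (σm A : Θ → E N → Matrix (Fin N) (Fin N) ℝ)
    (hA : ∀ (θ : Θ) (x : E N), A θ x = σm θ x * (σm θ x)ᵀ) (H : Θ → E N → E N → ℝ) (c Cs : ℝ) (hCs : 0 ≤ Cs)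
    (hsb : ∀ θ x c, ‖cols σm θ x c‖ ≤ Cs) (hsl : ∀ θ x y c, ‖cols σm θ x c - cols σm θ y c‖ ≤ Cs * ‖x - y‖)
    (hH : ∀ R > (0:ℝ), ∃ CR > (0:ℝ), ∀ (θ : Θ) (x y p q : E N),
      ‖p‖ ≤ R → ‖q‖ ≤ R → |H θ x p - H θ y q| ≤ CR * (‖x - y‖ + ‖p - q‖)) 
    (hHb : ∀ x p, ∃ B, ∀ θ, |H θ x p| ≤ B)
    (f : E N → ℝ → ℝ) (hFc : ContinuousOn (fun z : E N × ℝ => f z.1 z.2) (Set.univ ×ˢ Set.Ici 0)) (g : E N → ℝ)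
    (hconv : ∀ ε > 0, ∃ T, ∀ x t, T ≤ t → |f x t - g x| ≤ ε)
    (hj : JSup (cols σm) (fun θ x p => H θ x p - c) f) : IsSuperSolErg A H c g := by
  intro φ hφ x0 hmax
  obtain ⟨Q, hQ, hQs⟩ := hessOp_ex φ hφ x0
  have hd2 : DifferentiableAt ℝ (fderiv ℝ φ) x0 :=
    ((hφ.fderiv_right (m := 1) (by norm_num)).differentiable (by norm_num)) x0
  have htr : ∀ θ, Matrix.trace (A θ x0 * hessMatrix φ x0) = ∑ c, inner ℝ (Q (cols σm θ x0 c)) (cols σm θ x0 c) := by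
    intro θ
    rw [hA, trace_cols _ _ _ hd2]; simp only [hQ]; rfl
  obtain ⟨CR, hCR, hHR⟩ := hH (‖gradient φ x0‖ + ‖Q‖ + 4) (by positivity)
  have hbdd : BddAbove (Set.range fun θ => opVal A H θ x0 φ) := by
    obtain ⟨B, hB⟩ := hHb x0 (gradient φ x0)
    refine ⟨N * (‖Q‖ * Cs^2) + B, ?_⟩
    rintro _ ⟨θ, rfl⟩
    simp only [opVal, htr]
    have h1 := (abs_le.1 (hB θ)).2
    have h2 : ∀ c ∈ Finset.univ, - inner ℝ (Q (cols σm θ x0 c)) (cols σm θ x0 c) ≤ ‖Q‖ * Cs^2 := by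
      intro c _
      have i1 := (abs_le.1 (abs_real_inner_le_norm (Q (cols σm θ x0 c)) (cols σm θ x0 c))).1
      have i2 : ‖Q (cols σm θ x0 c)‖ * ‖cols σm θ x0 c‖ ≤ (‖Q‖ * Cs) * Cs := by
        have i3 := hsb θ x0 c
        have i4 := (Q.le_opNorm (cols σm θ x0 c)).trans (mul_le_mul_of_nonneg_left i3 (norm_nonneg _))
        gcongr
      nlinarith
    have h3 := Finset.sum_le_sum h2
    rw [Finset.sum_neg_distrib] at h3
    simp only [Finset.sum_const, Finset.card_univ, Fintype.card_fin, nsmul_eq_mul] at h3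
    linarith
  apply le_of_forall_pos_le_add
  intro κ hκ
  obtain ⟨ε, ⟨hε1, hε2⟩, hε⟩ := (((ev_small (3 + (N * (2 * ‖Q‖ * Cs^2 + 4 * Cs^2) + CR * (1 + ‖Q‖ + 4))) κ hκ).and
    (ev_small 1 1 one_pos)).and self_mem_nhdsWithin).exists
  have hε : 0 < ε := hε
  rw [one_mul] at hε2
  obtain ⟨xh, th, a, Y, hth, hxh, ha, hjet, hY⟩ := stab (fun x t => - f x t) hFc.neg (fun x => - g x) (by
      intro ε hε
      obtain ⟨T, hT⟩ := hconv ε hε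
      refine ⟨T, fun x t ht => ?_⟩
      have := hT x t ht
      rw [← abs_neg]; convert this using 2; ring) x0 (- gradient φ x0) (-Q) (by intro a b; simp [hQs]) ε hε (by
    obtain ⟨r1, hr1, h1⟩ := taylor2 φ hφ x0 ε hε
    obtain ⟨r2, hr2, h2⟩ := Metric.eventually_nhds_iff_ball.1 hmax
    refine ⟨min r1 (r2 / 2), by positivity, fun x hx => ?_⟩
    have h3 := (abs_le.1 (h1 x (hx.trans (min_le_left _ _)))).1
    have h4 := h2 x (by rw [Metric.mem_ball, dist_eq_norm]; have := hx.trans (min_le_right _ _); linarith)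
    rw [neg_apply, inner_neg_left, inner_neg_left, hQ]
    linarith)
  obtain ⟨θ, h1⟩ := hj (stp xh th) _ Y hth hjet ε hε
  simp only [WithLp.toLp_fst, WithLp.toLp_snd, hY] at h1
  have hR : ‖gradient φ x0‖ + ‖Q‖ + 4 = ‖- gradient φ x0‖ + ‖-Q‖ + 4 := by rw [norm_neg, norm_neg]
  have h2 := (est (cols σm) (fun θ x p => H θ x (-p)) Cs CR (‖gradient φ x0‖ + ‖Q‖ + 4) hCs hsb hsl hCR.le
    (fun θ x y p q hp hq => by
      have := hHR θ x y (-p) (-q) (by rwa [norm_neg]) (by rwa [norm_neg])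
      rwa [neg_sub_neg, norm_sub_rev q p] at this) θ x0 xh (-gradient φ x0) (-Q) hR.ge ε hε hε2 hxh)
  simp only [neg_neg, norm_neg] at h2
  have h4 := (abs_le.1 h2.1).2
  have h5 := (abs_le.1 h2.2).2
  have h6 := le_ciSup hbdd θ
  simp only [opVal, htr] at h6 ⊢
  simp only [neg_apply, inner_neg_left, Finset.sum_neg_distrib] at h4 h5 h1
  have h3 := abs_le.1 ha
  linarith

end Stab

section Conv

variable {N : ℕ} {Θ : Type*}

theorem Reg.tshift {L : ℝ} {f : E N → ℝ → ℝ} (h : Reg L f) (a : ℝ) (ha : 0 ≤ a) : Reg L (fun x t => f x (t + a)) where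
  per := fun x t k => h.per x (t + a) k
  cont := h.cont.comp (f := fun z : E N × ℝ => (z.1, z.2 + a)) (by fun_prop)
    (fun z hz => ⟨trivial, by have := hz.2; simp only [Set.mem_Ici] at this ⊢; linarith⟩)
  lip := fun t ht x y => h.lip (t + a) (by linarith) x y

theorem contr {sg : Θ → E N → Fin N → E N} {H : Θ → E N → E N → ℝ} {Cs CR L : ℝ} (D : Dat sg H Cs CR L)
    {f : E N → ℝ → ℝ} (R : Reg L f) (h1 : JSub sg H f) (h2 : JSup sg H f) (a b M : ℝ) (ha : 0 ≤ a) (hb : 0 ≤ b)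
    (h0 : ∀ x, f x a ≤ f x b + M) (x : E N) (t : ℝ) (ht : 0 ≤ t) : f x (t + a) ≤ f x (t + b) + M :=
  cmp D (R.tshift a ha) (R.tshift b hb) (jsub_tshift sg H f h1 a ha) (jsup_tshift sg H f h2 b hb) M
    (by intro x; simpa using h0 x) x t ht

theorem recur {L : ℝ} {f : E N → ℝ → ℝ} (R : Reg L f) (hL : 0 ≤ L) (B : ℝ) (hB : ∀ x t, 0 ≤ t → |f x t| ≤ B) (ε : ℝ) (hε : 0 < ε) :
    ∃ ts, 0 ≤ ts ∧ ∀ T, ∃ τ, T ≤ τ ∧ 0 ≤ τ ∧ ∀ x, |f x ts - f x τ| ≤ ε := by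
  obtain ⟨r, hr⟩ : ∃ r, r = ε / (3 * (L + 1)) := ⟨_, rfl⟩
  have hr0 : 0 < r := by rw [hr]; positivity
  have hLr : L * r ≤ ε / 3 := by
    rw [hr, show ε / (3 * (L+1)) = (ε / 3) / (L + 1) by field_simp, mul_div_assoc', div_le_iff₀ (by linarith)]
    nlinarith
  obtain ⟨F, -, hF, hFc⟩ := Metric.totallyBounded_iff.1 (cube_compact (N := N)).totallyBounded r hr0 |>.imp fun t h => (⟨trivial, h⟩ : True ∧ _)
  have : Finite F := hF.to_subtype
  have : Fintype F := Fintype.ofFinite F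
  obtain ⟨a, -, φ, hφ, hlim⟩ := (isCompact_univ_pi (fun _ : F => isCompact_Icc (a := -B) (b := B))).tendsto_subseq
    (x := fun (n : ℕ) (y : F) => f y n) (fun n y _ => abs_le.1 (hB y n n.cast_nonneg))
  have hc := hlim.cauchySeq
  rw [Metric.cauchySeq_iff] at hc
  obtain ⟨n0, hn0⟩ := hc (ε / 3) (by linarith)
  refine ⟨(φ n0 : ℕ), Nat.cast_nonneg _, fun T => ?_⟩
  obtain ⟨m, hm⟩ := exists_nat_ge T
  refine ⟨(φ (max n0 m) : ℕ), ?_, Nat.cast_nonneg _, fun x => ?_⟩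
  · refine hm.trans ?_
    exact_mod_cast (le_max_right n0 m).trans (hφ.id_le _)
  obtain ⟨k, hk⟩ := exists_cube x
  rw [← R.per x _ k, ← R.per x (φ (max n0 m)) k]
  obtain ⟨y, hy, hxy⟩ := Set.mem_iUnion₂.1 (hFc hk)
  have h1 := hn0 n0 le_rfl (max n0 m) (le_max_left _ _)
  have h2 := (dist_pi_lt_iff (by linarith)).1 h1 ⟨y, hy⟩
  simp only [Function.comp_apply, Real.dist_eq] at h2
  have hd : ‖x + iv k - y‖ ≤ r := by rw [← dist_eq_norm]; exact (Metric.mem_ball.1 hxy).le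
  have h3 := (R.lip (φ n0) (Nat.cast_nonneg _) (x + iv k) y).trans ((mul_le_mul_of_nonneg_left hd hL).trans hLr)
  have h4 := (R.lip (φ (max n0 m)) (Nat.cast_nonneg _) (x + iv k) y).trans ((mul_le_mul_of_nonneg_left hd hL).trans hLr)
  have := abs_le.1 h3
  have := abs_le.1 h4
  have := abs_lt.1 h2
  rw [abs_le]; constructor <;> linarith

theorem osc {sg : Θ → E N → Fin N → E N} {H : Θ → E N → E N → ℝ} {Cs CR L : ℝ} (D : Dat sg H Cs CR L)
    {f : E N → ℝ → ℝ} (R : Reg L f) (h1 : JSub sg H f) (h2 : JSup sg H f) (B : ℝ) (hB : ∀ x t, 0 ≤ t → |f x t| ≤ B)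
    (hasym : ∀ w, 0 ≤ w → ∀ ε > 0, ∃ T, ∀ x t, T ≤ t → f x t ≤ f x (w + t) + ε) (ε : ℝ) (hε : 0 < ε) :
    ∃ ts, 0 ≤ ts ∧ ∀ x t t', ts ≤ t → t ≤ t' → |f x t - f x t'| ≤ 7 * ε := by
  obtain ⟨ts, hts, hrec⟩ := recur R D.hL B hB ε hε
  have key : ∀ x t t', ts ≤ t → t ≤ t' → f x t ≤ f x t' + 3 * ε := by
    intro x t t' ht ht'
    obtain ⟨T, hT⟩ := hasym (t' - t) (by linarith) ε hε
    obtain ⟨τ, hτ, hτ0, hτx⟩ := hrec T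
    have e1 := contr D R h1 h2 ts τ ε hts hτ0 (fun x => by have := (abs_le.1 (hτx x)).2; linarith) x (t - ts) (by linarith)
    have e2 := contr D R h1 h2 τ ts ε hτ0 hts (fun x => by have := (abs_le.1 (hτx x)).1; linarith) x (t' - ts) (by linarith)
    have e3 := hT x (t - ts + τ) (by linarith)
    rw [show t' - t + (t - ts + τ) = t' - ts + τ by ring] at e3
    rw [sub_add_cancel] at e1 e2
    linarith
  refine ⟨ts, hts, fun x t t' ht ht' => ?_⟩
  obtain ⟨τ, hτ, hτ0, hτx⟩ := hrec t'
  have a1 := key x t t' ht ht'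
  have a2 := key x t' τ (by linarith) hτ
  have a3 := abs_le.1 (hτx x)
  have a4 := key x ts t le_rfl ht
  rw [abs_le]; constructor <;> linarith

theorem conv_of_asym {sg : Θ → E N → Fin N → E N} {H : Θ → E N → E N → ℝ} {Cs CR L : ℝ} (D : Dat sg H Cs CR L)
    {f : E N → ℝ → ℝ} (R : Reg L f) (h1 : JSub sg H f) (h2 : JSup sg H f) (B : ℝ) (hB : ∀ x t, 0 ≤ t → |f x t| ≤ B)
    (hasym : ∀ w, 0 ≤ w → ∀ ε > 0, ∃ T, ∀ x t, T ≤ t → f x t ≤ f x (w + t) + ε) :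
    ∃ g : E N → ℝ, (∀ x k, g (x + iv k) = g x) ∧ (∀ x y, |g x - g y| ≤ L * ‖x - y‖) ∧
      ∀ ε > 0, ∃ T, ∀ x t, T ≤ t → |f x t - g x| ≤ ε := by
  have hosc := osc D R h1 h2 B hB hasym
  have hlim : ∀ x, ∃ l, Tendsto (fun n : ℕ => f x n) atTop (nhds l) := by
    intro x
    apply cauchySeq_tendsto_of_complete
    rw [Metric.cauchySeq_iff']
    intro ε hε
    obtain ⟨ts, hts, h⟩ := hosc (ε / 8) (by linarith)
    obtain ⟨m, hm⟩ := exists_nat_ge ts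
    refine ⟨m, fun n hn => ?_⟩
    have := h x m n hm (by exact_mod_cast hn)
    rw [dist_comm, Real.dist_eq]
    linarith
  choose g hg using hlim
  refine ⟨g, fun x k => ?_, fun x y => ?_, fun ε hε => ?_⟩
  · refine tendsto_nhds_unique (hg (x + iv k)) ?_
    simp only [R.per]; exact hg x
  · exact le_of_tendsto ((hg x).sub (hg y)).abs (Eventually.of_forall fun n => R.lip n (Nat.cast_nonneg _) x y)
  · obtain ⟨ts, hts, h⟩ := hosc (ε / 7) (by linarith)
    refine ⟨ts, fun x t ht => ?_⟩
    refine le_of_tendsto (tendsto_const_nhds.sub (hg x)).abs ?_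
    obtain ⟨m, hm⟩ := exists_nat_ge t
    filter_upwards [eventually_ge_atTop m] with n hn
    have := h x t n ht (hm.trans (by exact_mod_cast hn))
    linarith

end Conv

section Fin

theorem asym_of_WW {N : ℕ} {f : E N → ℝ → ℝ} {V : E N → ℝ} (B μm : ℝ) (hμm : 1 < μm) (hB : ∀ x t, 0 ≤ t → |f x t| ≤ B)
    (hV : ∀ x, |V x| ≤ B)
    (hW : ∀ μ η, 1 < μ → μ < μm → μ < 2 → 0 < η → ∀ ι > 0, ∃ T, ∀ x t s, T ≤ t → t ≤ s → WW f V μ η x t s ≤ ι) :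
    ∀ w, 0 ≤ w → ∀ ε > 0, ∃ T, ∀ x t, T ≤ t → f x t ≤ f x (w + t) + ε := by
  intro w hw ε hε
  have hB0 : 0 ≤ B := (abs_nonneg _).trans (hV 0)
  obtain ⟨d, ⟨hd1, hd2⟩, hd⟩ := (((ev_small 2 (min (μm - 1) 1) (lt_min (by linarith) one_pos)).and
    (ev_small (2 * B) (ε / 3) (by linarith))).and self_mem_nhdsWithin).exists
  obtain ⟨η, hη1, hη⟩ := ((ev_small (2 * w) (ε / 3) (by linarith)).and self_mem_nhdsWithin).exists
  have hd : 0 < d := hd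
  have hη : 0 < η := hη
  have k1 := hd1.trans (min_le_left _ _)
  have k2 := hd1.trans (min_le_right _ _)
  obtain ⟨T, hT⟩ := hW (1 + d) η (by linarith) (by linarith) (by linarith) hη (ε / 3) (by linarith)
  refine ⟨max T 0, fun x t ht => ?_⟩
  have ht1 := (le_max_left _ _).trans ht
  have ht2 := (le_max_right _ _).trans ht
  have h1 := hT x t (w + t) ht1 (by linarith)
  have h2 := (abs_le.1 (hB x (w + t) (by linarith))).2
  have h3 := (abs_le.1 (hV x)).1
  have h4 := mul_nonneg hd.le (sub_nonneg.2 h2)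
  have h5 := mul_nonneg hd.le (by linarith : 0 ≤ V x + B)
  have h6 : d * (η * w) ≤ 1 * (η * w) := by
    have : 0 ≤ η * w := by positivity
    apply mul_le_mul_of_nonneg_right _ this
    linarith
  simp only [WW, add_sub_cancel_right, add_sub_cancel_left] at h1
  linarith

theorem lip_abs {N : ℕ} {g : E N → ℝ} {K : NNReal} (h : LipschitzWith K g) (x y : E N) : |g x - g y| ≤ K * ‖x - y‖ := by
  have := h.dist_le_mul x y
  rwa [Real.dist_eq, dist_eq_norm] at this

theorem abs_lip {N : ℕ} {g : E N → ℝ} {L : ℝ} (hL : 0 ≤ L) (h : ∀ x y, |g x - g y| ≤ L * ‖x - y‖) : LipschitzWith L.toNNReal g := by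
  refine LipschitzWith.of_dist_le_mul fun x y => ?_
  rw [Real.dist_eq, dist_eq_norm, Real.coe_toNNReal _ hL]
  exact h x y

end Fin

theorem statement2
    {N : ℕ} {Θ : Type*} [MetricSpace Θ] [Nonempty Θ]
    (C : ℝ) (hC : 0 < C)
    (σm : Θ → E N → Matrix (Fin N) (Fin N) ℝ)
    (A : Θ → E N → Matrix (Fin N) (Fin N) ℝ)
    -- (H1)
    (hA : ∀ (θ : Θ) (x : E N), A θ x = σm θ x * (σm θ x)ᵀ)
    (hσper : ∀ θ : Θ, ZPeriodic (σm θ))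
    (hσbd : ∀ (θ : Θ) (x : E N) (i j : Fin N), |σm θ x i j| ≤ C)
    (hσlip : ∀ (θ : Θ) (i j : Fin N), LipschitzWith C.toNNReal fun x : E N => σm θ x i j)
    (H : Θ → E N → E N → ℝ)
    -- (H2)
    (hHper : ∀ (θ : Θ) (p : E N), ZPeriodic fun x => H θ x p)
    (hH0 : ∀ (θ : Θ) (x : E N), |H θ x 0| ≤ C)
    (hHlip : ∀ R > (0:ℝ), ∃ CR > (0:ℝ), ∀ (θ : Θ) (x y p q : E N),
      ‖p‖ ≤ R → ‖q‖ ≤ R → |H θ x p - H θ y q| ≤ CR * (‖x - y‖ + ‖p - q‖))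
    -- (H3): Lipschitz solutions of the Cauchy problem and the discounted problems,
    -- and a solution (c,v) of the ergodic problem
    (u : E N → ℝ → ℝ) (u₀ : E N → ℝ)
    (huper : ∀ t : ℝ, ZPeriodic fun x => u x t)
    (hucont : ContinuousOn (fun q : E N × ℝ => u q.1 q.2) (Set.univ ×ˢ Set.Ici 0))
    (huinit : ∀ x : E N, u x 0 = u₀ x)
    (husol : IsSolCP A H u)
    (hulip : ∀ t : ℝ, 0 ≤ t → LipschitzWith C.toNNReal fun x => u x t)
    (hdisc : ∀ lam > (0:ℝ), ∃ w : E N → ℝ, ZPeriodic w ∧ Continuous w ∧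
      IsSolDisc A H lam w ∧ LipschitzWith C.toNNReal w)
    (c : ℝ) (v : E N → ℝ) (hvper : ZPeriodic v)
    (hvlip : ∃ L : NNReal, LipschitzWith L v)
    (hverg : IsSolErg A H c v)
    -- (sur-sol-stricte), for every constant C' > 0
    (hsss : ∀ C' > (0:ℝ), SurSolStricte A C')
    -- either [convexity and (cvx_neuf)] or [(H10)]
    (hmain :
      ((∀ (θ : Θ) (x : E N), ConvexOn ℝ Set.univ (H θ x)) ∧
        (∀ x ∈ degenSet A, ∀ lam : ℝ, 0 < lam → lam < 1 → ∀ p q : E N, p ≠ q →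
          0 < ⨅ θ, (lam * H θ x p + (1 - lam) * H θ x q
            - H θ x (lam • p + (1 - lam) • q)))) ∨
      (∃ μ₀ : ℝ, 1 < μ₀ ∧
        (∀ (θ : Θ) (x p : E N) (μ : ℝ), 1 < μ → μ < μ₀ →
          (1 - μ) * c ≤ H θ x (μ • p) - μ * H θ x p) ∧
        ∃ K : Set (E N), IsCompact K ∧ K ⊆ degenSet A ∧
          (∀ θ : Θ, ∀ x ∈ K, ∀ p : E N, c ≤ H θ x p) ∧
          (∀ x ∈ degenSet A, x ∉ K → ∀ p : E N, p ≠ 0 → ∀ μ : ℝ, 1 < μ → μ ≤ μ₀ →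
            (1 - μ) * c < ⨅ θ, (H θ x (μ • p) - μ * H θ x p)))) :
    ∃ uInf : E N → ℝ, ZPeriodic uInf ∧ (∃ L : NNReal, LipschitzWith L uInf) ∧
      IsSolErg A H c uInf ∧
      TendstoUniformly (fun (t : ℝ) (x : E N) => u x t + c * t) uInf atTop := by
  classical
  obtain ⟨LvN, hvl⟩ := hvlip
  obtain ⟨Lv, hLvd⟩ : ∃ Lv : ℝ, Lv = LvN := ⟨_, rfl⟩
  have hLv0 : 0 ≤ Lv := by rw [hLvd]; exact LvN.coe_nonneg
  have hvl' : ∀ x y, |v x - v y| ≤ Lv * ‖x - y‖ := by rw [hLvd]; exact lip_abs hvl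
  obtain ⟨L, hL⟩ : ∃ L, L = C + Lv := ⟨_, rfl⟩
  have hL0 : 0 < L := by linarith
  have hLvL : Lv ≤ L := by linarith
  obtain ⟨CR, hCR, hH2⟩ := hHlip (2 * L) (by linarith)
  have hH1 : ∀ θ x y p q, ‖p‖ ≤ L → ‖q‖ ≤ L → |H θ x p - H θ y q| ≤ CR * (‖x - y‖ + ‖p - q‖) :=
    fun θ x y p q hp hq => hH2 θ x y p q (by linarith) (by linarith)
  have hHb : ∀ x p, ∃ B, ∀ θ, |H θ x p| ≤ B := by
    intro x p
    obtain ⟨K, hK, h⟩ := hHlip (‖p‖ + 1) (by positivity)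
    refine ⟨C + K * ‖p‖, fun θ => ?_⟩
    have h1 := h θ x x p 0 (by linarith) (by simp; positivity)
    have h2 := hH0 θ x
    simp only [sub_self, norm_zero, sub_zero, zero_add] at h1
    have h3 := abs_add_le (H θ x p - H θ x 0) (H θ x 0)
    rw [sub_add_cancel] at h3
    linarith
  have hCs : (0:ℝ) ≤ N * C := by positivity
  have hsb := cols_bd σm C hC hσbd
  have hsl := cols_lip σm C hC hσlip
  have D : Dat (cols σm) (fun θ x p => H θ x p - c) (N * C) CR L :=
    ⟨hCs, hsb, hsl, hCR.le, hL0.le, fun θ x y p q hp hq => by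
      have := hH1 θ x y p q hp hq
      rwa [sub_sub_sub_cancel_right]⟩
  have R : Reg L (fun x t => u x t + c * t) := by
    refine ⟨fun x t k => ?_, ?_, fun t ht x y => ?_⟩
    · have : u (x + iv k) t = u x t := huper t x k
      simp only [this]
    · exact hucont.add (Continuous.continuousOn (by fun_prop))
    · have := lip_abs (hulip t ht) x y
      rw [Real.coe_toNNReal _ hC.le] at this
      rw [add_sub_add_right_eq_sub]
      refine this.trans ?_
      have := norm_nonneg (x - y)
      gcongr
      linarith
  have Rv : Reg L (fun x _ => v x) := by
    refine ⟨fun x t k => hvper x k, ?_, fun t ht x y => ?_⟩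
    · exact (hvl.continuous.comp continuous_fst).continuousOn
    · refine (hvl' x y).trans ?_
      gcongr
  have j1 := jsub_shift (cols σm) H u (jsub_of_subsol σm A hA (N * C) hsb H hHb u husol.1) c
  have j3 := jsup_shift (cols σm) H u (jsup_of_supersol σm A hA (N * C) hsb H u husol.2) c
  have k1 := jsub_shift (cols σm) H _ (jsub_of_subsol σm A hA (N * C) hsb H hHb _ (opVal_erg_sub A H c v hverg.1)) c
  have k3 := jsup_shift (cols σm) H _ (jsup_of_supersol σm A hA (N * C) hsb H _ (opVal_erg_super A H c v hverg.2)) c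
  simp only [sub_add_cancel] at k1 k3
  obtain ⟨B1, hB1, hb1⟩ := R.bdd 0
  obtain ⟨B2, hB2, hb2⟩ := Rv.bdd 0
  have hle1 : ∀ x t, 0 ≤ t → u x t + c * t ≤ v x + (B1 + B2) := by
    intro x t ht
    refine cmp D R Rv j1 k3 (B1 + B2) (fun x => ?_) x t ht
    have a1 := abs_le.1 (hb1 x 0 (by simp))
    have a2 := abs_le.1 (hb2 x 0 (by simp))
    linarith
  have hle2 : ∀ x t, 0 ≤ t → v x ≤ u x t + c * t + (B1 + B2) := by
    intro x t ht
    refine cmp D Rv R k1 j3 (B1 + B2) (fun x => ?_) x t ht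
    have a1 := abs_le.1 (hb1 x 0 (by simp))
    have a2 := abs_le.1 (hb2 x 0 (by simp))
    linarith
  have hvB : ∀ x, |v x| ≤ B2 := fun x => hb2 x 0 (by simp)
  obtain ⟨B, hB⟩ : ∃ B, B = B1 + 2 * B2 := ⟨_, rfl⟩
  have hB0 : 0 ≤ B := by linarith
  have hbu : ∀ x t, 0 ≤ t → |u x t + c * t| ≤ B := by
    intro x t ht
    have a1 := abs_le.1 (hvB x)
    have a2 := hle1 x t ht
    have a3 := hle2 x t ht
    rw [abs_le]; constructor <;> linarith
  have hsp : ∀ θ x c k, cols σm θ (x + iv k) c = cols σm θ x c := by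
    intro θ x c k
    have := hσper θ x k
    simp only [cols, iv]
    rw [this]
  have hHp : ∀ θ x p k, H θ (x + iv k) p = H θ x p := fun θ x p k => hHper θ p x k
  have hHp' : ∀ θ x p k, (fun θ x p => H θ x p - c) θ (x + iv k) p = (fun θ x p => H θ x p - c) θ x p := by
    intro θ x p k; simp only [hHp]
  have hS := sss_cols σm A hA CR hCR (hsss CR hCR)
  have hDg := Dg_cols σm A hA
  have hasym : ∀ w, 0 ≤ w → ∀ ε > 0, ∃ T, ∀ x t, T ≤ t → u x t + c * t ≤ u x (w + t) + c * (w + t) + ε := by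
    rcases hmain with ⟨hc, hs⟩ | ⟨μ0, hμ0, hi, K, hK, -, -, hs⟩
    · have hVB : ∀ x, |v x - (B1 + B2)| ≤ B := by
        intro x
        have a1 := abs_le.1 (hvB x)
        rw [abs_le]; constructor <;> linarith
      refine asym_of_WW (f := fun x t => u x t + c * t) (V := fun x => v x - (B1 + B2)) B 2 (by norm_num) hbu hVB ?_
      intro μ η hμ _ _ hη
      refine WW_asym (sg := cols σm) (H := fun θ x p => H θ x p - c) (G := fun θ x p => H θ x p - c) (Cs := N * C)
        (CR := CR) (L := L) (L2 := Lv) (C' := CR) (B := B) ?_ hS hsp hHp' hHp' ?_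
      · exact { D := D, DG := D, R := R, j1 := j1, j2 := jsub_addk _ _ _ k1 (B1 + B2), j3 := j3, hL2 := hLv0, hL2L := hLvL,
                Vper := fun x k => by rw [show v (x + iv k) = v x from hvper x k]
                Vlip := fun x y => by rw [sub_sub_sub_cancel_right]; exact hvl' x y
                bu := hbu, bV := hVB, huV := fun x t ht => by have := hle2 x t ht; linarith
                hμ := hμ, hη := hη, hC' := hCR
                str := str_cvx H c CR L Lv μ hμ hLvL hCR.le hc hH1 }
      · rw [hDg]
        exact no_cvx H c L Lv μ η hμ hη _ hc hs
    · have hVB : ∀ x : E N, |(fun _ => -B) x| ≤ B := by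
        intro x; simp only [abs_neg, abs_of_nonneg hB0, le_refl]
      refine asym_of_WW (f := fun x t => u x t + c * t) (V := fun _ => -B) B μ0 hμ0 hbu hVB ?_
      intro μ η hμ hμ1 hμ2 hη
      refine WW_asym (sg := cols σm) (H := fun θ x p => H θ x p - c) (G := fun _ _ _ => 0) (Cs := N * C)
        (CR := CR) (L := L) (L2 := 0) (C' := CR) (B := B) ?_ hS hsp hHp' (fun _ _ _ _ => rfl) ?_
      · exact { D := D, DG := ⟨hCs, hsb, hsl, hCR.le, hL0.le, fun θ x y p q hp hq => by
                  rw [sub_self, abs_zero]; positivity⟩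
                R := R, j1 := j1, j2 := jsub_const _ (-B), j3 := j3, hL2 := le_rfl, hL2L := hL0.le,
                Vper := fun x k => rfl
                Vlip := fun x y => by simp
                bu := hbu, bV := hVB, huV := fun x t ht => (abs_le.1 (hbu x t ht)).1
                hμ := hμ, hη := hη, hC' := hCR
                str := str_H10 H c CR L μ hμ hμ2 hL0.le (fun θ x p => hi θ x p μ hμ hμ1) hH2 }
      · rw [hDg]
        refine no_H10 H c L μ η hμ hη _ K hK ?_ hHp (fun θ x p => hi θ x p μ hμ hμ1)
          (fun x hx hxK p hp => hs x hx hxK p hp μ hμ hμ1.le)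
        intro x hx k
        rw [← hDg] at hx ⊢
        intro θ c
        rw [hsp]; exact hx θ c
  obtain ⟨g, hgp, hgl, hgc⟩ := conv_of_asym D R j1 j3 B hbu hasym
  refine ⟨g, fun x k => hgp x k, ⟨_, abs_lip hL0.le hgl⟩, ⟨?_, ?_⟩, ?_⟩
  · exact erg_sub σm A hA H c (N * C) hCs hsb hsl hHlip _ R.cont g hgc j1
  · exact erg_sup σm A hA H c (N * C) hCs hsb hsl hHlip hHb _ R.cont g hgc j3
  · rw [Metric.tendstoUniformly_iff]
    intro ε hε
    obtain ⟨T, hT⟩ := hgc (ε / 2) (by linarith)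
    filter_upwards [eventually_ge_atTop T] with t ht x
    rw [dist_comm, Real.dist_eq]
    have := hT x t ht
    linarith

end LargeTimeBehavior
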